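/- Let d ≥ 1 and ρ ∈ (0,1). Let η = η₀ + η̃ be admissible with mean value η₀ = 0, with φ the C² bounded solution of Δφ = η̃, and suppose ψ := |∇φ|² is admissible with mean value ψ₀ > 0. Let W ∈ S_{2,ρ}(ℝ^d), and suppose there exist constants C, R ∈ (0,∞) such that W(x)² ≥ C|x|^{-2ρ} for all |x| ≥ R. Then N(E; ηW) / N_cl(E; -ψ₀W²) → 1 as E ↑ 0, and there exist constants c₁, c₂ ∈ (0,∞) and E₀ < 0 such that c₁|E|^{(d/2)(1 - 1/ρ)} ≤ N(E; ηW) ≤ c₂|E|^{(d/2)(1 - 1/ρ)} for all E ∈ (E₀, 0). -/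

import Mathlib

open MeasureTheory Filter Real Set Topology

noncomputable section

abbrev Ed (d : ℕ) := EuclideanSpace ℝ (Fin d)

/-- Glazman variational count of eigenvalues of `-Δ + V` below `E`. -/
noncomputable def schN (d : ℕ) (V : Ed d → ℝ) (E : ℝ) : ℕ∞ :=
  ⨆ F : {F : Submodule ℝ (Ed d → ℝ) //
      (∀ u ∈ F, ContDiff ℝ (⊤ : ℕ∞) u ∧ HasCompactSupport u) ∧
      (∀ u ∈ F, u ≠ 0 →
        (∫ x, (‖gradient u x‖ ^ 2 + V x * u x ^ 2)) < E * ∫ x, u x ^ 2)},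
    (Module.finrank ℝ F.1 : ℕ∞)

/-- Laplacian. -/
noncomputable def lap (d : ℕ) (φ : Ed d → ℝ) (x : Ed d) : ℝ :=
  ∑ i : Fin d, iteratedFDeriv ℝ 2 φ x ![EuclideanSpace.single i 1, EuclideanSpace.single i 1]

/-- The symbol class `S_{m,ρ}`. -/
def SClass (d m : ℕ) (ρ : ℝ) (W : Ed d → ℝ) : Prop :=
  ContDiff ℝ m W ∧ ∃ C : ℝ, 0 < C ∧ ∀ k : ℕ, k ≤ m → ∀ x : Ed d,
    ‖iteratedFDeriv ℝ k W x‖ ≤ C * (1 + ‖x‖) ^ (-ρ - (k : ℝ))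

/-- The cube `(-R/2, R/2)^d`. -/
def cube (d : ℕ) (R : ℝ) : Set (Ed d) := {x | ∀ i, |x i| < R / 2}

/-- Admissibility of `η` with mean value `η₀` witnessed by the solution `φ` of `Δφ = η - η₀`. -/
structure IsAdmissible (d : ℕ) (η : Ed d → ℝ) (η₀ : ℝ) (φ : Ed d → ℝ) : Prop where
  background_ne : ∃ x, η x ≠ η₀
  smooth : ContDiff ℝ 2 φ
  bounded : ∀ k : ℕ, k ≤ 2 → ∃ M : ℝ, ∀ x, ‖iteratedFDeriv ℝ k φ x‖ ≤ M
  poisson : ∀ x, lap d φ x = η x - η₀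
  normalized : Filter.limsup (fun R : ℝ => (∫ x in cube d R, φ x) / R ^ d) Filter.atTop = 0

/-- Volume of the unit ball of `ℝ^d`. -/
noncomputable def tau (d : ℕ) : ℝ := (volume (Metric.ball (0 : Ed d) 1)).toReal

/-- Semiclassical counting function. -/
noncomputable def Ncl (d : ℕ) (V : Ed d → ℝ) (E : ℝ) : ℝ :=
  (tau d / (2 * π) ^ d) * ∫ x, (max (E - V x) 0) ^ ((d : ℝ) / 2)


/-- partial derivative -/
def pd {d : ℕ} (i : Fin d) (f : Ed d → ℝ) (x : Ed d) : ℝ :=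
  fderiv ℝ f x (EuclideanSpace.single i 1)

/-- closed cube -/
def ccube {d : ℕ} (a : Ed d) (L : ℝ) : Set (Ed d) := {x | ∀ i, a i ≤ x i ∧ x i ≤ a i + L}

/-- half-open cube -/
def hcube {d : ℕ} (a : Ed d) (L : ℝ) : Set (Ed d) := {x | ∀ i, a i ≤ x i ∧ x i < a i + L}

lemma ccube_eq_preimage {d : ℕ} (a : Ed d) (L : ℝ) :
    ccube a L = (@WithLp.ofLp 2 (Fin d → ℝ)) ⁻¹' (Icc (fun i => a i) (fun i => a i + L)) := by
  ext x
  simp only [ccube, mem_ofPred_eq, mem_preimage, mem_Icc, Pi.le_def]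
  exact forall_and

lemma hcube_eq_preimage {d : ℕ} (a : Ed d) (L : ℝ) :
    hcube a L = (@WithLp.ofLp 2 (Fin d → ℝ)) ⁻¹'
      (univ.pi fun i => Ico (a i) (a i + L)) := by
  ext x
  simp [hcube, mem_preimage]

lemma measurableSet_hcube {d : ℕ} (a : Ed d) (L : ℝ) : MeasurableSet (hcube a L) := by
  rw [hcube_eq_preimage]
  exact (PiLp.volume_preserving_ofLp (Fin d)).measurable
    (MeasurableSet.univ_pi fun i => measurableSet_Ico)

lemma isCompact_ccube {d : ℕ} (a : Ed d) (L : ℝ) : IsCompact (ccube a L) := by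
  have h : ccube a L = (EuclideanSpace.equiv (Fin d) ℝ).toHomeomorph ⁻¹'
      (Icc (fun i => a i) (fun i => a i + L)) := ccube_eq_preimage a L
  rw [h, Homeomorph.isCompact_preimage]
  exact isCompact_Icc

lemma integrableOn_ccube {d : ℕ} {a : Ed d} {L : ℝ} {f : Ed d → ℝ} (hf : Continuous f) :
    IntegrableOn f (ccube a L) :=
  hf.continuousOn.integrableOn_compact (isCompact_ccube a L)

lemma hcube_ae_eq_ccube {d : ℕ} (a : Ed d) (L : ℝ) :
    (hcube a L : Set (Ed d)) =ᵐ[volume] ccube a L := by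
  rw [hcube_eq_preimage, ccube_eq_preimage]
  exact (PiLp.volume_preserving_ofLp (Fin d)).quasiMeasurePreserving.preimage_ae_eq
    Measure.univ_pi_Ico_ae_eq_Icc

lemma volume_hcube {d : ℕ} (a : Ed d) {L : ℝ} (hL : 0 ≤ L) :
    (volume (hcube a L)).toReal = L ^ d := by
  rw [hcube_eq_preimage, (PiLp.volume_preserving_ofLp (Fin d)).measure_preimage
    (MeasurableSet.univ_pi fun i => measurableSet_Ico).nullMeasurableSet, volume_pi_pi]
  simp [Real.volume_Ico, hL]

lemma integral_pd_ccube {d : ℕ} (a : Ed d) {L : ℝ} (hL : 0 ≤ L) (f : Ed d → ℝ)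
    (hf : ContDiff ℝ 1 f) (i : Fin d)
    (hb : ∀ x : Ed d, x i = a i ∨ x i = a i + L → f x = 0) :
    ∫ x in ccube a L, pd i f x = 0 := by
  obtain ⟨n, rfl⟩ : ∃ n, d = n + 1 := ⟨d - 1, by have := i.pos; omega⟩
  set eL : Ed (n+1) ≃L[ℝ] (Fin (n+1) → ℝ) := EuclideanSpace.equiv (Fin (n+1)) ℝ with heL
  have hmp : MeasurePreserving eL volume volume := PiLp.volume_preserving_ofLp (Fin (n+1))
  have he_emb : MeasurableEmbedding eL := eL.toHomeomorph.measurableEmbedding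
  have h1 : ccube a L = eL ⁻¹' (Icc (fun i => a i) (fun i => a i + L)) := ccube_eq_preimage a L
  have h2 : pd i f = fun x => (fun y => pd i f (eL.symm y)) (eL x) := by funext x; simp
  rw [h1, h2]
  rw [hmp.setIntegral_preimage_emb he_emb (fun y => pd i f (eL.symm y))]
  classical
  have key := integral_divergence_of_hasFDerivAt_off_countable' (E := ℝ)
    (fun i => a i) (fun i => a i + L) (fun i => by simp [hL])
    (fun j y => if j = i then f (eL.symm y) else 0)
    (fun j y => if j = i then (fderiv ℝ f (eL.symm y)).comp
      (eL.symm : (Fin (n+1) → ℝ) →L[ℝ] Ed (n+1)) else 0) ∅ (by simp) ?_ ?_ ?_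
  · have hs : ∀ y : Fin (n+1) → ℝ, (∑ j, (if j = i then (fderiv ℝ f (eL.symm y)).comp
      (eL.symm : (Fin (n+1) → ℝ) →L[ℝ] Ed (n+1)) else 0) (Pi.single j 1)) =
        pd i f (eL.symm y) := by
      intro y
      rw [Finset.sum_eq_single i]
      · simp [pd]; rfl
      · intro j _ hj; simp [hj]
      · simp
    simp_rw [hs] at key
    rw [key]
    apply Finset.sum_eq_zero
    intro j _
    by_cases hj : j = i
    · subst hj
      simp only [if_true]
      have h3 : ∀ y, f (eL.symm (j.insertNth (a j + L) y)) = 0 := by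
        intro y; apply hb; right
        change (j.insertNth (a j + L) y : Fin (n+1) → ℝ) j = _
        simp
      have h4 : ∀ y, f (eL.symm (j.insertNth (a j) y)) = 0 := by
        intro y; apply hb; left
        change (j.insertNth (a j) y : Fin (n+1) → ℝ) j = _
        simp
      simp [h3, h4]
    · simp [hj]
  · intro j
    split_ifs
    · exact (hf.continuous.comp eL.symm.continuous).continuousOn
    · exact continuousOn_const
  · intro x _ j
    split_ifs
    · exact ((hf.differentiable one_ne_zero _).hasFDerivAt.comp x
        (eL.symm : (Fin (n+1) → ℝ) →L[ℝ] Ed (n+1)).hasFDerivAt)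
    · exact hasFDerivAt_const _ _
  · apply ContinuousOn.integrableOn_compact isCompact_Icc
    apply Continuous.continuousOn
    apply continuous_finsetSum
    intro j _
    split_ifs
    · have := (hf.continuous_fderiv one_ne_zero).comp eL.symm.continuous
      exact (this.clm_comp continuous_const).clm_apply continuous_const
    · simpa using continuous_const

lemma continuous_pd {d : ℕ} {f : Ed d → ℝ} (hf : ContDiff ℝ 1 f) (i : Fin d) :
    Continuous (pd i f) :=
  (hf.continuous_fderiv one_ne_zero).clm_apply continuous_const

lemma pd_mul {d : ℕ} {f g : Ed d → ℝ} (hf : ContDiff ℝ 1 f) (hg : ContDiff ℝ 1 g)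
    (i : Fin d) (x : Ed d) :
    pd i (fun y => f y * g y) x = pd i f x * g x + f x * pd i g x := by
  unfold pd
  rw [fderiv_fun_mul (hf.differentiable one_ne_zero x) (hg.differentiable one_ne_zero x)]
  simp; ring

/-- tensor product function -/
def pr {d : ℕ} (F : Fin d → ℝ → ℝ) (x : Ed d) : ℝ := ∏ i, F i (x i)

lemma pd_pr {d : ℕ} (F F' : Fin d → ℝ → ℝ) (hF : ∀ j t, HasDerivAt (F j) (F' j t) t)
    (i : Fin d) (x : Ed d) :
    pd i (pr F) x = pr (Function.update F i (F' i)) x := by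
  classical
  have h1 : ∀ j ∈ Finset.univ, HasFDerivAt (fun y : Ed d => F j (y j))
      (F' j (x j) • (EuclideanSpace.proj j : Ed d →L[ℝ] ℝ)) x := by
    intro j _
    exact (hF j (x j)).comp_hasFDerivAt x (EuclideanSpace.proj j : Ed d →L[ℝ] ℝ).hasFDerivAt
  have h2 := HasFDerivAt.finsetProd h1
  unfold pd
  have h3 : pr F = fun y : Ed d => ∏ j, F j (y j) := rfl
  rw [h3, h2.fderiv]
  simp only [sum_apply, smul_apply]
  rw [Finset.sum_eq_single i]
  · simp only [pr]
    rw [← Finset.mul_prod_erase Finset.univ _ (Finset.mem_univ i)]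
    simp only [Function.update_self, smul_eq_mul]
    have h4 : ∏ j ∈ Finset.univ.erase i, Function.update F i (F' i) j (x j) =
        ∏ j ∈ Finset.univ.erase i, F j (x j) := by
      apply Finset.prod_congr rfl
      intro j hj
      rw [Function.update_of_ne (Finset.ne_of_mem_erase hj)]
    rw [h4]
    simp; ring
  · intro j _ hj
    simp [hj]
  · simp

lemma contDiff_pr {d : ℕ} (F : Fin d → ℝ → ℝ) {n : WithTop ℕ∞} (hF : ∀ j, ContDiff ℝ n (F j)) :
    ContDiff ℝ n (pr F) := by
  apply contDiff_prod
  intro j _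
  exact (hF j).comp (EuclideanSpace.proj j : Ed d →L[ℝ] ℝ).contDiff

lemma green {d : ℕ} (a : Ed d) {L : ℝ} (hL : 0 ≤ L) (F F' : Fin d → ℝ → ℝ) (lam : Fin d → ℝ)
    (hF : ∀ j t, HasDerivAt (F j) (F' j t) t)
    (hF' : ∀ j t, HasDerivAt (F' j) (-lam j * F j t) t)
    (u : Ed d → ℝ) (hu : ContDiff ℝ 1 u) (i : Fin d)
    (hb : ∀ x : Ed d, x i = a i ∨ x i = a i + L → u x * F' i (x i) = 0) :
    ∫ x in ccube a L, pd i u x * pd i (pr F) x = lam i * ∫ x in ccube a L, u x * pr F x := by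
  classical
  have hFc : ∀ j, ContDiff ℝ 1 (F j) := by
    intro j
    rw [contDiff_one_iff_deriv]
    refine ⟨fun t => (hF j t).differentiableAt, ?_⟩
    have : deriv (F j) = F' j := funext fun t => (hF j t).deriv
    rw [this]
    exact continuous_iff_continuousAt.2 fun t => (hF' j t).continuousAt
  have hFc' : ∀ j, ContDiff ℝ 1 (F' j) := by
    intro j
    rw [contDiff_one_iff_deriv]
    refine ⟨fun t => (hF' j t).differentiableAt, ?_⟩
    have : deriv (F' j) = fun t => -lam j * F j t := funext fun t => (hF' j t).deriv
    rw [this]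
    exact continuous_const.mul (hFc j).continuous
  set G := Function.update F i (F' i) with hG
  set G' := Function.update F' i (fun t => -lam i * F i t) with hG'
  have hGc : ∀ j, ContDiff ℝ 1 (G j) := by
    intro j
    by_cases hj : j = i
    · subst hj; simpa [hG] using hFc' j
    · simpa [hG, hj] using hFc j
  have hGd : ∀ j t, HasDerivAt (G j) (G' j t) t := by
    intro j t
    by_cases hj : j = i
    · subst hj; simpa [hG, hG'] using hF' j t
    · simpa [hG, hG', hj] using hF j t
  have e1 : ∀ x, pd i (pr F) x = pr G x := fun x => pd_pr F F' hF i x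
  have e2 : ∀ x, pd i (pr G) x = -lam i * pr F x := by
    intro x
    rw [pd_pr G G' hGd i x]
    simp only [pr]
    rw [← Finset.mul_prod_erase Finset.univ _ (Finset.mem_univ i),
      ← Finset.mul_prod_erase Finset.univ (fun i => F i (x i)) (Finset.mem_univ i)]
    rw [Finset.prod_congr rfl (g := fun j => F j (x j))]
    · simp [hG']; ring
    · intro j hj
      simp [hG, Finset.ne_of_mem_erase hj]
  have hprG : ContDiff ℝ 1 (pr G) := contDiff_pr G hGc
  have hprF : ContDiff ℝ 1 (pr F) := contDiff_pr F hFc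
  have key := integral_pd_ccube a hL (fun x => u x * pr G x) (hu.mul hprG) i (by
    intro x hx
    have h0 := hb x hx
    simp only [pr]
    rw [← Finset.mul_prod_erase Finset.univ _ (Finset.mem_univ i)]
    simp only [hG, Function.update_self]
    rw [← mul_assoc, h0, zero_mul])
  simp_rw [pd_mul hu hprG, e2] at key
  have hcu := continuous_pd hu i
  have hc1 := hprG.continuous
  have hc2 := hprF.continuous
  have hc3 := hu.continuous
  have i1 : IntegrableOn (fun x => pd i u x * pr G x) (ccube a L) :=
    integrableOn_ccube (by fun_prop)
  have i2 : IntegrableOn (fun x => u x * (-lam i * pr F x)) (ccube a L) :=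
    integrableOn_ccube (by fun_prop)
  rw [integral_add i1 i2] at key
  simp_rw [e1]
  have e3 : ∀ x, u x * (-lam i * pr F x) = -lam i * (u x * pr F x) := fun x => by ring
  simp_rw [e3, integral_const_mul] at key
  linarith

/-- Neumann eigenfunctions on the cube -/
def ecos {d : ℕ} (a : Ed d) (L : ℝ) (k : Fin d → ℕ) : Ed d → ℝ :=
  pr (fun i t => cos (π * k i / L * (t - a i)))

/-- Dirichlet / Neumann eigenvalues -/
def lamk {d : ℕ} (L : ℝ) (k : Fin d → ℕ) : ℝ := ∑ i, (π * k i / L) ^ 2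

lemma contDiff_ecos {d : ℕ} (a : Ed d) (L : ℝ) (k : Fin d → ℕ) {n : WithTop ℕ∞} :
    ContDiff ℝ n (ecos a L k) := by
  apply contDiff_pr
  intro j
  apply Real.contDiff_cos.comp
  fun_prop

lemma green_cos {d : ℕ} (a : Ed d) {L : ℝ} (hL : 0 < L) (k : Fin d → ℕ)
    (u : Ed d → ℝ) (hu : ContDiff ℝ 1 u) (i : Fin d) :
    ∫ x in ccube a L, pd i u x * pd i (ecos a L k) x =
      (π * k i / L) ^ 2 * ∫ x in ccube a L, u x * ecos a L k x := by
  unfold ecos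
  apply green a hL.le (fun i t => cos (π * k i / L * (t - a i)))
    (fun i t => -(π * k i / L) * sin (π * k i / L * (t - a i))) (fun i => (π * k i / L) ^ 2)
  · intro j t
    have h : HasDerivAt (fun t => π * k j / L * (t - a j)) (π * k j / L) t := by
      simpa using ((hasDerivAt_id t).sub_const (a j)).const_mul (π * k j / L)
    convert h.cos using 1
    ring
  · intro j t
    have h : HasDerivAt (fun t => π * k j / L * (t - a j)) (π * k j / L) t := by
      simpa using ((hasDerivAt_id t).sub_const (a j)).const_mul (π * k j / L)
    exact ((h.sin).const_mul (-(π * k j / L))).congr_deriv (by ring)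
  · exact hu
  · rintro x (hx | hx)
    · simp [hx]
    · have : π * k i / L * (x i - a i) = k i * π := by rw [hx]; field_simp; ring
      rw [this, Real.sin_nat_mul_pi]; simp

lemma ecos_ortho {d : ℕ} (a : Ed d) {L : ℝ} (hL : 0 < L) {k l : Fin d → ℕ} (hkl : k ≠ l) :
    ∫ x in ccube a L, ecos a L k x * ecos a L l x = 0 := by
  obtain ⟨i, hi⟩ := Function.ne_iff.1 hkl
  have h1 := green_cos a hL l (ecos a L k) (contDiff_ecos a L k) i
  have h2 := green_cos a hL k (ecos a L l) (contDiff_ecos a L l) i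
  simp_rw [mul_comm (pd i (ecos a L l) _), mul_comm (ecos a L l _)] at h2
  rw [h1] at h2
  have h3 : ((π * l i / L) ^ 2 - (π * k i / L) ^ 2) *
    ∫ x in ccube a L, ecos a L k x * ecos a L l x = 0 := by linarith
  rcases mul_eq_zero.1 h3 with h | h
  · exfalso
    have h4 : (π * l i / L) ^ 2 = (π * k i / L) ^ 2 := by linarith
    rw [sq_eq_sq₀ (by positivity) (by positivity)] at h4
    field_simp at h4
    exact hi (by exact_mod_cast h4.symm)
  · exact h

lemma ccube_pos_measure_aux {d : ℕ} (a : Ed d) {L : ℝ} (hL : 0 < L) (f : Ed d → ℝ)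
    (hf : Continuous f) (h0 : ∀ x, 0 ≤ f x) (x₀ : Ed d) (hx : ∀ i, a i < x₀ i ∧ x₀ i < a i + L)
    (hfx : f x₀ ≠ 0) : 0 < ∫ x in ccube a L, f x := by
  have hO : IsOpen {x : Ed d | ∀ i, a i < x i ∧ x i < a i + L} := by
    simp only [ofPred_forall]
    apply isOpen_iInter_of_finite
    intro i
    have hc : Continuous (fun x : Ed d => x i) := by fun_prop
    exact (isOpen_lt continuous_const hc).inter (isOpen_lt hc continuous_const)
  rw [setIntegral_pos_iff_support_of_nonneg_ae (Eventually.of_forall h0) (integrableOn_ccube hf)]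
  have hO2 : IsOpen ({x : Ed d | ∀ i, a i < x i ∧ x i < a i + L} ∩ Function.support f) :=
    hO.inter hf.isOpen_support
  refine lt_of_lt_of_le (hO2.measure_pos volume ⟨x₀, hx, hfx⟩) (measure_mono ?_)
  rintro x ⟨h1, h2⟩
  exact ⟨h2, fun i => ⟨(h1 i).1.le, (h1 i).2.le⟩⟩

lemma ecos_norm_pos {d : ℕ} (a : Ed d) {L : ℝ} (hL : 0 < L) (k : Fin d → ℕ) :
    0 < ∫ x in ccube a L, ecos a L k x * ecos a L k x := by
  -- a point close to the corner
  have hc := (contDiff_ecos (n := 0) a L k).continuous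
  have h1 : ecos a L k a = 1 := by simp [ecos, pr]
  have h2 : ∀ᶠ t in 𝓝[>] (0:ℝ), ecos a L k (a + t • WithLp.toLp 2 (fun _ => (1:ℝ))) ≠ 0 := by
    have : Tendsto (fun t : ℝ => ecos a L k (a + t • WithLp.toLp 2 (fun _ => (1:ℝ)))) (𝓝[>] 0)
        (𝓝 1) := by
      have h3 : Continuous (fun t : ℝ => ecos a L k (a + t • WithLp.toLp 2 (fun _ => (1:ℝ)))) := by
        fun_prop
      have h4 := h3.tendsto 0
      simp only [zero_smul, add_zero, h1] at h4
      exact h4.mono_left nhdsWithin_le_nhds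
    exact this.eventually_ne one_ne_zero
  obtain ⟨t, ht, ht1, ht2⟩ := (h2.and (Ioo_mem_nhdsGT hL)).exists
  apply ccube_pos_measure_aux a hL _ (by fun_prop) (fun x => mul_self_nonneg _)
    (a + t • WithLp.toLp 2 (fun _ => (1:ℝ)))
  · intro i
    simp [ht1, ht2]
  · exact mul_ne_zero ht ht

lemma ecos_update {d : ℕ} (a : Ed d) (L : ℝ) (k : Fin d → ℕ) (i : Fin d) (n : ℕ) (x : Ed d) :
    ecos a L (Function.update k i n) x = cos (π * n / L * (x i - a i)) *
      ∏ j ∈ Finset.univ.erase i, cos (π * k j / L * (x j - a j)) := by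
  unfold ecos pr
  rw [← Finset.mul_prod_erase Finset.univ _ (Finset.mem_univ i)]
  simp only [Function.update_self]
  congr 1
  apply Finset.prod_congr rfl
  intro j hj
  rw [Function.update_of_ne (Finset.ne_of_mem_erase hj)]

lemma ecos_dense {d : ℕ} (a : Ed d) {L : ℝ} (hL : 0 < L) (u : Ed d → ℝ) (hu : Continuous u)
    {ε : ℝ} (hε : 0 < ε) : ∃ (S : Finset (Fin d → ℕ)) (b : (Fin d → ℕ) → ℝ),
      ∀ x ∈ ccube a L, |u x - ∑ k ∈ S, b k * ecos a L k x| < ε := by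
  classical
  have : CompactSpace (ccube a L) := isCompact_iff_compactSpace.1 (isCompact_ccube a L)
  let eC : (Fin d → ℕ) → C(ccube a L, ℝ) := fun k =>
    ⟨fun x => ecos a L k x.1, (contDiff_ecos (n := 0) a L k).continuous.comp continuous_subtype_val⟩
  let c : Fin d → C(ccube a L, ℝ) := fun i =>
    ⟨fun x => cos (π / L * (x.1 i - a i)), by fun_prop⟩
  let A : Subalgebra ℝ C(ccube a L, ℝ) := Algebra.adjoin ℝ (range c)
  have hsep : A.SeparatesPoints := by
    intro x y hxy
    obtain ⟨i, hi⟩ : ∃ i, x.1 i ≠ y.1 i := by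
      by_contra h
      push Not at h
      exact hxy (Subtype.ext (by ext i; exact h i))
    refine ⟨c i, ⟨c i, Algebra.subset_adjoin ⟨i, rfl⟩, rfl⟩, ?_⟩
    intro h
    apply hi
    have hmem : ∀ z : ccube a L, π / L * (z.1 i - a i) ∈ Icc 0 π := by
      intro z
      have h1 := z.2 i
      constructor
      · have : 0 ≤ z.1 i - a i := by linarith [h1.1]
        positivity
      · rw [div_mul_eq_mul_div, div_le_iff₀ hL]
        apply mul_le_mul_of_nonneg_left _ Real.pi_pos.le
        linarith [h1.2]
    have h2 := Real.injOn_cos (hmem x) (hmem y) h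
    have hp : π / L ≠ 0 := by positivity
    have := mul_left_cancel₀ hp h2
    linarith
  obtain ⟨g, hg⟩ := ContinuousMap.exists_mem_subalgebra_near_continuous_of_separatesPoints A hsep
    (fun x : ccube a L => u x.1) (hu.comp continuous_subtype_val) ε hε
  have hspan : (g : C(ccube a L, ℝ)) ∈ Submodule.span ℝ (range eC) := by
    have h1 : (g : C(ccube a L, ℝ)) ∈ Subalgebra.toSubmodule A := g.2
    rw [Algebra.adjoin_eq_span] at h1
    refine (Submodule.span_le.2 ?_) h1
    have hmul : ∀ i, ∀ f ∈ Submodule.span ℝ (range eC), f * c i ∈ Submodule.span ℝ (range eC) := by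
      intro i f hf
      induction hf using Submodule.span_induction with
      | mem f hf =>
        obtain ⟨k, rfl⟩ := hf
        rcases Nat.eq_zero_or_pos (k i) with h0 | h0
        · have : eC k * c i = eC (Function.update k i 1) := by
            ext x
            change ecos a L k x.1 * cos (π / L * (x.1 i - a i)) =
              ecos a L (Function.update k i 1) x.1
            conv_lhs => rw [← Function.update_eq_self i k]
            rw [ecos_update, ecos_update, h0]
            simp; ring
          rw [this]
          exact Submodule.subset_span ⟨_, rfl⟩
        · have : eC k * c i = (1/2 : ℝ) • eC (Function.update k i (k i + 1)) +
              (1/2 : ℝ) • eC (Function.update k i (k i - 1)) := by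
            ext x
            change ecos a L k x.1 * cos (π / L * (x.1 i - a i)) =
              (1/2) * ecos a L (Function.update k i (k i + 1)) x.1 +
              (1/2) * ecos a L (Function.update k i (k i - 1)) x.1
            conv_lhs => rw [← Function.update_eq_self i k]
            rw [ecos_update, ecos_update, ecos_update]
            have e1 : π * ((k i + 1 : ℕ) : ℝ) / L * (x.1 i - a i) =
              π * k i / L * (x.1 i - a i) + π / L * (x.1 i - a i) := by push_cast; ring
            have e2 : π * ((k i - 1 : ℕ) : ℝ) / L * (x.1 i - a i) =
              π * k i / L * (x.1 i - a i) - π / L * (x.1 i - a i) := by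
              rw [Nat.cast_sub h0]; push_cast; ring
            rw [e1, e2, Real.cos_add, Real.cos_sub]
            ring
          rw [this]
          exact Submodule.add_mem _ (Submodule.smul_mem _ _ (Submodule.subset_span ⟨_, rfl⟩))
            (Submodule.smul_mem _ _ (Submodule.subset_span ⟨_, rfl⟩))
      | zero => simp
      | add f g _ _ hf hg => rw [add_mul]; exact Submodule.add_mem _ hf hg
      | smul r f _ hf => rw [smul_mul_assoc]; exact Submodule.smul_mem _ _ hf
    intro f hf
    induction hf using Submonoid.closure_induction_right with
    | one =>
      have : (1 : C(ccube a L, ℝ)) = eC 0 := by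
        ext x; simp [eC, ecos, pr]
      rw [this]
      exact Submodule.subset_span ⟨_, rfl⟩
    | mul_right x hx y hy h =>
      obtain ⟨i, rfl⟩ := hy
      exact hmul i _ h
  rw [Finsupp.mem_span_range_iff_exists_finsupp] at hspan
  obtain ⟨b, hb⟩ := hspan
  refine ⟨b.support, b, ?_⟩
  intro x hx
  have h1 := hg ⟨x, hx⟩
  rw [← hb] at h1
  have h2 : (b.sum fun i r => r • eC i) ⟨x, hx⟩ = ∑ k ∈ b.support, b k * ecos a L k x := by
    rw [Finsupp.sum, ContinuousMap.coe_sum, Finset.sum_apply]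
    rfl
  rw [h2, Real.norm_eq_abs, abs_sub_comm] at h1
  exact h1

lemma pd_sub {d : ℕ} {f g : Ed d → ℝ} (hf : ContDiff ℝ 1 f) (hg : ContDiff ℝ 1 g)
    (i : Fin d) (x : Ed d) :
    pd i (fun y => f y - g y) x = pd i f x - pd i g x := by
  unfold pd
  rw [fderiv_fun_sub (hf.differentiable one_ne_zero x) (hg.differentiable one_ne_zero x)]
  simp

lemma pd_sum {d : ℕ} {ι : Type*} (S : Finset ι) (b : ι → ℝ) (e : ι → Ed d → ℝ)
    (he : ∀ k, ContDiff ℝ 1 (e k)) (i : Fin d) (x : Ed d) :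
    pd i (fun y => ∑ k ∈ S, b k * e k y) x = ∑ k ∈ S, b k * pd i (e k) x := by
  unfold pd
  rw [fderiv_fun_sum (fun k _ => ((he k).differentiable one_ne_zero x).const_mul (b k))]
  simp only [sum_apply]
  apply Finset.sum_congr rfl
  intro k _
  rw [fderiv_const_mul ((he k).differentiable one_ne_zero x)]
  simp

lemma contDiff_lincomb {d : ℕ} {ι : Type*} (S : Finset ι) (b : ι → ℝ) (e : ι → Ed d → ℝ)
    {n : WithTop ℕ∞} (he : ∀ k, ContDiff ℝ n (e k)) :
    ContDiff ℝ n (fun y => ∑ k ∈ S, b k * e k y) :=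
  ContDiff.sum fun k _ => contDiff_const.mul (he k)

/-- Neumann (Poincare type) inequality on a cube. -/
lemma neumann_ineq {d : ℕ} (a : Ed d) {L : ℝ} (hL : 0 < L) (u : Ed d → ℝ) (hu : ContDiff ℝ 1 u)
    {m : ℝ} (hm : 0 ≤ m)
    (horth : ∀ k, lamk L k < m → ∫ x in ccube a L, u x * ecos a L k x = 0) :
    m * ∫ x in ccube a L, u x ^ 2 ≤ ∫ x in ccube a L, ∑ i, pd i u x ^ 2 := by
  classical
  set Q := ccube a L with hQ
  set e := ecos a L with he
  have hec : ∀ k, ContDiff ℝ 1 (e k) := fun k => contDiff_ecos a L k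
  have hec0 : ∀ k, Continuous (e k) := fun k => (hec k).continuous
  have huc := hu.continuous
  set c : (Fin d → ℕ) → ℝ := fun k => ∫ x in Q, u x * e k x with hc
  set w : (Fin d → ℕ) → ℝ := fun k => ∫ x in Q, e k x * e k x with hw
  have hwpos : ∀ k, 0 < w k := fun k => ecos_norm_pos a hL k
  have ip_sum_e : ∀ (S : Finset (Fin d → ℕ)) (b : (Fin d → ℕ) → ℝ) (f : Ed d → ℝ),
      Continuous f → ∫ x in Q, f x * ∑ k ∈ S, b k * e k x = ∑ k ∈ S, b k * ∫ x in Q, f x * e k x := by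
    intro S b f hf
    simp_rw [Finset.mul_sum]
    rw [integral_finsetSum]
    · apply Finset.sum_congr rfl
      intro k _
      rw [← integral_const_mul]
      congr 1; ext x; ring
    · intro k _
      have := hec0 k
      exact integrableOn_ccube (by fun_prop)
  have ip_p_e : ∀ (S : Finset (Fin d → ℕ)) (b : (Fin d → ℕ) → ℝ) (l : Fin d → ℕ), l ∈ S →
      ∫ x in Q, (∑ k ∈ S, b k * e k x) * e l x = b l * w l := by
    intro S b l hl
    simp_rw [mul_comm (∑ k ∈ S, b k * e k _) (e l _)]
    rw [ip_sum_e S b (e l) (hec0 l), Finset.sum_eq_single l]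
    · intro k _ hk
      rw [ecos_ortho a hL (Ne.symm hk), mul_zero]
    · intro h; exact absurd hl h
  -- energy
  have energy : ∀ S : Finset (Fin d → ℕ), ∑ k ∈ S, lamk L k * (c k ^ 2 / w k) ≤
      ∫ x in Q, ∑ i, pd i u x ^ 2 := by
    intro S
    set b : (Fin d → ℕ) → ℝ := fun k => c k / w k with hb
    set p : Ed d → ℝ := fun y => ∑ k ∈ S, b k * e k y with hp
    have hpc : ContDiff ℝ 1 p := contDiff_lincomb S b e hec
    have hpc0 := hpc.continuous
    rw [integral_finsetSum]
    swap
    · intro i _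
      have := continuous_pd hu i
      exact integrableOn_ccube (by fun_prop)
    unfold lamk
    simp_rw [Finset.sum_mul]
    rw [Finset.sum_comm]
    apply Finset.sum_le_sum
    intro i _
    have c1 := continuous_pd hu i
    have c2 := continuous_pd hpc i
    have c3 : ∀ k, Continuous (pd i (e k)) := fun k => continuous_pd (hec k) i
    have hsum : ∀ f : Ed d → ℝ, Continuous f → ∫ x in Q, f x * pd i p x =
        ∑ k ∈ S, b k * ∫ x in Q, f x * pd i (e k) x := by
      intro f hf
      simp_rw [hp, pd_sum S b e hec, Finset.mul_sum]
      rw [integral_finsetSum]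
      · apply Finset.sum_congr rfl
        intro k _
        rw [← integral_const_mul]
        congr 1; ext x; ring
      · intro k _
        have := c3 k
        exact integrableOn_ccube (by fun_prop)
    have h1 : ∫ x in Q, pd i u x * pd i p x = ∑ k ∈ S, (π * k i / L) ^ 2 * (c k ^ 2 / w k) := by
      rw [hsum _ c1]
      apply Finset.sum_congr rfl
      intro k _
      rw [green_cos a hL k u hu i]
      change c k / w k * (_ * c k) = _
      ring
    have h2 : ∫ x in Q, pd i p x * pd i p x = ∑ k ∈ S, (π * k i / L) ^ 2 * (c k ^ 2 / w k) := by
      rw [hsum _ c2]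
      apply Finset.sum_congr rfl
      intro k hk
      rw [green_cos a hL k p hpc i]
      rw [ip_p_e S b k hk]
      have := (hwpos k).ne'
      simp only [hb]
      field_simp
    have h3 : 0 ≤ ∫ x in Q, (pd i u x - pd i p x) ^ 2 := integral_nonneg fun x => sq_nonneg _
    have h4 : ∫ x in Q, (pd i u x - pd i p x) ^ 2 = (∫ x in Q, pd i u x ^ 2)
        - 2 * (∫ x in Q, pd i u x * pd i p x) + ∫ x in Q, pd i p x * pd i p x := by
      rw [← integral_const_mul, ← integral_sub, ← integral_add]
      · congr 1; ext x; ring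
      · exact integrableOn_ccube (by fun_prop)
      · exact integrableOn_ccube (by fun_prop)
      · exact integrableOn_ccube (by fun_prop)
      · exact integrableOn_ccube (by fun_prop)
    linarith
  -- completeness
  have complete : ∀ ε : ℝ, 0 < ε → ∃ S : Finset (Fin d → ℕ), ∫ x in Q, u x ^ 2 ≤
      ∑ k ∈ S, c k ^ 2 / w k + ε ^ 2 * (volume Q).toReal := by
    intro ε hε
    obtain ⟨S, b, hSb⟩ := ecos_dense a hL u huc hε
    refine ⟨S, ?_⟩
    set p : Ed d → ℝ := fun y => ∑ k ∈ S, b k * e k y with hp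
    have hpc : ContDiff ℝ 1 p := contDiff_lincomb S b e hec
    have hpc0 := hpc.continuous
    have h1 : ∫ x in Q, u x * p x = ∑ k ∈ S, b k * c k := ip_sum_e S b u huc
    have h2 : ∫ x in Q, p x * p x = ∑ k ∈ S, b k * (b k * w k) := by
      have := ip_sum_e S b p hpc0
      change ∫ x in Q, p x * p x = _ at this
      rw [this]
      apply Finset.sum_congr rfl
      intro k hk
      rw [ip_p_e S b k hk]
    have h4 : ∫ x in Q, (u x - p x) ^ 2 = (∫ x in Q, u x ^ 2)
        - 2 * (∫ x in Q, u x * p x) + ∫ x in Q, p x * p x := by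
      rw [← integral_const_mul, ← integral_sub, ← integral_add]
      · congr 1; ext x; ring
      · exact integrableOn_ccube (by fun_prop)
      · exact integrableOn_ccube (by fun_prop)
      · exact integrableOn_ccube (by fun_prop)
      · exact integrableOn_ccube (by fun_prop)
    have h5 : ∫ x in Q, (u x - p x) ^ 2 ≤ ε ^ 2 * (volume Q).toReal := by
      have : ∫ x in Q, (u x - p x) ^ 2 ≤ ∫ x in Q, ε ^ 2 := by
        apply setIntegral_mono_on
        · exact integrableOn_ccube (by fun_prop)
        · exact integrableOn_ccube (by fun_prop)
        · exact (isCompact_ccube a L).isClosed.measurableSet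
        · intro x hx
          have := (hSb x hx).le
          exact sq_le_sq' (by linarith [abs_le.1 this]) (abs_le.1 this).2
      simpa [Measure.real, mul_comm] using this
    have h6 : ∑ k ∈ S, (2 * (b k * c k) - b k * (b k * w k)) ≤ ∑ k ∈ S, c k ^ 2 / w k := by
      apply Finset.sum_le_sum
      intro k _
      have := hwpos k
      rw [le_div_iff₀ this]
      nlinarith [sq_nonneg (c k - b k * w k)]
    rw [Finset.sum_sub_distrib, ← Finset.mul_sum, ← h1, ← h2] at h6
    linarith
  apply le_of_forall_pos_le_add
  intro δ hδ
  set B := m * (volume Q).toReal + 1 with hB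
  have hBpos : 0 < B := by positivity
  obtain ⟨S, hS⟩ := complete (Real.sqrt (δ / B)) (by positivity)
  rw [Real.sq_sqrt (by positivity)] at hS
  have h1 : m * ∑ k ∈ S, c k ^ 2 / w k ≤ ∑ k ∈ S, lamk L k * (c k ^ 2 / w k) := by
    rw [Finset.mul_sum]
    apply Finset.sum_le_sum
    intro k _
    by_cases hk : lamk L k < m
    · have : c k = 0 := horth k hk
      simp [this]
    · apply mul_le_mul_of_nonneg_right (not_lt.1 hk)
      have := hwpos k
      positivity
  have h2 : m * (δ / B * (volume Q).toReal) ≤ δ := by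
    have : m * (δ / B * (volume Q).toReal) = δ * (m * (volume Q).toReal) / B := by ring
    rw [this, div_le_iff₀ hBpos]
    apply mul_le_mul_of_nonneg_left _ hδ.le
    linarith
  have h3 := mul_le_mul_of_nonneg_left hS hm
  have h4 := energy S
  rw [mul_add] at h3
  linarith

lemma negdef_open {ι : Type*} [Fintype ι] (A : ℕ → ι → ι → ℝ) (A0 : ι → ι → ℝ)
    (hA : ∀ i j, Tendsto (fun n => A n i j) atTop (𝓝 (A0 i j)))
    (h0 : ∀ c : ι → ℝ, c ≠ 0 → ∑ i, ∑ j, c i * c j * A0 i j < 0) :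
    ∀ᶠ n in atTop, ∀ c : ι → ℝ, c ≠ 0 → ∑ i, ∑ j, c i * c j * A n i j < 0 := by
  have hcpt : IsCompact (Metric.sphere (0 : ι → ℝ) 1) := isCompact_sphere _ _
  obtain ⟨κ, hκ, hκ2⟩ : ∃ κ : ℝ, 0 < κ ∧ ∀ c ∈ Metric.sphere (0 : ι → ℝ) 1,
      ∑ i, ∑ j, c i * c j * A0 i j ≤ -κ := by
    rcases (Metric.sphere (0 : ι → ℝ) 1).eq_empty_or_nonempty with h | h
    · exact ⟨1, one_pos, by simp [h]⟩
    · obtain ⟨c, hc, hmax⟩ := hcpt.exists_isMaxOn h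
        (f := fun c : ι → ℝ => ∑ i, ∑ j, c i * c j * A0 i j) (by fun_prop)
      refine ⟨-∑ i, ∑ j, c i * c j * A0 i j, ?_, ?_⟩
      · have := h0 c (by rintro rfl; simp at hc)
        linarith
      · intro c' hc'
        have := hmax hc'
        simp only [mem_ofPred_eq] at this
        linarith
  have hT : Tendsto (fun n => ∑ i, ∑ j, |A n i j - A0 i j|) atTop (𝓝 0) := by
    have h1 : Tendsto (fun n => ∑ i, ∑ j, |A n i j - A0 i j|) atTop
        (𝓝 (∑ i : ι, ∑ j : ι, |A0 i j - A0 i j|)) :=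
      tendsto_finsetSum _ fun i _ => tendsto_finsetSum _ fun j _ =>
        ((hA i j).sub_const _).abs
    simpa using h1
  filter_upwards [hT.eventually (gt_mem_nhds hκ)] with n hn c hc
  have hnorm : 0 < ‖c‖ := norm_pos_iff.2 hc
  set s : ι → ℝ := ‖c‖⁻¹ • c with hs
  have hsn : s ∈ Metric.sphere (0 : ι → ℝ) 1 := by
    simp [hs, norm_smul, hnorm.ne']
  have hs1 : ∀ i, |s i| ≤ 1 := by
    intro i
    have h1 := norm_le_pi_norm s i
    have h2 : ‖s‖ = 1 := by simpa using hsn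
    rw [h2] at h1
    exact h1
  have h1 : ∑ i, ∑ j, s i * s j * A n i j ≤
      ∑ i, ∑ j, s i * s j * A0 i j + ∑ i, ∑ j, |A n i j - A0 i j| := by
    rw [← Finset.sum_add_distrib]
    apply Finset.sum_le_sum; intro i _
    rw [← Finset.sum_add_distrib]
    apply Finset.sum_le_sum; intro j _
    have h2 : s i * s j * (A n i j - A0 i j) ≤ |A n i j - A0 i j| := by
      refine (le_abs_self _).trans ?_
      rw [abs_mul, abs_mul]
      have : |s i| * |s j| ≤ 1 := mul_le_one₀ (hs1 i) (abs_nonneg _) (hs1 j)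
      exact mul_le_of_le_one_left (abs_nonneg _) this
    linarith
  have h2 := hκ2 s hsn
  have h3 : ∑ i, ∑ j, s i * s j * A n i j < 0 := by linarith
  have h4 : ∑ i, ∑ j, c i * c j * A n i j = ‖c‖ ^ 2 * ∑ i, ∑ j, s i * s j * A n i j := by
    rw [Finset.mul_sum]
    apply Finset.sum_congr rfl; intro i _
    rw [Finset.mul_sum]
    apply Finset.sum_congr rfl; intro j _
    simp only [hs, Pi.smul_apply, smul_eq_mul]
    field_simp
  rw [h4]
  exact mul_neg_of_pos_of_neg (by positivity) h3

/-- quadratic form of the Schroedinger operator -/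
def bform {d : ℕ} (V : Ed d → ℝ) (f g : Ed d → ℝ) : ℝ :=
  ∫ x, (∑ i, pd i f x * pd i g x + V x * (f x * g x))

lemma pd_eq_zero_of_notMem {d : ℕ} {K : Set (Ed d)} (hK : IsClosed K) {f : Ed d → ℝ}
    (hf : ∀ x, x ∉ K → f x = 0) (i : Fin d) {x : Ed d} (hx : x ∉ K) : pd i f x = 0 := by
  have h1 : f =ᶠ[𝓝 x] fun _ => (0:ℝ) := by
    filter_upwards [hK.isOpen_compl.mem_nhds hx] with y hy
    exact hf y hy
  unfold pd
  rw [h1.fderiv_eq]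
  simp

lemma integrable_of_cont_zero {d : ℕ} {K : Set (Ed d)} (hK : IsCompact K) {f : Ed d → ℝ}
    (hf : Continuous f) (h0 : ∀ x, x ∉ K → f x = 0) : Integrable f :=
  hf.integrable_of_hasCompactSupport (HasCompactSupport.intro hK h0)

lemma bform_expand {d : ℕ} {ι : Type*} [Fintype ι] {V : Ed d → ℝ} (hV : Continuous V)
    {K : Set (Ed d)} (hK : IsCompact K) (f : ι → Ed d → ℝ) (hf : ∀ k, ContDiff ℝ 1 (f k))
    (h0 : ∀ k x, x ∉ K → f k x = 0) (c : ι → ℝ) :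
    bform V (fun y => ∑ k, c k * f k y) (fun y => ∑ k, c k * f k y) =
      ∑ k, ∑ l, c k * c l * bform V (f k) (f l) := by
  have h1 : ∀ x, (∑ i, pd i (fun y => ∑ k, c k * f k y) x * pd i (fun y => ∑ k, c k * f k y) x +
      V x * ((∑ k, c k * f k x) * (∑ k, c k * f k x))) =
      ∑ k, ∑ l, c k * c l * (∑ i, pd i (f k) x * pd i (f l) x + V x * (f k x * f l x)) := by
    intro x
    simp_rw [pd_sum _ _ _ hf, Finset.sum_mul_sum, mul_add, Finset.sum_add_distrib, Finset.mul_sum]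
    congr 1
    · rw [Finset.sum_comm]
      apply Finset.sum_congr rfl; intro k _
      rw [Finset.sum_comm]
      apply Finset.sum_congr rfl; intro l _
      apply Finset.sum_congr rfl; intro i _
      ring
    · apply Finset.sum_congr rfl; intro k _
      apply Finset.sum_congr rfl; intro l _
      ring
  unfold bform
  simp_rw [h1]
  have hIntg : ∀ k l, Integrable
      (fun x => c k * c l * (∑ i, pd i (f k) x * pd i (f l) x + V x * (f k x * f l x))) := by
    intro k l
    apply integrable_of_cont_zero hK
    · have a1 : ∀ i, Continuous (pd i (f k)) := fun i => continuous_pd (hf k) i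
      have a2 : ∀ i, Continuous (pd i (f l)) := fun i => continuous_pd (hf l) i
      have a3 := (hf k).continuous
      have a4 := (hf l).continuous
      fun_prop
    · intro x hx
      simp [pd_eq_zero_of_notMem hK.isClosed (h0 k) _ hx, h0 k x hx]
  rw [integral_finsetSum _ (fun k _ => integrable_finsetSum _ fun l _ => hIntg k l)]
  apply Finset.sum_congr rfl; intro k _
  rw [integral_finsetSum _ (fun l _ => hIntg k l)]
  apply Finset.sum_congr rfl; intro l _
  rw [integral_const_mul]

lemma bform_approx {d : ℕ} {ι : Type*} [Fintype ι] {V : Ed d → ℝ} (hV : Continuous V)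
    {K : Set (Ed d)} (hK : IsCompact K) (f : ι → ℕ → Ed d → ℝ)
    (hf : ∀ k n, ContDiff ℝ 1 (f k n)) (h0 : ∀ k n x, x ∉ K → f k n x = 0)
    (M : ℝ) (hM : ∀ k n x, |f k n x| ≤ M) (hM' : ∀ k n i x, |pd i (f k n) x| ≤ M)
    (F : ι → Ed d → ℝ) (P : ι → Fin d → Ed d → ℝ)
    (hF : ∀ k, ∀ᵐ x, Tendsto (fun n => f k n x) atTop (𝓝 (F k x)))
    (hP : ∀ k i, ∀ᵐ x, Tendsto (fun n => pd i (f k n) x) atTop (𝓝 (P k i x)))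
    (hneg : ∀ c : ι → ℝ, c ≠ 0 → ∑ k, ∑ l, c k * c l *
      (∫ x, (∑ i, P k i x * P l i x + V x * (F k x * F l x))) < 0) :
    ∃ n, ∀ c : ι → ℝ, c ≠ 0 →
      bform V (fun y => ∑ k, c k * f k n y) (fun y => ∑ k, c k * f k n y) < 0 := by
  obtain ⟨B, hB⟩ := hK.exists_bound_of_continuousOn hV.continuousOn
  have key := negdef_open (fun n k l => bform V (f k n) (f l n))
    (fun k l => ∫ x, (∑ i, P k i x * P l i x + V x * (F k x * F l x))) ?_ hneg
  · obtain ⟨n, hn⟩ := key.exists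
    refine ⟨n, fun c hc => ?_⟩
    rw [bform_expand hV hK (fun k => f k n) (fun k => hf k n) (fun k => h0 k n) c]
    exact hn c hc
  · intro k l
    unfold bform
    apply tendsto_integral_of_dominated_convergence
      (K.indicator fun _ => (d * (M * M) + |B| * (M * M) : ℝ))
    · intro n
      apply Continuous.aestronglyMeasurable
      have a1 : ∀ i, Continuous (pd i (f k n)) := fun i => continuous_pd (hf k n) i
      have a2 : ∀ i, Continuous (pd i (f l n)) := fun i => continuous_pd (hf l n) i
      have a3 := (hf k n).continuous
      have a4 := (hf l n).continuous
      fun_prop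
    · rw [integrable_indicator_iff hK.isClosed.measurableSet]
      exact continuousOn_const.integrableOn_compact hK
    · intro n
      apply Eventually.of_forall
      intro x
      by_cases hx : x ∈ K
      · have hM0 : 0 ≤ M := (abs_nonneg _).trans (hM k n x)
        rw [indicator_of_mem hx]
        refine (norm_add_le _ _).trans (add_le_add ?_ ?_)
        · refine (norm_sum_le _ _).trans ?_
          have : ∀ i ∈ (Finset.univ : Finset (Fin d)),
              ‖pd i (f k n) x * pd i (f l n) x‖ ≤ M * M := by
            intro i _
            rw [norm_mul]
            exact mul_le_mul (hM' k n i x) (hM' l n i x) (norm_nonneg _) hM0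
          refine (Finset.sum_le_sum this).trans ?_
          simp
        · rw [norm_mul, norm_mul]
          apply mul_le_mul ((hB x hx).trans (le_abs_self _)) _ (by positivity) (abs_nonneg _)
          exact mul_le_mul (hM k n x) (hM l n x) (norm_nonneg _) hM0
      · rw [indicator_of_notMem hx]
        simp [pd_eq_zero_of_notMem hK.isClosed (h0 k n) _ hx, h0 k n x hx]
    · have hP1 : ∀ᵐ x, ∀ i, Tendsto (fun n => pd i (f k n) x) atTop (𝓝 (P k i x)) :=
        ae_all_iff.2 (hP k)
      have hP2 : ∀ᵐ x, ∀ i, Tendsto (fun n => pd i (f l n) x) atTop (𝓝 (P l i x)) :=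
        ae_all_iff.2 (hP l)
      filter_upwards [hP1, hP2, hF k, hF l] with x h1 h2 h3 h4
      exact (tendsto_finsetSum _ fun i _ => (h1 i).mul (h2 i)).add
        ((h3.mul h4).const_mul _)

/-- open cube -/
def ocube {d : ℕ} (a : Ed d) (L : ℝ) : Set (Ed d) := {x | ∀ i, a i < x i ∧ x i < a i + L}

lemma ocube_eq_preimage {d : ℕ} (a : Ed d) (L : ℝ) :
    ocube a L = (@WithLp.ofLp 2 (Fin d → ℝ)) ⁻¹'
      (univ.pi fun i => Ioo (a i) (a i + L)) := by
  ext x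
  simp [ocube, mem_preimage]

lemma measurableSet_ocube {d : ℕ} (a : Ed d) (L : ℝ) : MeasurableSet (ocube a L) := by
  rw [ocube_eq_preimage]
  exact (PiLp.volume_preserving_ofLp (Fin d)).measurable
    (MeasurableSet.univ_pi fun i => measurableSet_Ioo)

lemma ocube_ae_eq_ccube {d : ℕ} (a : Ed d) (L : ℝ) :
    (ocube a L : Set (Ed d)) =ᵐ[volume] ccube a L := by
  rw [ocube_eq_preimage, ccube_eq_preimage]
  exact (PiLp.volume_preserving_ofLp (Fin d)).quasiMeasurePreserving.preimage_ae_eq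
    Measure.univ_pi_Ioo_ae_eq_Icc

/-- sine products -/
def esin {d : ℕ} (a : Ed d) (L : ℝ) (k : Fin d → ℕ) : Ed d → ℝ :=
  pr (fun i t => sin (π * k i / L * (t - a i)))

lemma contDiff_esin {d : ℕ} (a : Ed d) (L : ℝ) (k : Fin d → ℕ) {n : WithTop ℕ∞} :
    ContDiff ℝ n (esin a L k) := by
  apply contDiff_pr
  intro j
  apply Real.contDiff_sin.comp
  fun_prop

lemma hasDerivAt_sinfac (c a t : ℝ) :
    HasDerivAt (fun t => sin (c * (t - a))) (c * cos (c * (t - a))) t := by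
  have h : HasDerivAt (fun t => c * (t - a)) c t := by
    simpa using ((hasDerivAt_id t).sub_const a).const_mul c
  exact h.sin.congr_deriv (by ring)

lemma hasDerivAt_cosfac (c a t : ℝ) :
    HasDerivAt (fun t => c * cos (c * (t - a))) (-c^2 * sin (c * (t - a))) t := by
  have h : HasDerivAt (fun t => c * (t - a)) c t := by
    simpa using ((hasDerivAt_id t).sub_const a).const_mul c
  exact (h.cos.const_mul c).congr_deriv (by ring)

lemma esin_face {d : ℕ} (a : Ed d) {L : ℝ} (hL : 0 < L) (k : Fin d → ℕ) (i : Fin d) (x : Ed d)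
    (hx : x i = a i ∨ x i = a i + L) : esin a L k x = 0 := by
  unfold esin pr
  apply Finset.prod_eq_zero (Finset.mem_univ i)
  rcases hx with hx | hx
  · simp [hx]
  · rw [hx]
    have : π * k i / L * (a i + L - a i) = k i * π := by field_simp; ring
    beta_reduce
    rw [this, sin_nat_mul_pi]

lemma green_sin {d : ℕ} (a : Ed d) {L : ℝ} (hL : 0 < L) (k l : Fin d → ℕ) (i : Fin d) :
    ∫ x in ccube a L, pd i (esin a L l) x * pd i (esin a L k) x =
      (π * k i / L) ^ 2 * ∫ x in ccube a L, esin a L l x * esin a L k x := by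
  have := green a hL.le (fun i t => sin (π * k i / L * (t - a i)))
    (fun i t => (π * k i / L) * cos (π * k i / L * (t - a i))) (fun i => (π * k i / L) ^ 2)
    (fun j t => hasDerivAt_sinfac _ _ _) (fun j t => hasDerivAt_cosfac _ _ _)
    (esin a L l) (contDiff_esin a L l) i (fun x hx => by rw [esin_face a hL l i x hx, zero_mul])
  exact this

lemma esin_ortho {d : ℕ} (a : Ed d) {L : ℝ} (hL : 0 < L) {k l : Fin d → ℕ} (hkl : k ≠ l) :
    ∫ x in ccube a L, esin a L k x * esin a L l x = 0 := by
  obtain ⟨i, hi⟩ := Function.ne_iff.1 hkl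
  have h1 := green_sin a hL l k i
  have h2 := green_sin a hL k l i
  simp_rw [mul_comm (pd i (esin a L l) _), mul_comm (esin a L l _)] at h2
  rw [h1] at h2
  have h3 : ((π * l i / L) ^ 2 - (π * k i / L) ^ 2) *
    ∫ x in ccube a L, esin a L k x * esin a L l x = 0 := by linarith
  rcases mul_eq_zero.1 h3 with h | h
  · exfalso
    have h4 : (π * l i / L) ^ 2 = (π * k i / L) ^ 2 := by linarith
    rw [sq_eq_sq₀ (by positivity) (by positivity)] at h4
    field_simp at h4
    exact hi (by exact_mod_cast h4.symm)
  · exact h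

lemma esin_norm_pos {d : ℕ} (a : Ed d) {L : ℝ} (hL : 0 < L) (k : Fin d → ℕ) (hk : ∀ i, 1 ≤ k i) :
    0 < ∫ x in ccube a L, esin a L k x * esin a L k x := by
  have hc := (contDiff_esin (n := 0) a L k).continuous
  set s : ℝ := ((∑ i, k i : ℕ) : ℝ) with hs
  have hs0 : 0 ≤ s := by positivity
  have hks : ∀ i, (k i : ℝ) ≤ s := fun i => by
    rw [hs]; exact_mod_cast Finset.single_le_sum (f := k) (by simp) (Finset.mem_univ i)
  have hk1 : ∀ i, (1:ℝ) ≤ k i := fun i => by exact_mod_cast hk i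
  have ht0 : 0 < L / (2 * (1 + s)) := by positivity
  have ht1 : L / (2 * (1 + s)) < L := by
    rw [div_lt_iff₀ (by positivity)]; nlinarith
  apply ccube_pos_measure_aux a hL _ (hc.mul hc) (fun x => mul_self_nonneg _)
    (WithLp.toLp 2 (fun i => a i + L / (2 * (1 + s))))
  · intro i
    simp only
    constructor <;> linarith
  · apply mul_self_ne_zero.2
    unfold esin pr
    rw [Finset.prod_ne_zero_iff]
    intro i _
    apply ne_of_gt
    apply sin_pos_of_pos_of_lt_pi
    · have := hk1 i
      simp only [add_sub_cancel_left]
      positivity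
    · simp only [add_sub_cancel_left]
      have h1 : π * k i / L * (L / (2 * (1 + s))) = π * (k i / (2 * (1 + s))) := by
        field_simp
      rw [h1]
      have h2 : k i / (2 * (1 + s)) < 1 := by
        rw [div_lt_one (by positivity)]
        linarith [hks i]
      nlinarith [pi_pos]

/-- cut-off profile -/
def gcut (n : ℕ) (t : ℝ) : ℝ := min 1 ((n + 1) * max 0 (t * (1 - t)))

lemma continuous_gcut (n : ℕ) : Continuous (gcut n) := by unfold gcut; fun_prop

lemma gcut_nonneg (n : ℕ) (t : ℝ) : 0 ≤ gcut n t := by unfold gcut; positivity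
lemma gcut_le (n : ℕ) (t : ℝ) : gcut n t ≤ 1 := min_le_left _ _

lemma gcut_zero (n : ℕ) {t : ℝ} (ht : t ≤ 0 ∨ 1 ≤ t) : gcut n t = 0 := by
  have : t * (1 - t) ≤ 0 := by rcases ht with h | h <;> nlinarith
  unfold gcut; rw [max_eq_left this]; simp

lemma gcut_tendsto {t : ℝ} (h0 : 0 < t) (h1 : t < 1) :
    Tendsto (fun n => gcut n t) atTop (𝓝 1) := by
  have hp : 0 < t * (1 - t) := mul_pos h0 (by linarith)
  have h2 : Tendsto (fun n : ℕ => ((n:ℝ) + 1) * max 0 (t * (1 - t))) atTop atTop := by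
    rw [max_eq_right hp.le]
    exact (tendsto_atTop_add_const_right _ _ tendsto_natCast_atTop_atTop).atTop_mul_const hp
  apply tendsto_const_nhds.congr'
  filter_upwards [h2.eventually_ge_atTop 1] with n hn
  unfold gcut; rw [min_eq_left hn]

lemma gcut_mono (n : ℕ) (t : ℝ) : gcut 0 t ≤ gcut n t := by
  unfold gcut
  apply min_le_min_left
  apply mul_le_mul_of_nonneg_right _ (le_max_left _ _)
  simp

def Kcut (n : ℕ) (t : ℝ) : ℝ := ∫ s in (0:ℝ)..t, gcut n s

lemma hasDerivAt_Kcut (n : ℕ) (t : ℝ) : HasDerivAt (Kcut n) (gcut n t) t :=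
  intervalIntegral.integral_hasDerivAt_right ((continuous_gcut n).intervalIntegrable _ _)
    ((continuous_gcut n).stronglyMeasurableAtFilter _ _) (continuous_gcut n).continuousAt

lemma Kcut_of_nonpos (n : ℕ) {t : ℝ} (ht : t ≤ 0) : Kcut n t = 0 := by
  unfold Kcut
  rw [intervalIntegral.integral_congr (g := fun _ => 0)]
  · simp
  · intro s hs
    rw [uIcc_of_ge ht] at hs
    exact gcut_zero n (Or.inl hs.2)

lemma Kcut_of_ge (n : ℕ) {t : ℝ} (ht : 1 ≤ t) : Kcut n t = Kcut n 1 := by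
  unfold Kcut
  rw [← intervalIntegral.integral_add_adjacent_intervals (b := 1)
    ((continuous_gcut n).intervalIntegrable _ _) ((continuous_gcut n).intervalIntegrable _ _)]
  rw [intervalIntegral.integral_congr (a := 1) (g := fun _ => 0)]
  · simp
  · intro s hs
    rw [uIcc_of_le ht] at hs
    exact gcut_zero n (Or.inr hs.1)

lemma Kcut_tendsto {t : ℝ} (h0 : 0 ≤ t) (h1 : t ≤ 1) :
    Tendsto (fun n => Kcut n t) atTop (𝓝 t) := by
  have := intervalIntegral.tendsto_integral_filter_of_dominated_convergence (μ := volume)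
    (a := 0) (b := t) (F := fun n s => gcut n s) (f := fun _ => (1:ℝ)) (l := atTop) (fun _ => (1:ℝ))
    (Eventually.of_forall fun n => (continuous_gcut n).aestronglyMeasurable)
    (Eventually.of_forall fun n => Eventually.of_forall fun s _ => by
      rw [Real.norm_of_nonneg (gcut_nonneg n s)]; exact gcut_le n s)
    (by simp) ?_
  · simpa [Kcut] using this
  · have h2 : ∀ᵐ s : ℝ, s ≠ 1 := by simp [ae_iff, measure_singleton]
    filter_upwards [h2] with s hs hs2
    rw [uIoc_of_le h0] at hs2
    exact gcut_tendsto hs2.1 (lt_of_le_of_ne (hs2.2.trans h1) hs)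

lemma Kcut_zero_pos : 0 < Kcut 0 1 := by
  unfold Kcut
  apply intervalIntegral.intervalIntegral_pos_of_pos_on ((continuous_gcut 0).intervalIntegrable _ _)
  · intro s hs
    unfold gcut
    have : 0 < s * (1 - s) := mul_pos hs.1 (by linarith [hs.2])
    rw [max_eq_right this.le]
    simp [this]
  · norm_num

lemma Kcut_mono (n : ℕ) : Kcut 0 1 ≤ Kcut n 1 :=
  intervalIntegral.integral_mono (by norm_num) ((continuous_gcut 0).intervalIntegrable _ _)
    ((continuous_gcut n).intervalIntegrable _ _) (gcut_mono n)

/-- One-dimensional trial factor and its derivative -/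
def tf (a L : ℝ) (k : ℕ) (n : ℕ) (t : ℝ) : ℝ := sin (π * k * (Kcut n ((t - a) / L) / Kcut n 1))
def tf' (a L : ℝ) (k : ℕ) (n : ℕ) (t : ℝ) : ℝ :=
  cos (π * k * (Kcut n ((t - a) / L) / Kcut n 1)) * (π * k / L * (gcut n ((t - a) / L) / Kcut n 1))

lemma hasDerivAt_tf (a L : ℝ) (k n : ℕ) (t : ℝ) : HasDerivAt (tf a L k n) (tf' a L k n t) t := by
  have h1 : HasDerivAt (fun t : ℝ => (t - a) / L) (1 / L) t :=
    ((hasDerivAt_id t).sub_const a).div_const L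
  have h2 := (((hasDerivAt_Kcut n ((t - a) / L)).comp t h1).div_const (Kcut n 1)).const_mul (π * k)
  exact h2.sin.congr_deriv (by simp only [tf', Function.comp]; ring)

lemma continuous_tf' (a L : ℝ) (k n : ℕ) : Continuous (tf' a L k n) := by
  have h1 : Continuous (Kcut n) := continuous_iff_continuousAt.2 fun t =>
    (hasDerivAt_Kcut n t).continuousAt
  have h2 := continuous_gcut n
  unfold tf'
  fun_prop

lemma contDiff_tf (a L : ℝ) (k n : ℕ) : ContDiff ℝ 1 (tf a L k n) := by
  rw [contDiff_one_iff_deriv]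
  refine ⟨fun t => (hasDerivAt_tf a L k n t).differentiableAt, ?_⟩
  have : deriv (tf a L k n) = tf' a L k n := funext fun t => (hasDerivAt_tf a L k n t).deriv
  rw [this]; exact continuous_tf' a L k n

lemma out_aux {a L t : ℝ} (hL : 0 < L) (ht : ¬ (a < t ∧ t < a + L)) :
    (t - a) / L ≤ 0 ∨ 1 ≤ (t - a) / L := by
  by_cases h : a < t
  · right; rw [le_div_iff₀ hL]
    by_contra h2; exact ht ⟨h, by linarith⟩
  · left; apply div_nonpos_of_nonpos_of_nonneg <;> linarith

lemma tf_out {a L : ℝ} (hL : 0 < L) (k n : ℕ) {t : ℝ} (ht : ¬ (a < t ∧ t < a + L)) :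
    tf a L k n t = 0 := by
  have hp : Kcut n 1 ≠ 0 := (Kcut_zero_pos.trans_le (Kcut_mono n)).ne'
  unfold tf
  rcases out_aux hL ht with h | h
  · rw [Kcut_of_nonpos n h]; simp
  · rw [Kcut_of_ge n h, div_self hp, mul_one, mul_comm, sin_nat_mul_pi]

lemma tf'_out {a L : ℝ} (hL : 0 < L) (k n : ℕ) {t : ℝ} (ht : ¬ (a < t ∧ t < a + L)) :
    tf' a L k n t = 0 := by
  unfold tf'
  rw [gcut_zero n (out_aux hL ht)]; simp

lemma tf_tendsto {a L : ℝ} (hL : 0 < L) (k : ℕ) {t : ℝ} (h0 : a < t) (h1 : t < a + L) :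
    Tendsto (fun n => tf a L k n t) atTop (𝓝 (sin (π * k / L * (t - a)))) ∧
    Tendsto (fun n => tf' a L k n t) atTop (𝓝 (π * k / L * cos (π * k / L * (t - a)))) := by
  have e0 : 0 < (t - a) / L := div_pos (by linarith) hL
  have e1 : (t - a) / L < 1 := by rw [div_lt_one hL]; linarith
  have hK : Tendsto (fun n => π * k * (Kcut n ((t - a) / L) / Kcut n 1)) atTop
      (𝓝 (π * k * ((t - a) / L / 1))) :=
    ((Kcut_tendsto e0.le e1.le).div (Kcut_tendsto zero_le_one le_rfl) one_ne_zero).const_mul _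
  have he : π * k * ((t - a) / L / 1) = π * k / L * (t - a) := by field_simp
  rw [he] at hK
  refine ⟨(continuous_sin.tendsto _).comp hK, ?_⟩
  have h2 := ((gcut_tendsto e0 e1).div (Kcut_tendsto zero_le_one le_rfl) one_ne_zero).const_mul
    (π * k / L)
  have h3 := ((continuous_cos.tendsto _).comp hK).mul h2
  have he2 : cos (π * k / L * (t - a)) * (π * k / L * (1 / 1)) =
    π * k / L * cos (π * k / L * (t - a)) := by ring
  rw [he2] at h3
  exact h3

lemma tf_bound (a L : ℝ) (k n : ℕ) (t : ℝ) : |tf a L k n t| ≤ 1 := abs_sin_le_one _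

lemma tf'_bound (a : ℝ) {L : ℝ} (hL : 0 < L) (k n : ℕ) (t : ℝ) :
    |tf' a L k n t| ≤ π * k / L / Kcut 0 1 := by
  have hp := Kcut_zero_pos
  have hp2 := Kcut_mono n
  unfold tf'
  rw [abs_mul]
  have h1 : |π * k / L * (gcut n ((t - a) / L) / Kcut n 1)| ≤ π * k / L / Kcut 0 1 := by
    have hg := gcut_nonneg n ((t - a) / L)
    have hp3 : 0 < Kcut n 1 := by linarith
    rw [abs_of_nonneg (by positivity), div_eq_mul_one_div (π * k / L)]
    apply mul_le_mul_of_nonneg_left _ (by positivity)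
    exact div_le_div₀ zero_le_one (gcut_le _ _) hp hp2
  calc _ ≤ 1 * (π * k / L / Kcut 0 1) :=
        mul_le_mul (abs_cos_le_one _) h1 (abs_nonneg _) zero_le_one
    _ = _ := one_mul _

lemma pr_bound {d : ℕ} (F : Fin d → ℝ → ℝ) (M : ℝ) (hM : 1 ≤ M) (hF : ∀ j t, |F j t| ≤ M) (x : Ed d) :
    |pr F x| ≤ M ^ d := by
  unfold pr
  rw [Finset.abs_prod]
  calc _ ≤ ∏ _i : Fin d, M := Finset.prod_le_prod (fun i _ => abs_nonneg _) (fun i _ => hF i _)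
    _ = _ := by simp

/-- limit matrix on one tile -/
lemma esin_matrix {d : ℕ} (a : Ed d) {L : ℝ} (hL : 0 < L) (m : ℝ) (k l : Fin d → ℕ) :
    ∫ x in ccube a L, (∑ i, pd i (esin a L k) x * pd i (esin a L l) x +
      (-m) * (esin a L k x * esin a L l x)) =
    (lamk L l - m) * ∫ x in ccube a L, esin a L k x * esin a L l x := by
  have hk := (contDiff_esin (n := 1) a L k)
  have hl := (contDiff_esin (n := 1) a L l)
  have hkc := hk.continuous
  have hlc := hl.continuous
  have hpk := fun i => continuous_pd hk i
  have hpl := fun i => continuous_pd hl i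
  rw [integral_add (integrableOn_ccube (by fun_prop)) (integrableOn_ccube (by fun_prop)),
    integral_finsetSum _ (fun i _ => integrableOn_ccube (by fun_prop)), integral_const_mul]
  simp_rw [green_sin a hL]
  rw [← Finset.sum_mul]
  unfold lamk
  ring

lemma dir_trial {d : ℕ} (a : Ed d) {L : ℝ} (hL : 0 < L) (m : ℝ) (S : Finset (Fin d → ℕ))
    (hS : ∀ k ∈ S, (∀ i, 1 ≤ k i) ∧ lamk L k < m) :
    ∃ v : S → Ed d → ℝ, (∀ k, ContDiff ℝ 1 (v k)) ∧ (∀ k x, x ∉ ocube a L → v k x = 0) ∧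
      ∀ c : S → ℝ, c ≠ 0 →
        bform (fun _ => -m) (fun y => ∑ k, c k * v k y) (fun y => ∑ k, c k * v k y) < 0 := by
  classical
  let f : S → ℕ → Ed d → ℝ := fun k n => pr (fun i => tf (a i) L (k.1 i) n)
  have hfd : ∀ k n, ContDiff ℝ 1 (f k n) := fun k n => contDiff_pr _ (fun j => contDiff_tf _ _ _ _)
  have hf0 : ∀ k n x, x ∉ ocube a L → f k n x = 0 := by
    intro k n x hx
    simp only [ocube, mem_ofPred_eq, not_forall] at hx
    obtain ⟨i, hi⟩ := hx
    exact Finset.prod_eq_zero (Finset.mem_univ i) (tf_out hL _ _ hi)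
  have hpd : ∀ k n i x, pd i (f k n) x = pr (Function.update (fun i => tf (a i) L (k.1 i) n) i
      (tf' (a i) L (k.1 i) n)) x := fun k n i x =>
    pd_pr _ (fun i => tf' (a i) L (k.1 i) n) (fun j t => hasDerivAt_tf _ _ _ _ _) i x
  have hp0 : ∀ k n i x, x ∉ ocube a L → pd i (f k n) x = 0 := by
    intro k n i x hx
    simp only [ocube, mem_ofPred_eq, not_forall] at hx
    obtain ⟨j, hj⟩ := hx
    rw [hpd]
    apply Finset.prod_eq_zero (Finset.mem_univ j)
    by_cases h : j = i
    · subst h; simp only [Function.update_self]; exact tf'_out hL _ _ hj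
    · rw [Function.update_of_ne h]; exact tf_out hL _ _ hj
  have hpdl : ∀ (k : S) i x, pd i (esin a L k.1) x = pr (Function.update
      (fun i t => sin (π * k.1 i / L * (t - a i))) i
      (fun t => π * k.1 i / L * cos (π * k.1 i / L * (t - a i)))) x := fun k i x =>
    pd_pr _ (fun i t => π * k.1 i / L * cos (π * k.1 i / L * (t - a i)))
      (fun j t => hasDerivAt_sinfac _ _ _) i x
  set B : ℝ := 1 + ∑ k : S, ∑ i, (π * k.1 i / L / Kcut 0 1) with hB
  have hnn : ∀ (k : S) i, 0 ≤ (π * k.1 i / L / Kcut 0 1) := fun k i => by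
    have := Kcut_zero_pos; positivity
  have hB1 : 1 ≤ B := by
    have : 0 ≤ ∑ k : S, ∑ i, (π * k.1 i / L / Kcut 0 1) :=
      Finset.sum_nonneg fun k _ => Finset.sum_nonneg fun i _ => hnn k i
    linarith
  have hBk : ∀ (k : S) i, (π * k.1 i / L / Kcut 0 1) ≤ B := fun k i => by
    have h1 : (π * k.1 i / L / Kcut 0 1) ≤ ∑ i, (π * k.1 i / L / Kcut 0 1) :=
      Finset.single_le_sum (f := fun i => (π * k.1 i / L / Kcut 0 1)) (fun i _ => hnn k i) (Finset.mem_univ i)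
    have h2 := Finset.single_le_sum (f := fun k : S => ∑ i, (π * k.1 i / L / Kcut 0 1))
      (fun k _ => Finset.sum_nonneg fun i _ => hnn k i) (Finset.mem_univ k)
    linarith
  have happ := bform_approx (V := fun _ => -m) continuous_const (isCompact_ccube a L) f hfd
    (fun k n x hx => hf0 k n x (fun h => hx fun i => ⟨(h i).1.le, (h i).2.le⟩))
    (B ^ d) (fun k n x => pr_bound _ B hB1 (fun j t => (tf_bound _ _ _ _ _).trans hB1) x)
    (fun k n i x => by
      rw [hpd]
      apply pr_bound _ B hB1
      intro j t
      by_cases h : j = i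
      · subst h; simp only [Function.update_self]
        exact (tf'_bound _ hL _ _ _).trans (hBk k j)
      · rw [Function.update_of_ne h]; exact (tf_bound _ _ _ _ _).trans hB1)
    (fun k => (ocube a L).indicator (esin a L k.1))
    (fun k i => (ocube a L).indicator (pd i (esin a L k.1))) ?_ ?_ ?_
  · obtain ⟨n, hn⟩ := happ
    exact ⟨fun k => f k n, fun k => hfd k n, fun k x hx => hf0 k n x hx, hn⟩
  · intro k
    refine Eventually.of_forall fun x => ?_
    by_cases hx : x ∈ ocube a L
    · rw [indicator_of_mem hx]
      apply tendsto_finsetProd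
      intro i _
      exact (tf_tendsto hL (k.1 i) (hx i).1 (hx i).2).1
    · rw [indicator_of_notMem hx]
      simp_rw [hf0 _ _ x hx]
      exact tendsto_const_nhds
  · intro k i
    refine Eventually.of_forall fun x => ?_
    by_cases hx : x ∈ ocube a L
    · rw [indicator_of_mem hx, hpdl]
      simp_rw [hpd]
      apply tendsto_finsetProd
      intro j _
      by_cases h : j = i
      · subst h; simp only [Function.update_self]
        exact (tf_tendsto hL (k.1 j) (hx j).1 (hx j).2).2
      · simp only [Function.update_of_ne h]
        exact (tf_tendsto hL (k.1 j) (hx j).1 (hx j).2).1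
    · rw [indicator_of_notMem hx]
      simp_rw [hp0 _ _ _ x hx]
      exact tendsto_const_nhds
  · intro c hc
    have hIntg : ∀ k l : S, (∫ x, (∑ i, (ocube a L).indicator (pd i (esin a L k.1)) x *
        (ocube a L).indicator (pd i (esin a L l.1)) x + -m * ((ocube a L).indicator (esin a L k.1) x *
        (ocube a L).indicator (esin a L l.1) x))) =
        (lamk L l.1 - m) * ∫ x in ccube a L, esin a L k.1 x * esin a L l.1 x := by
      intro k l
      rw [← esin_matrix a hL m, ← setIntegral_congr_set (ocube_ae_eq_ccube a L),
        ← integral_indicator (measurableSet_ocube a L)]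
      congr 1
      funext x
      by_cases hx : x ∈ ocube a L
      · simp [indicator_of_mem hx]
      · simp [indicator_of_notMem hx]
    simp_rw [hIntg]
    have hdiag : ∀ k : S, ∑ l : S, c k * c l * ((lamk L l.1 - m) *
        ∫ x in ccube a L, esin a L k.1 x * esin a L l.1 x) =
        -(c k ^ 2 * ((m - lamk L k.1) * ∫ x in ccube a L, esin a L k.1 x * esin a L k.1 x)) := by
      intro k
      rw [Finset.sum_eq_single k]
      · ring
      · intro l _ hl
        rw [esin_ortho a hL (fun h => hl (Subtype.ext h.symm))]; ring
      · simp
    simp_rw [hdiag]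
    rw [Finset.sum_neg_distrib, neg_lt_zero]
    obtain ⟨k0, hk0⟩ := Function.ne_iff.1 hc
    have hpos : ∀ k : S, 0 < (m - lamk L k.1) * ∫ x in ccube a L, esin a L k.1 x * esin a L k.1 x :=
      fun k => mul_pos (by linarith [(hS k.1 k.2).2]) (esin_norm_pos a hL k.1 (hS k.1 k.2).1)
    apply Finset.sum_pos' (fun k _ => mul_nonneg (sq_nonneg _) (hpos k).le)
    exact ⟨k0, Finset.mem_univ _, mul_pos (by have : c k0 ≠ 0 := hk0
                                              positivity) (hpos k0)⟩

lemma norm_gradient_sq {d : ℕ} (u : Ed d → ℝ) (x : Ed d) :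
    ‖gradient u x‖ ^ 2 = ∑ i, pd i u x ^ 2 := by
  rw [EuclideanSpace.norm_sq_eq]
  apply Finset.sum_congr rfl
  intro i _
  have : pd i u x = (gradient u x) i := by
    unfold pd gradient
    rw [← InnerProductSpace.toDual_symm_apply (𝕜 := ℝ), EuclideanSpace.inner_single_right]
    simp
  rw [this, Real.norm_eq_abs, sq_abs]

lemma norm_pd_le {d : ℕ} (i : Fin d) (f : Ed d → ℝ) (x : Ed d) : |pd i f x| ≤ ‖fderiv ℝ f x‖ := by
  have := (fderiv ℝ f x).le_opNorm (EuclideanSpace.single i (1:ℝ))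
  simpa [pd] using this

lemma schN_form {d : ℕ} {V : Ed d → ℝ} (hV : Continuous V) (E : ℝ) {u : Ed d → ℝ}
    (hu : ContDiff ℝ 1 u) (hc : HasCompactSupport u) :
    (∫ x, (‖gradient u x‖ ^ 2 + V x * u x ^ 2)) - E * (∫ x, u x ^ 2) =
      bform (fun x => V x - E) u u := by
  have huc := hu.continuous
  have hpc := fun i => continuous_pd hu i
  have hK : IsCompact (tsupport u) := hc
  have hu0 : ∀ x, x ∉ tsupport u → u x = 0 := fun x hx => image_eq_zero_of_notMem_tsupport hx
  have hp0 : ∀ i x, x ∉ tsupport u → pd i u x = 0 := fun i x hx =>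
    pd_eq_zero_of_notMem hK.isClosed hu0 i hx
  unfold bform
  simp_rw [norm_gradient_sq]
  rw [← integral_const_mul, ← integral_sub]
  · congr 1; funext x
    simp_rw [pow_two]; ring
  · apply integrable_of_cont_zero hK (by fun_prop)
    intro x hx
    simp [hu0 x hx, hp0 _ x hx]
  · apply integrable_of_cont_zero hK (by fun_prop)
    intro x hx
    simp [hu0 x hx]

lemma schN_ge {d : ℕ} {ι : Type*} [Fintype ι] {V : Ed d → ℝ} (hV : Continuous V) (E : ℝ)
    (g : ι → Ed d → ℝ) (hg : ∀ k, ContDiff ℝ (⊤ : ℕ∞) (g k)) {K : Set (Ed d)} (hK : IsCompact K)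
    (h0 : ∀ k x, x ∉ K → g k x = 0)
    (hneg : ∀ c : ι → ℝ, c ≠ 0 → bform (fun x => V x - E)
      (fun y => ∑ k, c k * g k y) (fun y => ∑ k, c k * g k y) < 0) :
    (Fintype.card ι : ℕ∞) ≤ schN d V E := by
  let T : (ι → ℝ) →ₗ[ℝ] (Ed d → ℝ) :=
    { toFun := fun c => fun y => ∑ k, c k * g k y
      map_add' := by
        intro a b; funext y; simp [add_mul, Finset.sum_add_distrib]
      map_smul' := by
        intro a b; funext y; simp [Finset.mul_sum, mul_assoc] }
  have hT : ∀ c, T c = fun y => ∑ k, c k * g k y := fun c => rfl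
  have hinj : Function.Injective T := by
    rw [← LinearMap.ker_eq_bot, LinearMap.ker_eq_bot']
    intro c hc
    by_contra hne
    have h1 := hneg c hne
    rw [← hT, hc] at h1
    simp [bform, pd] at h1
  have hsm : ∀ c, ContDiff ℝ (⊤ : ℕ∞) (T c) := fun c => contDiff_lincomb _ _ _ hg
  have hcs : ∀ c, HasCompactSupport (T c) := fun c =>
    HasCompactSupport.intro hK (fun x hx => by simp [hT, h0 _ x hx])
  have hrank : Module.finrank ℝ (LinearMap.range T) = Fintype.card ι := by
    rw [LinearMap.finrank_range_of_inj hinj]; simp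
  unfold schN
  refine le_iSup_of_le ⟨LinearMap.range T, ?_, ?_⟩ ?_
  · rintro u ⟨c, rfl⟩
    exact ⟨hsm c, hcs c⟩
  · rintro u ⟨c, rfl⟩ hu
    have hc : c ≠ 0 := by rintro rfl; exact hu (map_zero T)
    have h1 := schN_form hV E ((hsm c).of_le (by exact_mod_cast le_top)) (hcs c)
    have h2 := hneg c hc
    rw [← hT, ← h1] at h2
    linarith
  · simp only [hrank]; exact le_rfl

lemma mollify {d : ℕ} {ι : Type*} [Fintype ι] {V : Ed d → ℝ} (hV : Continuous V)
    (f : ι → Ed d → ℝ) (hf : ∀ k, ContDiff ℝ 1 (f k)) {K : Set (Ed d)} (hK : IsCompact K)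
    (h0 : ∀ k x, x ∉ K → f k x = 0)
    (hneg : ∀ c : ι → ℝ, c ≠ 0 → bform V
      (fun y => ∑ k, c k * f k y) (fun y => ∑ k, c k * f k y) < 0) :
    ∃ (g : ι → Ed d → ℝ) (K' : Set (Ed d)), IsCompact K' ∧ (∀ k, ContDiff ℝ (⊤ : ℕ∞) (g k)) ∧
      (∀ k x, x ∉ K' → g k x = 0) ∧ ∀ c : ι → ℝ, c ≠ 0 → bform V
      (fun y => ∑ k, c k * g k y) (fun y => ∑ k, c k * g k y) < 0 := by
  classical
  let b : ℕ → ContDiffBump (0 : Ed d) := fun n =>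
    { rIn := 1 / (n + 2), rOut := 1 / (n + 1), rIn_pos := by positivity,
      rIn_lt_rOut := by gcongr; norm_num }
  have hb : ∀ n, (b n).rOut = 1 / ((n:ℝ) + 1) := fun n => rfl
  have hb0 : Tendsto (fun n => (b n).rOut) atTop (𝓝 0) := tendsto_one_div_add_atTop_nhds_zero_nat
  have hb1 : ∀ n, (b n).rOut ≤ 1 := fun n => by
    rw [hb, div_le_one (by positivity)]
    have : (0:ℝ) ≤ n := by positivity
    linarith
  have hfc : ∀ k, Continuous (f k) := fun k => (hf k).continuous
  have hfd : ∀ k, Continuous (fderiv ℝ (f k)) := fun k => (hf k).continuous_fderiv one_ne_zero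
  have hfs : ∀ k, HasCompactSupport (f k) := fun k => HasCompactSupport.intro hK (h0 k)
  let g : ι → ℕ → Ed d → ℝ := fun k n =>
    convolution ((b n).normed volume) (f k) (ContinuousLinearMap.lsmul ℝ ℝ) volume
  have hgs : ∀ k n, ContDiff ℝ (⊤ : ℕ∞) (g k n) := fun k n =>
    HasCompactSupport.contDiff_convolution_left _ (b n).hasCompactSupport_normed
      (b n).contDiff_normed (hfc k).locallyIntegrable
  have hgd : ∀ k n x, fderiv ℝ (g k n) x = convolution ((b n).normed volume) (fderiv ℝ (f k))
      (ContinuousLinearMap.lsmul ℝ ℝ) volume x := by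
    intro k n x
    have h1 := (HasCompactSupport.hasFDerivAt_convolution_right (ContinuousLinearMap.lsmul ℝ ℝ)
      (hfs k) (((b n).continuous_normed (μ := volume)).locallyIntegrable (μ := volume)) (hf k) x).fderiv
    rw [h1]
    unfold convolution
    congr 1
  have hKc : IsCompact (Metric.cthickening 1 K) := hK.cthickening
  have hg0 : ∀ k n x, x ∉ Metric.cthickening 1 K → g k n x = 0 := by
    intro k n x hx
    have hxK : ∀ y ∈ Metric.ball x (b n).rOut, f k y = 0 := by
      intro y hy
      apply h0
      intro hyK
      apply hx
      apply Metric.mem_cthickening_of_dist_le x y 1 K hyK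
      rw [dist_comm]
      exact (Metric.mem_ball.1 hy).le.trans (hb1 n)
    have hx0 := hxK x (Metric.mem_ball_self (b n).rOut_pos)
    have h1 := ContDiffBump.dist_normed_convolution_le (φ := b n) (μ := volume) (ε := 0)
      (hfc k).aestronglyMeasurable (x₀ := x) (fun y hy => by rw [hxK y hy, hx0]; simp)
    have h2 := dist_le_zero.1 h1
    rw [hx0] at h2
    exact h2
  have hbd : ∀ k, ∃ M, 0 ≤ M ∧ (∀ x, |f k x| ≤ M) ∧ ∀ x, ‖fderiv ℝ (f k) x‖ ≤ M := by
    intro k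
    obtain ⟨M1, h1⟩ := (hfs k).exists_bound_of_continuous (hfc k)
    obtain ⟨M2, h2⟩ := ((hfs k).fderiv ℝ).exists_bound_of_continuous (hfd k)
    exact ⟨max M1 M2, (norm_nonneg _).trans ((h1 0).trans (le_max_left _ _)),
      fun x => (h1 x).trans (le_max_left _ _),
      fun x => (h2 x).trans (le_max_right _ _)⟩
  choose M hM0 hM1 hM2 using hbd
  have hMs : ∀ k, M k ≤ ∑ k, M k := fun k =>
    Finset.single_le_sum (f := M) (fun k _ => hM0 k) (Finset.mem_univ k)
  have happ := bform_approx hV hKc g (fun k n => (hgs k n).of_le (by exact_mod_cast le_top)) hg0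
    (3 * ∑ k, M k) ?_ ?_ f (fun k i => pd i (f k)) ?_ ?_ ?_
  · obtain ⟨n, hn⟩ := happ
    exact ⟨fun k => g k n, _, hKc, fun k => hgs k n, fun k => hg0 k n, hn⟩
  · intro k n x
    have h1 := ContDiffBump.dist_normed_convolution_le (φ := b n) (μ := volume) (ε := 2 * M k)
      (hfc k).aestronglyMeasurable (x₀ := x) (fun y hy => by
        rw [Real.dist_eq]
        linarith [abs_sub (f k y) (f k x), hM1 k y, hM1 k x])
    rw [Real.dist_eq] at h1
    have h2 := abs_sub_abs_le_abs_sub (g k n x) (f k x)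
    linarith [hM1 k x, hMs k]
  · intro k n i x
    refine (norm_pd_le i _ x).trans ?_
    rw [hgd]
    have h1 := ContDiffBump.dist_normed_convolution_le (φ := b n) (μ := volume) (ε := 2 * M k)
      (hfd k).aestronglyMeasurable (x₀ := x) (fun y hy => by
        rw [dist_eq_norm]
        linarith [norm_sub_le (fderiv ℝ (f k) y) (fderiv ℝ (f k) x), hM2 k y, hM2 k x])
    rw [dist_eq_norm] at h1
    have h2 := norm_sub_norm_le (convolution ((b n).normed volume) (fderiv ℝ (f k))
      (ContinuousLinearMap.lsmul ℝ ℝ) volume x) (fderiv ℝ (f k) x)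
    linarith [hM2 k x, hMs k]
  · intro k
    exact Eventually.of_forall fun x =>
      ContDiffBump.convolution_tendsto_right_of_continuous hb0 (hfc k) x
  · intro k i
    refine Eventually.of_forall fun x => ?_
    unfold pd
    simp_rw [hgd]
    have h1 := ContDiffBump.convolution_tendsto_right_of_continuous (μ := volume) hb0 (hfd k) x
    exact ((ContinuousLinearMap.apply ℝ ℝ (EuclideanSpace.single i (1:ℝ))).continuous.tendsto _).comp h1
  · intro c hc
    have := hneg c hc
    rw [bform_expand hV hK f hf h0] at this
    exact this

/-- C¹ version of the lower bound -/
lemma schN_ge_C1 {d : ℕ} {ι : Type*} [Fintype ι] {V : Ed d → ℝ} (hV : Continuous V) (E : ℝ)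
    (f : ι → Ed d → ℝ) (hf : ∀ k, ContDiff ℝ 1 (f k)) {K : Set (Ed d)} (hK : IsCompact K)
    (h0 : ∀ k x, x ∉ K → f k x = 0)
    (hneg : ∀ c : ι → ℝ, c ≠ 0 → bform (fun x => V x - E)
      (fun y => ∑ k, c k * f k y) (fun y => ∑ k, c k * f k y) < 0) :
    (Fintype.card ι : ℕ∞) ≤ schN d V E := by
  obtain ⟨g, K', hK', hg, hg0, hgn⟩ := mollify (V := fun x => V x - E) (by fun_prop) f hf hK h0 hneg
  exact schN_ge hV E g hg hK' hg0 hgn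

/-- linear algebra upper bound -/
lemma schN_le {d : ℕ} {ι : Type*} [Fintype ι] {V : Ed d → ℝ} (hV : Continuous V) (E : ℝ)
    (w : ι → Ed d → ℝ) (S : ι → Set (Ed d)) (hw : ∀ i, Continuous (w i))
    (hpos : ∀ u : Ed d → ℝ, ContDiff ℝ 1 u → HasCompactSupport u →
      (∀ i, ∫ x in S i, u x * w i x = 0) → 0 ≤ bform (fun x => V x - E) u u) :
    schN d V E ≤ (Fintype.card ι : ℕ∞) := by
  unfold schN
  apply iSup_le
  rintro ⟨F, hF1, hF2⟩
  simp only
  have hIntg : ∀ u ∈ F, ∀ i, IntegrableOn (fun x => u x * w i x) (S i) := fun u hu i =>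
    ((((hF1 u hu).1.continuous).mul (hw i)).integrable_of_hasCompactSupport
      ((hF1 u hu).2.mul_right)).integrableOn
  let T : F →ₗ[ℝ] (ι → ℝ) :=
    { toFun := fun u i => ∫ x in S i, u.1 x * w i x
      map_add' := by
        intro u v; funext i
        simp only [Submodule.coe_add, Pi.add_apply, add_mul]
        exact integral_add (hIntg _ u.2 i) (hIntg _ v.2 i)
      map_smul' := by
        intro c u; funext i
        simp only [Submodule.coe_smul, Pi.smul_apply, smul_eq_mul, mul_assoc, RingHom.id_apply]
        exact integral_const_mul _ _ }
  have hinj : Function.Injective T := by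
    rw [← LinearMap.ker_eq_bot, LinearMap.ker_eq_bot']
    intro u hu
    by_contra hne
    have hne' : u.1 ≠ 0 := fun h => hne (Subtype.ext h)
    have h1 := hF2 u.1 u.2 hne'
    have hs := hF1 u.1 u.2
    have hs1 : ContDiff ℝ 1 u.1 := hs.1.of_le (by exact_mod_cast le_top)
    have h2 := hpos u.1 hs1 hs.2 (fun i => congrFun hu i)
    rw [← schN_form hV E hs1 hs.2] at h2
    linarith
  have := LinearMap.finrank_le_finrank_of_injective hinj
  simp only [Module.finrank_fintype_fun_eq_card] at this
  exact_mod_cast this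

/-- coordinate reflections -/
def refl' {d : ℕ} (σ : Fin d → Bool) : Ed d ≃ₗᵢ[ℝ] Ed d :=
  LinearIsometryEquiv.piLpCongrRight 2
    (fun i => if σ i then LinearIsometryEquiv.refl ℝ ℝ else LinearIsometryEquiv.neg ℝ)

lemma refl'_apply {d : ℕ} (σ : Fin d → Bool) (x : Ed d) (i : Fin d) :
    refl' σ x i = if σ i then x i else - x i := by
  unfold refl'
  rw [LinearIsometryEquiv.piLpCongrRight_apply]
  simp only
  split_ifs <;> simp

def posO (d : ℕ) : Set (Ed d) := {x | ∀ i, 0 < x i}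
def nnO (d : ℕ) : Set (Ed d) := {x | ∀ i, 0 ≤ x i}

lemma measurableSet_posO (d : ℕ) : MeasurableSet (posO d) := by
  have : posO d = ⋂ i, {x : Ed d | 0 < x i} := by ext x; simp [posO]
  rw [this]
  apply MeasurableSet.iInter
  intro i
  have hc : Continuous (fun x : Ed d => x i) := by fun_prop
  exact (isOpen_lt continuous_const hc).measurableSet

lemma measurableSet_nnO (d : ℕ) : MeasurableSet (nnO d) := by
  have : nnO d = ⋂ i, {x : Ed d | 0 ≤ x i} := by ext x; simp [nnO]
  rw [this]
  apply MeasurableSet.iInter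
  intro i
  have hc : Continuous (fun x : Ed d => x i) := by fun_prop
  exact (isClosed_le continuous_const hc).measurableSet

lemma vol_refl {d : ℕ} (σ : Fin d → Bool) (r : ℝ) (A : Set (Ed d)) (hA : MeasurableSet A) :
    volume (refl' σ ⁻¹' (A ∩ Metric.ball 0 r)) = volume (A ∩ Metric.ball 0 r) :=
  (refl' σ).measurePreserving.measure_preimage (hA.inter measurableSet_ball).nullMeasurableSet

lemma orthant_upper {d : ℕ} (r : ℝ) :
    2 ^ d * volume (posO d ∩ Metric.ball 0 r) ≤ volume (Metric.ball (0 : Ed d) r) := by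
  have h1 : ∑ σ : Fin d → Bool, volume (refl' σ ⁻¹' (posO d ∩ Metric.ball 0 r)) ≤
      volume (Metric.ball (0 : Ed d) r) := by
    rw [← measure_biUnion_finset]
    · apply measure_mono
      intro x hx
      simp only [Finset.mem_univ, iUnion_true, mem_iUnion] at hx
      obtain ⟨σ, h1, h2⟩ := hx
      simpa using h2
    · intro σ _ τ _ hne
      apply Set.disjoint_left.2
      intro x hx hy
      obtain ⟨i, hi⟩ := Function.ne_iff.1 hne
      have h1 := hx.1 i
      have h2 := hy.1 i
      rw [refl'_apply] at h1 h2
      cases h3 : σ i <;> cases h4 : τ i <;> simp_all <;> linarith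
    · intro σ _
      exact (refl' σ).continuous.measurable ((measurableSet_posO d).inter measurableSet_ball)
  simp_rw [vol_refl _ _ _ (measurableSet_posO d)] at h1
  simpa using h1

lemma orthant_lower {d : ℕ} (r : ℝ) :
    volume (Metric.ball (0 : Ed d) r) ≤ 2 ^ d * volume (nnO d ∩ Metric.ball 0 r) := by
  have h1 : volume (Metric.ball (0 : Ed d) r) ≤
      ∑ σ : Fin d → Bool, volume (refl' σ ⁻¹' (nnO d ∩ Metric.ball 0 r)) := by
    refine (measure_mono ?_).trans (measure_biUnion_finset_le Finset.univ _)
    intro x hx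
    simp only [Finset.mem_univ, iUnion_true, mem_iUnion]
    refine ⟨fun i => decide (0 ≤ x i), ?_, ?_⟩
    · intro i
      rw [refl'_apply]
      by_cases h : 0 ≤ x i
      · simp [h]
      · simp [h]; linarith
    · simpa using hx
  simp_rw [vol_refl _ _ _ (measurableSet_nnO d)] at h1
  simpa using h1

lemma tau_pos (d : ℕ) : 0 < tau d := by
  unfold tau
  apply ENNReal.toReal_pos
  · exact (Metric.measure_ball_pos volume _ one_pos).ne'
  · exact measure_ball_lt_top.ne

lemma vol_ball {d : ℕ} (hd : 1 ≤ d) {r : ℝ} (hr : 0 ≤ r) :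
    (volume (Metric.ball (0 : Ed d) r)).toReal = r ^ d * tau d := by
  haveI : Nonempty (Fin d) := ⟨⟨0, hd⟩⟩
  rw [Measure.addHaar_ball volume _ hr]
  simp [tau, ENNReal.toReal_mul, hr]

lemma vol_hcube' {d : ℕ} (a : Ed d) : volume (hcube a 1) = 1 := by
  have := volume_hcube a (L := 1) zero_le_one
  simp only [one_pow] at this
  rwa [ENNReal.toReal_eq_one_iff] at this

lemma vol_ocube' {d : ℕ} (a : Ed d) : volume (ocube a 1) = 1 := by
  rw [← vol_hcube' a]
  exact measure_congr ((ocube_ae_eq_ccube a 1).trans (hcube_ae_eq_ccube a 1).symm)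

lemma norm_ones {d : ℕ} (x y : Ed d) (h : ∀ i, |x i - y i| ≤ 1) : ‖x - y‖ ≤ √d := by
  rw [EuclideanSpace.norm_eq]
  apply Real.sqrt_le_sqrt
  calc ∑ i, ‖(x - y) i‖ ^ 2 ≤ ∑ i : Fin d, (1:ℝ) := by
        apply Finset.sum_le_sum
        intro i _
        have := h i
        simp only [PiLp.sub_apply, Real.norm_eq_abs]
        nlinarith [abs_nonneg (x i - y i)]
    _ = d := by simp

/-- natural point to Euclidean -/
def nE {d : ℕ} (k : Fin d → ℕ) : Ed d := WithLp.toLp 2 (fun i => (k i : ℝ))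

lemma nE_apply {d : ℕ} (k : Fin d → ℕ) (i : Fin d) : nE k i = k i := rfl

lemma lattice_upper {d : ℕ} (hd : 1 ≤ d) (S : Finset (Fin d → ℕ)) {s : ℝ} (hs : 0 ≤ s)
    (hS : ∀ k ∈ S, ‖nE k‖ < s) : (2:ℝ) ^ d * S.card ≤ (s + √d) ^ d * tau d := by
  have h1 : ∑ k ∈ S, volume (ocube (nE k) 1) ≤ volume (posO d ∩ Metric.ball 0 (s + √d)) := by
    rw [← measure_biUnion_finset]
    · apply measure_mono
      intro x hx
      simp only [mem_iUnion] at hx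
      obtain ⟨k, hk, hx⟩ := hx
      refine ⟨fun i => ?_, ?_⟩
      · have := (hx i).1
        rw [nE_apply] at this
        exact lt_of_le_of_lt (Nat.cast_nonneg _) this
      · rw [mem_ball_zero_iff]
        have h2 := norm_ones x (nE k) (fun i => by
          rw [abs_le]; constructor <;> linarith [(hx i).1, (hx i).2])
        have h3 := norm_sub_norm_le x (nE k)
        linarith [hS k hk]
    · intro k _ l _ hkl
      apply Set.disjoint_left.2
      intro x hx hy
      obtain ⟨i, hi⟩ := Function.ne_iff.1 hkl
      have a1 := hx i
      have a2 := hy i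
      simp only [nE_apply] at a1 a2
      apply hi
      have b1 : (k i : ℝ) < l i + 1 := by linarith
      have b2 : (l i : ℝ) < k i + 1 := by linarith
      have b3 : k i < l i + 1 := by exact_mod_cast b1
      have b4 : l i < k i + 1 := by exact_mod_cast b2
      omega
    · intro k _; exact measurableSet_ocube _ _
  simp only [vol_ocube', Finset.sum_const, nsmul_eq_mul, mul_one] at h1
  have h2 : (2:ENNReal) ^ d * S.card ≤ volume (Metric.ball (0 : Ed d) (s + √d)) :=
    (mul_le_mul_right h1 _).trans (orthant_upper _)
  have h3 := ENNReal.toReal_mono measure_ball_lt_top.ne h2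
  rw [vol_ball hd (by positivity)] at h3
  simpa using h3

lemma lattice_lower {d : ℕ} (hd : 1 ≤ d) (S : Finset (Fin d → ℕ)) {s : ℝ} (hs : √d ≤ s)
    (hS : ∀ k : Fin d → ℕ, (∀ i, 1 ≤ k i) → ‖nE k‖ < s → k ∈ S) :
    (s - √d) ^ d * tau d ≤ (2:ℝ) ^ d * S.card := by
  have h1 : volume (nnO d ∩ Metric.ball 0 (s - √d)) ≤
      ∑ k ∈ S, volume (hcube (nE k - WithLp.toLp 2 (fun _ => (1:ℝ))) 1) := by
    refine (measure_mono ?_).trans (measure_biUnion_finset_le _ _)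
    intro x hx
    simp only [mem_iUnion]
    have hfl : ∀ i, (⌊x i⌋₊ : ℝ) ≤ x i := fun i => Nat.floor_le (hx.1 i)
    have hfl2 : ∀ i, x i < (⌊x i⌋₊ : ℝ) + 1 := fun i => Nat.lt_floor_add_one _
    refine ⟨fun i => ⌊x i⌋₊ + 1, ?_, ?_⟩
    · apply hS
      · intro i; omega
      · have h2 := norm_ones (nE fun i => ⌊x i⌋₊ + 1) x (fun i => by
          simp only [nE_apply]; push_cast
          rw [abs_le]; constructor <;> linarith [hfl i, hfl2 i])
        have h3 := norm_sub_norm_le (nE fun i => ⌊x i⌋₊ + 1) x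
        have h4 := mem_ball_zero_iff.1 hx.2
        linarith
    · intro i
      simp only [PiLp.sub_apply, nE_apply]
      push_cast
      constructor <;> linarith [hfl i, hfl2 i]
  simp only [vol_hcube', Finset.sum_const, nsmul_eq_mul, mul_one] at h1
  have h2 : volume (Metric.ball (0 : Ed d) (s - √d)) ≤ (2:ENNReal) ^ d * S.card :=
    (orthant_lower _).trans (mul_le_mul_right h1 _)
  have h3 := ENNReal.toReal_mono (ENNReal.mul_ne_top (by simp) (by simp)) h2
  rw [vol_ball hd (by linarith)] at h3
  simpa using h3

lemma lamk_eq {d : ℕ} (L : ℝ) (k : Fin d → ℕ) : lamk L k = (π / L) ^ 2 * ‖nE k‖ ^ 2 := by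
  rw [EuclideanSpace.norm_sq_eq]
  unfold lamk
  rw [Finset.mul_sum]
  apply Finset.sum_congr rfl
  intro i _
  rw [nE_apply, Real.norm_eq_abs, sq_abs]; ring

lemma lamk_lt_iff {d : ℕ} {L m : ℝ} (hL : 0 < L) (k : Fin d → ℕ) :
    lamk L k < m ↔ ‖nE k‖ < L * √m / π := by
  have hp := pi_pos
  rw [lamk_eq, ← mul_pow, ← Real.lt_sqrt (by positivity), lt_div_iff₀ hp, div_mul_eq_mul_div,
    div_lt_iff₀ hL]
  constructor <;> intro h <;> linarith

lemma finite_lamk {d : ℕ} {L : ℝ} (hL : 0 < L) (m : ℝ) : {k : Fin d → ℕ | lamk L k < m}.Finite := by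
  apply (Set.finite_Iic (fun _ : Fin d => ⌊L * √m / π⌋₊)).subset
  intro k hk i
  rw [mem_ofPred_eq, lamk_lt_iff hL] at hk
  apply Nat.le_floor
  have := PiLp.norm_apply_le (nE k) i
  rw [nE_apply, Real.norm_natCast] at this
  linarith

/-- Neumann index set -/
def nset {d : ℕ} {L : ℝ} (hL : 0 < L) (m : ℝ) : Finset (Fin d → ℕ) := (finite_lamk hL m).toFinset

lemma mem_nset {d : ℕ} {L : ℝ} (hL : 0 < L) (m : ℝ) (k : Fin d → ℕ) :
    k ∈ nset hL m ↔ lamk L k < m := by simp [nset]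

open Classical in
/-- Dirichlet index set -/
def dset {d : ℕ} {L : ℝ} (hL : 0 < L) (m : ℝ) : Finset (Fin d → ℕ) :=
  (nset hL m).filter (fun k => ∀ i, 1 ≤ k i)

lemma mem_dset {d : ℕ} {L : ℝ} (hL : 0 < L) (m : ℝ) (k : Fin d → ℕ) :
    k ∈ dset hL m ↔ (∀ i, 1 ≤ k i) ∧ lamk L k < m := by
  simp [dset, mem_nset, and_comm]

lemma nset_card {d : ℕ} (hd : 1 ≤ d) {L : ℝ} (hL : 0 < L) (m : ℝ) :
    ((nset (d := d) hL m).card : ℝ) ≤ tau d / (2 * π) ^ d * (L * √m + π * √d) ^ d := by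
  have hp := pi_pos
  have h := lattice_upper hd (nset (d := d) hL m) (s := L * √m / π) (by positivity)
    (fun k hk => by rwa [mem_nset, lamk_lt_iff hL] at hk)
  have e : tau d / (2 * π) ^ d * (L * √m + π * √d) ^ d =
      ((L * √m / π + √d) ^ d * tau d) / 2 ^ d := by
    have : L * √m / π + √d = (L * √m + π * √d) / π := by field_simp
    rw [this, div_pow, mul_pow]; field_simp
  rw [e, le_div_iff₀ (by positivity)]
  linarith

lemma dset_card {d : ℕ} (hd : 1 ≤ d) {L : ℝ} (hL : 0 < L) (m : ℝ) :
    tau d / (2 * π) ^ d * (max 0 (L * √m - π * √d)) ^ d ≤ ((dset (d := d) hL m).card : ℝ) := by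
  have hp := pi_pos
  rcases le_or_gt (L * √m - π * √d) 0 with h0 | h0
  · rw [max_eq_left h0, zero_pow (by omega)]; simp
  · rw [max_eq_right h0.le]
    have h := lattice_lower hd (dset (d := d) hL m) (s := L * √m / π)
      (by rw [le_div_iff₀ hp]; linarith)
      (fun k hk hk2 => by rw [mem_dset, lamk_lt_iff hL]; exact ⟨hk, hk2⟩)
    have e : tau d / (2 * π) ^ d * (L * √m - π * √d) ^ d =
        ((L * √m / π - √d) ^ d * tau d) / 2 ^ d := by
      have : L * √m / π - √d = (L * √m - π * √d) / π := by field_simp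
      rw [this, div_pow, mul_pow]; field_simp
    rw [e, div_le_iff₀ (by positivity)]
    linarith

/-- one index contribution of the gauged form -/
def Tq (W φ w f c p v : ℝ) : ℝ :=
  (p + v * φ * w) ^ 2 + 2 * W ^ 2 * v * c * (p + v * φ * w) +
    (-(f * w) + 2 * W * (c * w) + 2 * W ^ 3 * (c * f)) * v ^ 2

set_option maxHeartbeats 1000000 in
lemma Tq_far {W φ w f c B δ : ℝ} (p v : ℝ) (hB : 1 ≤ B) (hδ0 : 0 ≤ δ) (hδ1 : δ ≤ 1) (hφ : |φ| ≤ B)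
    (hf : |f| ≤ B) (hc : |c| ≤ B) (hw : |w| ≤ δ * W ^ 2) (hW : |W| ≤ δ) :
    |Tq W φ w f c p v - p ^ 2| ≤ 2 * δ * p ^ 2 + 10 * B ^ 2 * δ * W ^ 2 * v ^ 2 := by
  set S : ℝ := |W| with hS
  have hS0 : 0 ≤ S := abs_nonneg _
  have hS1 : S ≤ 1 := hW.trans hδ1
  have hWS : W ^ 2 = S ^ 2 := (sq_abs W).symm
  rw [hWS] at hw ⊢
  set P : ℝ := |p| with hP
  set N : ℝ := |v| with hN
  have hP0 : 0 ≤ P := abs_nonneg _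
  have hN0 : 0 ≤ N := abs_nonneg _
  have hPP : p ^ 2 = P ^ 2 := (sq_abs p).symm
  have hNN : v ^ 2 = N ^ 2 := (sq_abs v).symm
  have e : Tq W φ w f c p v - p ^ 2 = 2 * (p * v * φ * w) + (v * φ * w) ^ 2 + 2 * (W ^ 2 * v * c * p)
      + 2 * (W ^ 2 * v ^ 2 * c * φ * w) - f * w * v ^ 2 + 2 * (W * c * w * v ^ 2)
      + 2 * (W ^ 3 * c * f * v ^ 2) := by unfold Tq; ring
  have hS2 : S ^ 2 ≤ 1 := by nlinarith
  have hS4 : S ^ 4 ≤ S ^ 2 := by nlinarith [sq_nonneg S]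
  have hS3 : S ^ 3 ≤ δ * S ^ 2 := by nlinarith [sq_nonneg S]
  have hw1 : |w| ≤ δ := hw.trans (by nlinarith)
  have b1 : |p * v * φ * w| ≤ P * N * B * (δ * S ^ 2) := by
    rw [abs_mul, abs_mul, abs_mul]; gcongr
  have b2 : |v * φ * w| ≤ N * B * (δ * S ^ 2) := by
    rw [abs_mul, abs_mul]; gcongr
  have b3 : |W ^ 2 * v * c * p| ≤ S ^ 2 * N * B * P := by
    rw [abs_mul, abs_mul, abs_mul, abs_pow]; gcongr
  have b4 : |W ^ 2 * v ^ 2 * c * φ * w| ≤ S ^ 2 * N ^ 2 * B * B * δ := by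
    rw [abs_mul, abs_mul, abs_mul, abs_mul, abs_pow, abs_pow]; gcongr
  have b5 : |f * w * v ^ 2| ≤ B * (δ * S ^ 2) * N ^ 2 := by
    rw [abs_mul, abs_mul, abs_pow]; gcongr
  have b6 : |W * c * w * v ^ 2| ≤ 1 * B * (δ * S ^ 2) * N ^ 2 := by
    rw [abs_mul, abs_mul, abs_mul, abs_pow]; gcongr
  have b7 : |W ^ 3 * c * f * v ^ 2| ≤ (δ * S ^ 2) * B * B * N ^ 2 := by
    rw [abs_mul, abs_mul, abs_mul, abs_pow, abs_pow]
    gcongr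
  -- clean up
  have hBB : B ≤ B ^ 2 := by nlinarith
  have hZ : 0 ≤ δ * S ^ 2 * N ^ 2 := by positivity
  have c1 : 2 * (P * N * B * (δ * S ^ 2)) ≤ δ * P ^ 2 + B ^ 2 * (δ * S ^ 2 * N ^ 2) := by
    have h1 : 2 * (P * N * B * S ^ 2) ≤ P ^ 2 + (N * B * S ^ 2) ^ 2 := by
      linarith [sq_nonneg (P - N * B * S ^ 2)]
    have h2 : (N * B * S ^ 2) ^ 2 ≤ B ^ 2 * (S ^ 2 * N ^ 2) := by
      have : (N * B * S ^ 2) ^ 2 = B ^ 2 * N ^ 2 * S ^ 4 := by ring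
      rw [this]
      have h0 : 0 ≤ B ^ 2 * N ^ 2 := by positivity
      linarith [mul_le_mul_of_nonneg_left hS4 h0]
    linarith [mul_le_mul_of_nonneg_left (h1.trans (add_le_add le_rfl h2)) hδ0]
  have c2 : (v * φ * w) ^ 2 ≤ B ^ 2 * (δ * S ^ 2 * N ^ 2) := by
    rw [← sq_abs (v * φ * w)]
    calc |v * φ * w| ^ 2 ≤ (N * B * (δ * S ^ 2)) ^ 2 := by gcongr
      _ = (B ^ 2 * N ^ 2) * (δ * S ^ 2) * (δ * S ^ 2) := by ring
      _ ≤ (B ^ 2 * N ^ 2) * (δ * S ^ 2) * (1 * 1) := by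
        apply mul_le_mul_of_nonneg_left _ (by positivity)
        exact mul_le_mul hδ1 hS2 (by positivity) zero_le_one
      _ = _ := by ring
  have c3 : 2 * (S ^ 2 * N * B * P) ≤ δ * P ^ 2 + B ^ 2 * (δ * S ^ 2 * N ^ 2) := by
    have h1 : 2 * (S * N * B * P) ≤ P ^ 2 + (S * N * B) ^ 2 := by
      linarith [sq_nonneg (P - S * N * B)]
    have h2 : 2 * (S ^ 2 * N * B * P) ≤ δ * (2 * (S * N * B * P)) := by
      have h0 : 0 ≤ S * N * B * P := by positivity
      linarith [mul_le_mul_of_nonneg_right hW h0]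
    linarith [mul_le_mul_of_nonneg_left h1 hδ0]
  have c4 : S ^ 2 * N ^ 2 * B * B * δ = B ^ 2 * (δ * S ^ 2 * N ^ 2) := by ring
  have c5 : B * (δ * S ^ 2) * N ^ 2 ≤ B ^ 2 * (δ * S ^ 2 * N ^ 2) := by
    linarith [mul_le_mul_of_nonneg_right hBB hZ]
  have c7 : (δ * S ^ 2) * B * B * N ^ 2 = B ^ 2 * (δ * S ^ 2 * N ^ 2) := by ring
  rw [e, hPP, hNN]
  rw [hNN] at b4 b5 b6 b7
  have c2' := sq_nonneg (v * φ * w)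
  have hfin : 2 * δ * P ^ 2 + 10 * B ^ 2 * δ * S ^ 2 * N ^ 2 =
    2 * (δ * P ^ 2) + 10 * (B ^ 2 * (δ * S ^ 2 * N ^ 2)) := by ring
  rw [hfin]
  set Z := B ^ 2 * (δ * S ^ 2 * N ^ 2) with hZdef
  rw [abs_le] at b1 b3 b4 b5 b6 b7 ⊢
  constructor
  · linarith [b1.1, b3.1, b4.1, b5.2, b6.1, b7.1]
  · linarith [b1.2, b3.2, b4.2, b5.1, b6.2, b7.2]

lemma Tq_core {W φ w f c B : ℝ} (p v : ℝ) (hB : 1 ≤ B) (hφ : |φ| ≤ B)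
    (hf : |f| ≤ B) (hc : |c| ≤ B) (hw : |w| ≤ B) (hW : |W| ≤ B) :
    p ^ 2 / 4 - 10 * B ^ 6 * v ^ 2 ≤ Tq W φ w f c p v := by
  set q := v * φ * w with hq
  set k := W ^ 2 * v * c with hk
  have h1 : Tq W φ w f c p v = (p + q) ^ 2 + 2 * k * (p + q) +
    (-(f * w) + 2 * W * (c * w) + 2 * W ^ 3 * (c * f)) * v ^ 2 := by unfold Tq; rw [hk]; ring
  have h2 : (p + q) ^ 2 / 2 - 2 * k ^ 2 ≤ (p + q) ^ 2 + 2 * k * (p + q) := by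
    nlinarith [sq_nonneg ((p + q) + 2 * k)]
  have h3 : p ^ 2 / 2 - q ^ 2 ≤ (p + q) ^ 2 := by nlinarith [sq_nonneg (p + 2 * q)]
  have hB0 : 0 ≤ B := by linarith
  have hq2 : q ^ 2 ≤ B ^ 6 * v ^ 2 := by
    rw [hq, ← sq_abs]
    calc |v * φ * w| ^ 2 ≤ (|v| * B * B) ^ 2 := by rw [abs_mul, abs_mul]; gcongr
      _ = B ^ 4 * v ^ 2 := by rw [← sq_abs v]; ring
      _ ≤ B ^ 6 * v ^ 2 := by
        apply mul_le_mul_of_nonneg_right _ (sq_nonneg _)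
        exact pow_le_pow_right₀ hB (by norm_num)
  have hk2 : k ^ 2 ≤ B ^ 6 * v ^ 2 := by
    rw [hk, ← sq_abs]
    calc |W ^ 2 * v * c| ^ 2 ≤ (B ^ 2 * |v| * B) ^ 2 := by rw [abs_mul, abs_mul, abs_pow]; gcongr
      _ = B ^ 6 * v ^ 2 := by rw [← sq_abs v]; ring
  have hr : |-(f * w) + 2 * W * (c * w) + 2 * W ^ 3 * (c * f)| ≤ 5 * B ^ 6 := by
    have a1 : |f * w| ≤ B ^ 6 := by
      calc |f * w| ≤ B * B := by rw [abs_mul]; gcongr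
        _ = B ^ 2 := by ring
        _ ≤ B ^ 6 := pow_le_pow_right₀ hB (by norm_num)
    have a2 : |W * (c * w)| ≤ B ^ 6 := by
      calc |W * (c * w)| ≤ B * (B * B) := by rw [abs_mul, abs_mul]; gcongr
        _ = B ^ 3 := by ring
        _ ≤ B ^ 6 := pow_le_pow_right₀ hB (by norm_num)
    have a3 : |W ^ 3 * (c * f)| ≤ B ^ 6 := by
      calc |W ^ 3 * (c * f)| ≤ B ^ 3 * (B * B) := by rw [abs_mul, abs_mul, abs_pow]; gcongr
        _ = B ^ 5 := by ring
        _ ≤ B ^ 6 := pow_le_pow_right₀ hB (by norm_num)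
    rw [abs_le] at *
    constructor <;> linarith [a1.1, a1.2, a2.1, a2.2, a3.1, a3.2]
  have hrv := mul_le_mul_of_nonneg_right (abs_le.1 hr).1 (sq_nonneg v)
  rw [h1]
  have : 0 ≤ B ^ 6 * v ^ 2 := by positivity
  nlinarith

/-- Standing hypotheses for the gauge transformation. -/
structure GH (d : ℕ) (η φ χ W : Ed d → ℝ) (ψ₀ B : ℝ) : Prop where
  φ2 : ContDiff ℝ 2 φ
  χ2 : ContDiff ℝ 2 χ
  W2 : ContDiff ℝ 2 W
  B1 : 1 ≤ B
  ψpos : 0 < ψ₀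
  bφ : ∀ x, |φ x| ≤ B
  bW : ∀ x, |W x| ≤ B
  bdφ : ∀ i x, |pd i φ x| ≤ B
  bdχ : ∀ i x, |pd i χ x| ≤ B
  bdW : ∀ i x, |pd i W x| ≤ B
  lapφ : ∀ x, ∑ i, pd i (pd i φ) x = η x
  lapχ : ∀ x, ∑ i, pd i (pd i χ) x = ∑ i, pd i φ x ^ 2 - ψ₀

lemma pd_contDiff {d : ℕ} {f : Ed d → ℝ} (hf : ContDiff ℝ 2 f) (i : Fin d) :
    ContDiff ℝ 1 (pd i f) :=
  (hf.fderiv_right (m := 1) (by norm_num)).clm_apply contDiff_const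

lemma lap_eq {d : ℕ} {f : Ed d → ℝ} (hf : ContDiff ℝ 2 f) (x : Ed d) :
    lap d f x = ∑ i, pd i (pd i f) x := by
  unfold lap
  apply Finset.sum_congr rfl
  intro i _
  rw [iteratedFDeriv_two_apply]
  simp only [Matrix.cons_val_zero, Matrix.cons_val_one]
  have h1 : DifferentiableAt ℝ (fderiv ℝ f) x :=
    (hf.fderiv_right (m := 1) (by norm_num)).differentiable one_ne_zero x
  unfold pd
  rw [fderiv_clm_apply h1 (differentiableAt_const _)]
  simp

lemma pd_exp {d : ℕ} {f : Ed d → ℝ} (hf : ContDiff ℝ 1 f) (i : Fin d) (x : Ed d) :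
    pd i (fun y => exp (f y)) x = exp (f x) * pd i f x := by
  unfold pd
  rw [fderiv_exp (hf.differentiable one_ne_zero x)]
  simp

lemma integral_pd_zero {d : ℕ} {f : Ed d → ℝ} (hf : ContDiff ℝ 1 f) {K : Set (Ed d)}
    (hK : IsCompact K) (h0 : ∀ x, x ∉ K → f x = 0) (i : Fin d) : ∫ x, pd i f x = 0 := by
  have hp := continuous_pd hf i
  have h := integral_mul_fderiv_eq_neg_fderiv_mul_of_integrable (𝕜 := ℝ) (μ := (volume : Measure (Ed d)))
    (f := fun _ => (1:ℝ)) (g := f)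
    (v := EuclideanSpace.single i (1:ℝ)) (by simp)
    (by simpa [pd, Function.comp_def] using integrable_of_cont_zero (f := fun x => pd i f x) hK hp (fun x hx => pd_eq_zero_of_notMem hK.isClosed h0 i hx))
    (by simpa using integrable_of_cont_zero hK hf.continuous h0)
    (fun x _ => differentiableAt_const _) (fun x _ => hf.differentiable one_ne_zero x)
  simpa [pd] using h

/-- gauged energy density -/
def hd {d : ℕ} (φ χ W : Ed d → ℝ) (ψ₀ e : ℝ) (v : Ed d → ℝ) (x : Ed d) : ℝ :=
  exp (2 * (W x * φ x)) * (∑ i, Tq (W x) (φ x) (pd i W x) (pd i φ x) (pd i χ x) (pd i v x) (v x) +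
    (e - ψ₀ * W x ^ 2) * v x ^ 2)

lemma continuous_hd {d : ℕ} {η φ χ W : Ed d → ℝ} {ψ₀ B : ℝ} (H : GH d η φ χ W ψ₀ B) (e : ℝ)
    {v : Ed d → ℝ} (hv : ContDiff ℝ 1 v) : Continuous (hd φ χ W ψ₀ e v) := by
  have h1 := H.φ2.continuous
  have h2 := H.W2.continuous
  have h3 := hv.continuous
  have h4 := fun i => continuous_pd (H.φ2.of_le one_le_two) i
  have h5 := fun i => continuous_pd (H.χ2.of_le one_le_two) i
  have h6 := fun i => continuous_pd (H.W2.of_le one_le_two) i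
  have h7 := fun i => continuous_pd hv i
  unfold hd Tq
  fun_prop

lemma hd_zero {d : ℕ} (φ χ W : Ed d → ℝ) (ψ₀ e : ℝ) {v : Ed d → ℝ} {K : Set (Ed d)}
    (hK : IsClosed K) (h0 : ∀ x, x ∉ K → v x = 0) {x : Ed d} (hx : x ∉ K) :
    hd φ χ W ψ₀ e v x = 0 := by
  simp [hd, Tq, h0 x hx, pd_eq_zero_of_notMem hK h0 _ hx]

lemma continuous_eta {d : ℕ} {η φ χ W : Ed d → ℝ} {ψ₀ B : ℝ} (H : GH d η φ χ W ψ₀ B) :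
    Continuous η := by
  have : η = fun x => ∑ i, pd i (pd i φ) x := funext fun x => (H.lapφ x).symm
  rw [this]
  have := fun i => continuous_pd (pd_contDiff H.φ2 i) i
  fun_prop

lemma gauge_id {d : ℕ} {η φ χ W : Ed d → ℝ} {ψ₀ B : ℝ} (H : GH d η φ χ W ψ₀ B) (e : ℝ)
    {v : Ed d → ℝ} (hv : ContDiff ℝ 1 v) {K : Set (Ed d)}
    (hK : IsCompact K) (h0 : ∀ x, x ∉ K → v x = 0) :
    bform (fun x => η x * W x - (-e)) (fun y => exp (W y * φ y) * v y)
      (fun y => exp (W y * φ y) * v y) = ∫ x, hd φ χ W ψ₀ e v x := by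
  have hφ1 : ContDiff ℝ 1 φ := H.φ2.of_le one_le_two
  have hχ1 : ContDiff ℝ 1 χ := H.χ2.of_le one_le_two
  have hW1 : ContDiff ℝ 1 W := H.W2.of_le one_le_two
  set G : Ed d → ℝ := fun y => W y * φ y with hG
  have hG1 : ContDiff ℝ 1 G := hW1.mul hφ1
  have hE1 : ContDiff ℝ 1 (fun y => exp (G y)) := hG1.exp
  set u : Ed d → ℝ := fun y => exp (G y) * v y with hu
  have hu1 : ContDiff ℝ 1 u := hE1.mul hv
  have hpu : ∀ i x, pd i u x = exp (G x) * (pd i v x + v x * (pd i W x * φ x + W x * pd i φ x)) := by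
    intro i x
    rw [hu, pd_mul hE1 hv, pd_exp hG1, hG, pd_mul hW1 hφ1]; ring
  have hu0 : ∀ x, x ∉ K → u x = 0 := fun x hx => by simp [hu, h0 x hx]
  -- the divergence fields
  let X : Fin d → Ed d → ℝ := fun i y => pd i φ y * (W y * (u y * u y)) -
    pd i χ y * ((W y * W y) * (u y * u y))
  have huu : ContDiff ℝ 1 (fun y => u y * u y) := hu1.mul hu1
  have hWuu : ContDiff ℝ 1 (fun y => W y * (u y * u y)) := hW1.mul huu
  have hWW : ContDiff ℝ 1 (fun y => W y * W y) := hW1.mul hW1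
  have hWWuu : ContDiff ℝ 1 (fun y => (W y * W y) * (u y * u y)) := hWW.mul huu
  have hX1 : ∀ i, ContDiff ℝ 1 (X i) := fun i =>
    ((pd_contDiff H.φ2 i).mul hWuu).sub ((pd_contDiff H.χ2 i).mul hWWuu)
  have hX0 : ∀ i x, x ∉ K → X i x = 0 := fun i x hx => by simp [X, hu0 x hx]
  have hpX : ∀ i x, pd i (X i) x = pd i (pd i φ) x * (W x * (u x * u x)) +
      pd i φ x * (pd i W x * (u x * u x) + W x * (pd i u x * u x + u x * pd i u x)) -
      (pd i (pd i χ) x * ((W x * W x) * (u x * u x)) + pd i χ x *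
        ((pd i W x * W x + W x * pd i W x) * (u x * u x) +
          (W x * W x) * (pd i u x * u x + u x * pd i u x))) := by
    intro i x
    have e1 : X i = fun y => (fun y => pd i φ y * (W y * (u y * u y))) y -
      (fun y => pd i χ y * ((W y * W y) * (u y * u y))) y := rfl
    rw [e1, pd_sub ((pd_contDiff H.φ2 i).mul hWuu) ((pd_contDiff H.χ2 i).mul hWWuu),
      pd_mul (pd_contDiff H.φ2 i) hWuu, pd_mul hW1 huu, pd_mul hu1 hu1,
      pd_mul (pd_contDiff H.χ2 i) hWWuu, pd_mul hWW huu, pd_mul hW1 hW1, pd_mul hu1 hu1]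
  have hpt : ∀ x, (∑ i, pd i u x * pd i u x + (η x * W x - (-e)) * (u x * u x)) =
      hd φ χ W ψ₀ e v x + ∑ i, pd i (X i) x := by
    intro x
    have hE2 : exp (2 * (W x * φ x)) = exp (G x) * exp (G x) := by
      rw [← exp_add]; congr 1; simp only [hG]; ring
    have hux : u x = exp (G x) * v x := rfl
    simp only [hpX]
    unfold hd
    rw [hE2]
    have l1 := H.lapφ x
    have l2 := H.lapχ x
    set g := exp (G x) with hg
    have r1 : ∑ i, (pd i (pd i φ) x * (W x * (u x * u x)) +
      pd i φ x * (pd i W x * (u x * u x) + W x * (pd i u x * u x + u x * pd i u x)) -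
      (pd i (pd i χ) x * ((W x * W x) * (u x * u x)) + pd i χ x *
        ((pd i W x * W x + W x * pd i W x) * (u x * u x) +
          (W x * W x) * (pd i u x * u x + u x * pd i u x)))) =
      (∑ i, pd i (pd i φ) x) * (W x * (u x * u x)) -
      (∑ i, pd i (pd i χ) x) * ((W x * W x) * (u x * u x)) +
      ∑ i, (pd i φ x * (pd i W x * (u x * u x) + W x * (pd i u x * u x + u x * pd i u x)) -
      pd i χ x *
        ((pd i W x * W x + W x * pd i W x) * (u x * u x) +
          (W x * W x) * (pd i u x * u x + u x * pd i u x))) := by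
      rw [Finset.sum_mul, Finset.sum_mul, ← Finset.sum_sub_distrib, ← Finset.sum_add_distrib]
      apply Finset.sum_congr rfl
      intro i _; ring
    rw [r1, l1, l2]
    have r2 : ∀ i, pd i u x * pd i u x = g * g * Tq (W x) (φ x) (pd i W x) (pd i φ x) (pd i χ x) (pd i v x) (v x)
       - pd i φ x ^ 2 * ((W x * W x) * (u x * u x)) +
       (pd i φ x * (pd i W x * (u x * u x) + W x * (pd i u x * u x + u x * pd i u x)) -
      pd i χ x *
        ((pd i W x * W x + W x * pd i W x) * (u x * u x) +
          (W x * W x) * (pd i u x * u x + u x * pd i u x))) := by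
      intro i
      rw [hpu, hux]
      unfold Tq
      ring
    rw [Finset.sum_congr rfl (fun i _ => r2 i), Finset.sum_add_distrib, Finset.sum_sub_distrib,
      ← Finset.mul_sum, ← Finset.sum_mul, hux]
    ring
  unfold bform
  simp_rw [hpt]
  have hpXc := fun i => continuous_pd (hX1 i) i
  have hpXi : ∀ i ∈ Finset.univ, Integrable (fun x => pd i (X i) x) := fun i _ =>
    integrable_of_cont_zero hK (hpXc i) (fun x hx => pd_eq_zero_of_notMem hK.isClosed (hX0 i) i hx)
  rw [integral_add]
  · rw [integral_finsetSum _ hpXi, Finset.sum_eq_zero, add_zero]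
    intro i _
    exact integral_pd_zero (hX1 i) hK (hX0 i) i
  · exact integrable_of_cont_zero hK (continuous_hd H e hv)
      (fun x hx => hd_zero φ χ W ψ₀ e hK.isClosed h0 hx)
  · exact integrable_finsetSum _ hpXi

/-- squared gradient -/
def gsq {d : ℕ} (v : Ed d → ℝ) (x : Ed d) : ℝ := ∑ i, pd i v x ^ 2

lemma gsq_nonneg {d : ℕ} (v : Ed d → ℝ) (x : Ed d) : 0 ≤ gsq v x :=
  Finset.sum_nonneg fun _ _ => sq_nonneg _

lemma hd_far_aux {P a e v2 X g ε : ℝ} (hε0 : 0 < ε) (hε1 : ε < 1) (hP : 0 ≤ P) (ha : 0 ≤ a * v2)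
    (he : 0 ≤ e * v2) (hg : |g - 1| ≤ ε / 4) (hX : |X - (P + (e - a) * v2)| ≤ ε / 4 * (P + a * v2)) :
    (1 - ε) * P - ((1 + ε) * a - (1 - ε) * e) * v2 ≤ g * X ∧
    g * X ≤ (1 + ε) * P - ((1 - ε) * a - (1 + ε) * e) * v2 := by
  rw [abs_le] at hg hX
  have hg0 : 0 < g := by linarith [hg.1]
  set A := a * v2 with hA
  set F := e * v2 with hF
  have e1 : ((1 + ε) * a - (1 - ε) * e) * v2 = (1 + ε) * A - (1 - ε) * F := by rw [hA, hF]; ring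
  have e2 : ((1 - ε) * a - (1 + ε) * e) * v2 = (1 - ε) * A - (1 + ε) * F := by rw [hA, hF]; ring
  have e3 : (e - a) * v2 = F - A := by rw [hA, hF]; ring
  rw [e1, e2]
  rw [e3] at hX
  have q1 : (1 + ε / 4) * (1 + ε / 4) ≤ 1 + ε := by nlinarith
  have q2 : 1 - ε ≤ (1 - ε / 4) * (1 - ε / 4) := by nlinarith
  have hx1 : (1 - ε / 4) * P - (1 + ε / 4) * A + F ≤ X := by linarith [hX.1]
  have hx2 : X ≤ (1 + ε / 4) * P - (1 - ε / 4) * A + F := by linarith [hX.2]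
  have m1 := mul_le_mul_of_nonneg_left hx1 hg0.le
  have m2 := mul_le_mul_of_nonneg_left hx2 hg0.le
  have gl : 1 - ε / 4 ≤ g := by linarith [hg.1]
  have gu : g ≤ 1 + ε / 4 := by linarith [hg.2]
  have u1 : g * (1 + ε / 4) ≤ 1 + ε :=
    (mul_le_mul_of_nonneg_right gu (by linarith)).trans q1
  have u2 : 1 - ε ≤ g * (1 - ε / 4) :=
    q2.trans (mul_le_mul_of_nonneg_right gl (by linarith))
  have k1 := mul_le_mul_of_nonneg_right u1 hP
  have k2 := mul_le_mul_of_nonneg_right u2 hP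
  have k3 := mul_le_mul_of_nonneg_right u1 ha
  have k4 := mul_le_mul_of_nonneg_right u2 ha
  have k5 := mul_le_mul_of_nonneg_right (show g ≤ 1 + ε by linarith) he
  have k6 := mul_le_mul_of_nonneg_right (show 1 - ε ≤ g by linarith) he
  constructor <;> linarith

lemma hd_far {d : ℕ} {η φ χ W : Ed d → ℝ} {ψ₀ B : ℝ} (H : GH d η φ χ W ψ₀ B) {ε : ℝ}
    (hε0 : 0 < ε) (hε1 : ε < 1) : ∃ δ : ℝ, 0 < δ ∧ ∀ (e : ℝ) (v : Ed d → ℝ) (x : Ed d), 0 ≤ e →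
      |W x| ≤ δ → (∀ i, |pd i W x| ≤ δ * W x ^ 2) →
      (1 - ε) * gsq v x - ((1 + ε) * (ψ₀ * W x ^ 2) - (1 - ε) * e) * v x ^ 2 ≤ hd φ χ W ψ₀ e v x ∧
      hd φ χ W ψ₀ e v x ≤ (1 + ε) * gsq v x - ((1 - ε) * (ψ₀ * W x ^ 2) - (1 + ε) * e) * v x ^ 2 := by
  have hB := H.B1
  have hψ := H.ψpos
  set C1 : ℝ := 2 + 10 * B ^ 2 * d / ψ₀ with hC1
  have hC1p : 0 < C1 := by positivity
  set δ : ℝ := ε / (16 * B + 4 * C1) with hδ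
  have hδp : 0 < δ := by positivity
  have hδe : δ * (16 * B + 4 * C1) = ε := by rw [hδ]; field_simp
  have hδB : 16 * (δ * B) ≤ ε := by nlinarith [mul_pos hδp hC1p]
  have hδC : 4 * (δ * C1) ≤ ε := by nlinarith [mul_pos hδp (by linarith : 0 < B)]
  have hδ1 : δ ≤ 1 := by nlinarith
  refine ⟨δ, hδp, fun e v x he hW hw => ?_⟩
  unfold hd
  apply hd_far_aux hε0 hε1 (gsq_nonneg v x) (by positivity) (by positivity)
  · have h1 : |2 * (W x * φ x)| ≤ 2 * (δ * B) := by
      rw [abs_mul, abs_mul, abs_two]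
      have := mul_le_mul hW (H.bφ x) (abs_nonneg _) hδp.le
      linarith
    have h2 := Real.abs_exp_sub_one_le (x := 2 * (W x * φ x)) (by linarith)
    linarith
  · have h1 : ∑ i, Tq (W x) (φ x) (pd i W x) (pd i φ x) (pd i χ x) (pd i v x) (v x) +
        (e - ψ₀ * W x ^ 2) * v x ^ 2 - (gsq v x + (e - ψ₀ * W x ^ 2) * v x ^ 2) =
        ∑ i, (Tq (W x) (φ x) (pd i W x) (pd i φ x) (pd i χ x) (pd i v x) (v x) - pd i v x ^ 2) := by
      rw [Finset.sum_sub_distrib]; unfold gsq; ring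
    rw [h1]
    calc _ ≤ ∑ i, |Tq (W x) (φ x) (pd i W x) (pd i φ x) (pd i χ x) (pd i v x) (v x) - pd i v x ^ 2| :=
          Finset.abs_sum_le_sum_abs _ _
      _ ≤ ∑ i, (2 * δ * pd i v x ^ 2 + 10 * B ^ 2 * δ * W x ^ 2 * v x ^ 2) :=
          Finset.sum_le_sum fun i _ => Tq_far _ _ hB hδp.le hδ1 (H.bφ x) (H.bdφ i x) (H.bdχ i x)
            (hw i) hW
      _ = 2 * δ * gsq v x + (10 * B ^ 2 * d / ψ₀) * δ * (ψ₀ * W x ^ 2 * v x ^ 2) := by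
          rw [Finset.sum_add_distrib, ← Finset.mul_sum]
          unfold gsq
          simp only [Finset.sum_const, Finset.card_univ, Fintype.card_fin, nsmul_eq_mul]
          field_simp
      _ ≤ δ * C1 * (gsq v x + ψ₀ * W x ^ 2 * v x ^ 2) := by
          have p1 := gsq_nonneg v x
          have p2 : 0 ≤ ψ₀ * W x ^ 2 * v x ^ 2 := by positivity
          have p3 : 0 ≤ 10 * B ^ 2 * d / ψ₀ := by positivity
          have p4 : 0 ≤ 10 * B ^ 2 * d / ψ₀ * δ * gsq v x := by positivity
          have p5 : 0 ≤ δ * (ψ₀ * W x ^ 2 * v x ^ 2) := by positivity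
          rw [hC1]
          linarith
      _ ≤ _ := by
          apply mul_le_mul_of_nonneg_right (by linarith)
          have p1 := gsq_nonneg v x
          positivity

lemma hd_core {d : ℕ} {η φ χ W : Ed d → ℝ} {ψ₀ B : ℝ} (H : GH d η φ χ W ψ₀ B) :
    ∃ c D : ℝ, 0 < c ∧ 0 ≤ D ∧ ∀ (e : ℝ) (v : Ed d → ℝ) (x : Ed d), 0 ≤ e →
      c * gsq v x - D * v x ^ 2 ≤ hd φ χ W ψ₀ e v x := by
  have hB := H.B1
  have hψ := H.ψpos
  refine ⟨exp (-(2 * B ^ 2)) / 4, exp (2 * B ^ 2) * (10 * B ^ 6 * d + ψ₀ * B ^ 2), by positivity,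
    by positivity, fun e v x he => ?_⟩
  have h1 : |2 * (W x * φ x)| ≤ 2 * B ^ 2 := by
    rw [abs_mul, abs_mul, abs_two]
    have := mul_le_mul (H.bW x) (H.bφ x) (abs_nonneg _) (by linarith)
    nlinarith
  rw [abs_le] at h1
  have g1 : exp (-(2 * B ^ 2)) ≤ exp (2 * (W x * φ x)) := exp_le_exp.2 h1.1
  have g2 : exp (2 * (W x * φ x)) ≤ exp (2 * B ^ 2) := exp_le_exp.2 h1.2
  have g0 := exp_pos (2 * (W x * φ x))
  unfold hd
  have hX : gsq v x / 4 - (10 * B ^ 6 * d + ψ₀ * B ^ 2) * v x ^ 2 ≤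
      ∑ i, Tq (W x) (φ x) (pd i W x) (pd i φ x) (pd i χ x) (pd i v x) (v x) +
        (e - ψ₀ * W x ^ 2) * v x ^ 2 := by
    have h2 : ∑ i, (pd i v x ^ 2 / 4 - 10 * B ^ 6 * v x ^ 2) ≤
        ∑ i, Tq (W x) (φ x) (pd i W x) (pd i φ x) (pd i χ x) (pd i v x) (v x) :=
      Finset.sum_le_sum fun i _ => Tq_core _ _ hB (H.bφ x) (H.bdφ i x) (H.bdχ i x)
            (H.bdW i x) (H.bW x)
    rw [Finset.sum_sub_distrib, ← Finset.sum_div] at h2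
    simp only [Finset.sum_const, Finset.card_univ, Fintype.card_fin, nsmul_eq_mul] at h2
    have h3 : W x ^ 2 ≤ B ^ 2 := by
      rw [← sq_abs]; exact pow_le_pow_left₀ (abs_nonneg _) (H.bW x) 2
    have h4 : -(ψ₀ * B ^ 2) * v x ^ 2 ≤ (e - ψ₀ * W x ^ 2) * v x ^ 2 := by
      apply mul_le_mul_of_nonneg_right _ (sq_nonneg _)
      nlinarith
    unfold gsq
    linarith
  have m := mul_le_mul_of_nonneg_left hX g0.le
  have p1 := mul_le_mul_of_nonneg_right g1 (gsq_nonneg v x)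
  have p2 := mul_le_mul_of_nonneg_right g2 (show 0 ≤ (10 * B ^ 6 * d + ψ₀ * B ^ 2) * v x ^ 2 by positivity)
  linarith

lemma lamk_nonneg {d : ℕ} (L : ℝ) (k : Fin d → ℕ) : 0 ≤ lamk L k :=
  Finset.sum_nonneg fun _ _ => sq_nonneg _

lemma continuous_gsq {d : ℕ} {v : Ed d → ℝ} (hv : ContDiff ℝ 1 v) : Continuous (gsq v) := by
  have := fun i => continuous_pd hv i
  unfold gsq; fun_prop

/-- Neumann bracketing upper bound -/
lemma upper_tiles {d : ℕ} {η φ χ W : Ed d → ℝ} {ψ₀ B : ℝ} (H : GH d η φ χ W ψ₀ B) {e : ℝ}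
    {ι : Type*} [Fintype ι] (a : ι → Ed d) (L : ι → ℝ) (hL : ∀ q, 0 < L q)
    (hdisj : ∀ p q, p ≠ q → Disjoint (hcube (a p) (L p)) (hcube (a q) (L q)))
    (α β : ι → ℝ) (hα : ∀ q, 0 < α q)
    (hin : ∀ q, ∀ x ∈ hcube (a q) (L q), ∀ v : Ed d → ℝ,
      α q * gsq v x - β q * v x ^ 2 ≤ hd φ χ W ψ₀ e v x)
    (hout : ∀ x, (∀ q, x ∉ hcube (a q) (L q)) → ∀ v : Ed d → ℝ, 0 ≤ hd φ χ W ψ₀ e v x) :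
    schN d (fun x => η x * W x) (-e) ≤
      ((∑ q, (nset (d := d) (hL q) (β q / α q)).card : ℕ) : ℕ∞) := by
  classical
  have hφ1 : ContDiff ℝ 1 φ := H.φ2.of_le one_le_two
  have hW1 : ContDiff ℝ 1 W := H.W2.of_le one_le_two
  have hG1 : ContDiff ℝ 1 (fun y => -(W y * φ y)) := (hW1.mul hφ1).neg
  have hE1 : ContDiff ℝ 1 (fun y => exp (-(W y * φ y))) := hG1.exp
  have hcV : Continuous (fun x => η x * W x) := (continuous_eta H).mul hW1.continuous
  have key := schN_le (d := d) (V := fun x => η x * W x) hcV (-e)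
    (ι := (q : ι) × (nset (d := d) (hL q) (β q / α q)))
    (fun p x => exp (-(W x * φ x)) * ecos (a p.1) (L p.1) p.2.1 x)
    (fun p => ccube (a p.1) (L p.1))
    (fun p => hE1.continuous.mul (contDiff_ecos (n := 1) _ _ _).continuous) ?_
  · simpa using key
  · intro u hu hcs horth
    set v : Ed d → ℝ := fun y => exp (-(W y * φ y)) * u y with hv
    have hv1 : ContDiff ℝ 1 v := hE1.mul hu
    have huv : u = fun y => exp (W y * φ y) * v y := by
      funext y
      rw [hv]
      simp only
      rw [← mul_assoc, ← exp_add]; simp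
    have hK : IsCompact (tsupport u) := hcs
    have hv0 : ∀ x, x ∉ tsupport u → v x = 0 := fun x hx => by
      simp [hv, image_eq_zero_of_notMem_tsupport hx]
    have hg := gauge_id H e hv1 hK hv0
    rw [← huv] at hg
    rw [hg]
    have hdc := continuous_hd H e hv1
    have hdi : Integrable (hd φ χ W ψ₀ e v) := integrable_of_cont_zero hK hdc
      (fun x hx => hd_zero φ χ W ψ₀ e hK.isClosed hv0 hx)
    set U := ⋃ q ∈ (Finset.univ : Finset ι), hcube (a q) (L q) with hU
    have hUm : MeasurableSet U := Finset.measurableSet_biUnion _ fun q _ => measurableSet_hcube _ _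
    rw [← integral_add_compl hUm hdi]
    apply add_nonneg
    · rw [hU, integral_biUnion_finset _ (fun q _ => measurableSet_hcube _ _)
        (fun p _ q _ hpq => hdisj p q hpq) (fun q _ => hdi.integrableOn)]
      apply Finset.sum_nonneg
      intro q _
      have h1 : ∫ x in hcube (a q) (L q), (α q * gsq v x - β q * v x ^ 2) ≤
          ∫ x in hcube (a q) (L q), hd φ χ W ψ₀ e v x := by
        apply setIntegral_mono_on _ hdi.integrableOn (measurableSet_hcube _ _)
        · intro x hx; exact hin q x hx v
        · rw [integrableOn_congr_set_ae (hcube_ae_eq_ccube _ _)]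
          have := continuous_gsq hv1
          have := hv1.continuous
          exact integrableOn_ccube (by fun_prop)
      refine le_trans ?_ h1
      rw [setIntegral_congr_set (hcube_ae_eq_ccube _ _)]
      have c1 := continuous_gsq hv1
      have c2 := hv1.continuous
      rw [integral_sub (integrableOn_ccube (by fun_prop)) (integrableOn_ccube (by fun_prop)),
        integral_const_mul, integral_const_mul]
      have h2 := neumann_ineq (a q) (hL q) v hv1 (m := max 0 (β q / α q)) (le_max_left _ _) ?_
      · have h3 : (β q / α q) * ∫ x in ccube (a q) (L q), v x ^ 2 ≤
            max 0 (β q / α q) * ∫ x in ccube (a q) (L q), v x ^ 2 :=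
          mul_le_mul_of_nonneg_right (le_max_right _ _) (integral_nonneg fun x => sq_nonneg _)
        have h4 := mul_le_mul_of_nonneg_left (h3.trans h2) (hα q).le
        rw [← mul_assoc, mul_div_cancel₀ _ (hα q).ne'] at h4
        have h5 : (∫ x in ccube (a q) (L q), gsq v x) =
          ∫ x in ccube (a q) (L q), ∑ i, pd i v x ^ 2 := rfl
        rw [h5]; linarith
      · intro k hk
        have hk' : lamk (L q) k < β q / α q := by
          rcases lt_max_iff.1 hk with h | h
          · linarith [lamk_nonneg (L q) k]
          · exact h
        have := horth ⟨q, ⟨k, (mem_nset _ _ _).2 hk'⟩⟩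
        simp only at this
        rw [← this]
        congr 1; funext x; rw [hv]; ring
    · apply setIntegral_nonneg hUm.compl
      intro x hx
      apply hout
      intro q hq
      apply hx
      simp only [hU, Finset.mem_univ, iUnion_true, mem_iUnion]
      exact ⟨q, hq⟩

/-- Dirichlet bracketing lower bound -/
lemma lower_tiles {d : ℕ} {η φ χ W : Ed d → ℝ} {ψ₀ B : ℝ} (H : GH d η φ χ W ψ₀ B) {e : ℝ}
    {ι : Type*} [Fintype ι] (a : ι → Ed d) (L : ι → ℝ) (hL : ∀ q, 0 < L q)
    (hdisj : ∀ p q, p ≠ q → Disjoint (hcube (a p) (L p)) (hcube (a q) (L q)))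
    (α β : ι → ℝ) (hα : ∀ q, 0 < α q)
    (hin : ∀ q, ∀ x ∈ hcube (a q) (L q), ∀ v : Ed d → ℝ,
      hd φ χ W ψ₀ e v x ≤ α q * gsq v x - β q * v x ^ 2) :
    ((∑ q, (dset (d := d) (hL q) (β q / α q)).card : ℕ) : ℕ∞) ≤
      schN d (fun x => η x * W x) (-e) := by
  classical
  have hφ1 : ContDiff ℝ 1 φ := H.φ2.of_le one_le_two
  have hW1 : ContDiff ℝ 1 W := H.W2.of_le one_le_two
  have hE1 : ContDiff ℝ 1 (fun y => exp (W y * φ y)) := (hW1.mul hφ1).exp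
  have hcV : Continuous (fun x => η x * W x) := (continuous_eta H).mul hW1.continuous
  have htr := fun q => dir_trial (a q) (hL q) (β q / α q) (dset (hL q) (β q / α q))
    (fun k hk => (mem_dset _ _ _).1 hk)
  choose w hw1 hw0 hwn using htr
  set K : Set (Ed d) := ⋃ q, ccube (a q) (L q) with hKd
  have hK : IsCompact K := isCompact_iUnion fun q => isCompact_ccube _ _
  have hoc : ∀ q, ocube (a q) (L q) ⊆ ccube (a q) (L q) := fun q x h i => ⟨(h i).1.le, (h i).2.le⟩
  have hoh : ∀ q, ocube (a q) (L q) ⊆ hcube (a q) (L q) := fun q x h i => ⟨(h i).1.le, (h i).2⟩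
  have hoo : ∀ q, IsOpen (ocube (a q) (L q)) := by
    intro q
    have : ocube (a q) (L q) = ⋂ i, {x : Ed d | a q i < x i ∧ x i < a q i + L q} := by
      ext x; simp [ocube]
    rw [this]
    apply isOpen_iInter_of_finite
    intro i
    have hc : Continuous (fun x : Ed d => x i) := by fun_prop
    exact (isOpen_lt continuous_const hc).inter (isOpen_lt hc continuous_const)
  have key := schN_ge_C1 (d := d) (V := fun x => η x * W x) hcV (-e)
    (ι := (q : ι) × (dset (d := d) (hL q) (β q / α q)))
    (fun p x => exp (W x * φ x) * w p.1 p.2 x) (fun p => hE1.mul (hw1 _ _)) hK ?_ ?_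
  · simpa using key
  · intro p x hx
    rw [hw0 p.1 p.2 x, mul_zero]
    intro h
    exact hx (mem_iUnion.2 ⟨p.1, hoc _ h⟩)
  · intro c hc
    set vq : ι → Ed d → ℝ := fun q y => ∑ k, c ⟨q, k⟩ * w q k y with hvq
    set v : Ed d → ℝ := fun y => ∑ q, vq q y with hv
    have hvq1 : ∀ q, ContDiff ℝ 1 (vq q) := fun q => contDiff_lincomb _ _ _ (hw1 q)
    have hv1 : ContDiff ℝ 1 v := ContDiff.sum fun q _ => hvq1 q
    have hvq0 : ∀ q x, x ∉ ocube (a q) (L q) → vq q x = 0 := fun q x hx => by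
      simp [hvq, hw0 q _ x hx]
    have hvqc : ∀ q x, x ∉ ccube (a q) (L q) → vq q x = 0 := fun q x hx =>
      hvq0 q x fun h => hx (hoc q h)
    have hv0 : ∀ x, x ∉ K → v x = 0 := fun x hx => by
      simp only [hv]
      apply Finset.sum_eq_zero
      intro q _
      exact hvqc q x fun h => hx (mem_iUnion.2 ⟨q, h⟩)
    have hue : (fun y => ∑ p : (q : ι) × (dset (d := d) (hL q) (β q / α q)),
        c p * (exp (W y * φ y) * w p.1 p.2 y)) = fun y => exp (W y * φ y) * v y := by
      funext y
      rw [Fintype.sum_sigma]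
      simp only [hv, hvq, Finset.mul_sum]
      apply Finset.sum_congr rfl; intro q _
      apply Finset.sum_congr rfl; intro k _
      ring
    simp only [hue]
    rw [gauge_id H e hv1 hK hv0]
    have hIntg : ∀ q, Integrable (fun x => α q * gsq (vq q) x - β q * vq q x ^ 2) := by
      intro q
      have c1 := continuous_gsq (hvq1 q)
      have c2 := (hvq1 q).continuous
      apply integrable_of_cont_zero (isCompact_ccube (a q) (L q)) (by fun_prop)
      intro x hx
      simp [gsq, hvqc q x hx, pd_eq_zero_of_notMem (isCompact_ccube (a q) (L q)).isClosed (hvqc q) _ hx]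
    have hae : ∀ᵐ x, ∀ q, x ∈ ccube (a q) (L q) → x ∈ ocube (a q) (L q) := by
      rw [ae_all_iff]
      intro q
      filter_upwards [(ocube_ae_eq_ccube (a q) (L q))] with x hx h
      exact (eq_iff_iff.1 hx).2 h
    have hloc : ∀ q x, x ∉ ccube (a q) (L q) →
        α q * gsq (vq q) x - β q * vq q x ^ 2 = 0 := fun q x hx => by
      simp [gsq, hvqc q x hx, pd_eq_zero_of_notMem (isCompact_ccube (a q) (L q)).isClosed (hvqc q) _ hx]
    have hle : ∫ x, hd φ χ W ψ₀ e v x ≤ ∫ x, ∑ q, (α q * gsq (vq q) x - β q * vq q x ^ 2) := by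
      apply integral_mono_ae
      · exact integrable_of_cont_zero hK (continuous_hd H e hv1)
          (fun x hx => hd_zero φ χ W ψ₀ e hK.isClosed hv0 hx)
      · exact integrable_finsetSum _ fun q _ => hIntg q
      · filter_upwards [hae] with x hx
        by_cases hxK : x ∈ K
        · obtain ⟨q, hq⟩ := mem_iUnion.1 hxK
          have hxq := hx q hq
          have hne : ∀ p, p ≠ q → x ∉ ccube (a p) (L p) := by
            intro p hp h
            exact Set.disjoint_left.1 (hdisj p q hp) (hoh p (hx p h)) (hoh q hxq)
          rw [Finset.sum_eq_single q (fun p _ hp => hloc p x (hne p hp)) (by simp)]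
          have heq : v =ᶠ[𝓝 x] vq q := by
            filter_upwards [(hoo q).mem_nhds hxq] with y hy
            simp only [hv]
            apply Finset.sum_eq_single q _ (by simp)
            intro p _ hp
            apply hvq0
            intro h
            exact Set.disjoint_left.1 (hdisj p q hp) (hoh p h) (hoh q hy)
          have hvx : v x = vq q x := heq.eq_of_nhds
          have hpx : gsq v x = gsq (vq q) x := by
            unfold gsq pd; rw [heq.fderiv_eq]
          rw [← hvx, ← hpx]
          exact hin q x (hoh q hxq) v
        · rw [hd_zero φ χ W ψ₀ e hK.isClosed hv0 hxK]
          rw [Finset.sum_eq_zero]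
          intro q _
          exact hloc q x fun h => hxK (mem_iUnion.2 ⟨q, h⟩)
    refine lt_of_le_of_lt hle ?_
    rw [integral_finsetSum _ fun q _ => hIntg q]
    have hq : ∀ q, (∫ x, (α q * gsq (vq q) x - β q * vq q x ^ 2)) =
        α q * bform (fun _ => -(β q / α q)) (vq q) (vq q) := by
      intro q
      unfold bform
      rw [← integral_const_mul]
      congr 1; funext x
      have := (hα q).ne'
      have e1 : ∑ i, pd i (vq q) x * pd i (vq q) x = gsq (vq q) x := by
        unfold gsq; simp_rw [pow_two]
      rw [e1]
      field_simp
      ring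
    simp_rw [hq]
    have hneg : ∀ q, (fun k => c ⟨q, k⟩) ≠ 0 → bform (fun _ => -(β q / α q)) (vq q) (vq q) < 0 :=
      fun q h => hwn q (fun k => c ⟨q, k⟩) h
    have hz : ∀ q, (fun k => c ⟨q, k⟩) = 0 → bform (fun _ => -(β q / α q)) (vq q) (vq q) = 0 := by
      intro q h
      have : vq q = fun _ => 0 := by
        funext y; simp only [hvq]
        apply Finset.sum_eq_zero; intro k _
        have := congrFun h k
        simp only [Pi.zero_apply] at this
        rw [this, zero_mul]
      rw [this]
      simp [bform, pd]
    obtain ⟨⟨q0, k0⟩, hne⟩ := Function.ne_iff.1 hc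
    have hle0 : ∀ q, α q * bform (fun _ => -(β q / α q)) (vq q) (vq q) ≤ 0 := by
      intro q
      apply mul_nonpos_of_nonneg_of_nonpos (hα q).le
      by_cases h : (fun k => c ⟨q, k⟩) = 0
      · exact (hz q h).le
      · exact (hneg q h).le
    apply Finset.sum_neg' (fun q _ => hle0 q)
    refine ⟨q0, Finset.mem_univ _, mul_neg_of_pos_of_neg (hα q0) (hneg q0 ?_)⟩
    intro h
    exact hne (congrFun h k0)

/-- dyadic box -/
def bx (d : ℕ) (k : ℕ) : Set (Ed d) := {x | ∀ i, -(2:ℝ) ^ k ≤ x i ∧ x i < (2:ℝ) ^ k}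

/-- corner of a tile -/
def tcorner {d : ℕ} (M : ℕ) (p : ℕ × (Fin d → ℤ)) : Ed d :=
  WithLp.toLp 2 (fun i => (2:ℝ) ^ p.1 / M * (p.2 i : ℝ))

/-- side of a tile -/
def tside {d : ℕ} (M : ℕ) (p : ℕ × (Fin d → ℤ)) : ℝ := (2:ℝ) ^ p.1 / M

/-- tile -/
def tcube {d : ℕ} (M : ℕ) (p : ℕ × (Fin d → ℤ)) : Set (Ed d) := hcube (tcorner M p) (tside M p)

open Classical in
/-- index set of tiles in the shells from `k0` to `k1` -/
def TS (d M k0 k1 : ℕ) : Finset (ℕ × (Fin d → ℤ)) :=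
  (Finset.Ico k0 k1 ×ˢ Fintype.piFinset fun _ => Finset.Ico (-2 * (M:ℤ)) (2 * M)).filter
    (fun p => ∃ i, p.2 i < -(M:ℤ) ∨ (M:ℤ) ≤ p.2 i)

lemma mem_TS {d M k0 k1 : ℕ} {p : ℕ × (Fin d → ℤ)} : p ∈ TS d M k0 k1 ↔
    (k0 ≤ p.1 ∧ p.1 < k1) ∧ (∀ i, -2 * (M:ℤ) ≤ p.2 i ∧ p.2 i < 2 * M) ∧
    ∃ i, p.2 i < -(M:ℤ) ∨ (M:ℤ) ≤ p.2 i := by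
  simp only [TS, Finset.mem_filter, Finset.mem_product, Finset.mem_Ico, Fintype.mem_piFinset]
  exact and_assoc

lemma mem_tcube {d M : ℕ} {p : ℕ × (Fin d → ℤ)} {x : Ed d} : x ∈ tcube M p ↔
    ∀ i, (2:ℝ) ^ p.1 / M * (p.2 i : ℝ) ≤ x i ∧ x i < (2:ℝ) ^ p.1 / M * (p.2 i : ℝ) + (2:ℝ) ^ p.1 / M := by
  simp [tcube, hcube, tcorner, tside]

lemma mem_tcube_floor {d M : ℕ} (hM : 0 < M) {p : ℕ × (Fin d → ℤ)} {x : Ed d} : x ∈ tcube M p ↔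
    ∀ i, ⌊x i / ((2:ℝ) ^ p.1 / M)⌋ = p.2 i := by
  rw [mem_tcube]
  have hs : 0 < (2:ℝ) ^ p.1 / M := by positivity
  refine forall_congr' fun i => ?_
  rw [Int.floor_eq_iff, le_div_iff₀ hs, div_lt_iff₀ hs, add_mul, one_mul, mul_comm]

lemma bx_mono {d k l : ℕ} (h : k ≤ l) : bx d k ⊆ bx d l := by
  intro x hx i
  have := hx i
  have h2 : (2:ℝ) ^ k ≤ 2 ^ l := pow_le_pow_right₀ (by norm_num) h
  constructor <;> linarith [this.1, this.2]

lemma tcube_shell {d M k0 k1 : ℕ} (hM : 0 < M) {p : ℕ × (Fin d → ℤ)} (hp : p ∈ TS d M k0 k1) {x : Ed d}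
    (hx : x ∈ tcube M p) : x ∈ bx d (p.1 + 1) ∧ x ∉ bx d p.1 := by
  rw [mem_TS] at hp
  obtain ⟨-, h1, i, hi⟩ := hp
  rw [mem_tcube] at hx
  have hMr : (0:ℝ) < M := by exact_mod_cast hM
  set s := (2:ℝ) ^ p.1 / M with hs
  have hs0 : 0 < s := by positivity
  have hsM : s * M = 2 ^ p.1 := by rw [hs]; field_simp
  constructor
  · intro j
    have := h1 j
    have a1 : -2 * (M:ℝ) ≤ (p.2 j : ℝ) := by exact_mod_cast this.1
    have a2 : (p.2 j : ℝ) + 1 ≤ 2 * M := by exact_mod_cast this.2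
    have b1 := mul_le_mul_of_nonneg_left a1 hs0.le
    have b2 := mul_le_mul_of_nonneg_left a2 hs0.le
    have := hx j
    rw [pow_succ]
    constructor <;> linarith [this.1, this.2]
  · intro hb
    have h2 := hb i
    have h3 := hx i
    rcases hi with hi | hi
    · have a1 : (p.2 i : ℝ) + 1 ≤ -(M:ℝ) := by exact_mod_cast hi
      have b1 := mul_le_mul_of_nonneg_left a1 hs0.le
      linarith
    · have a1 : (M:ℝ) ≤ (p.2 i : ℝ) := by exact_mod_cast hi
      have b1 := mul_le_mul_of_nonneg_left a1 hs0.le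
      linarith

lemma tcube_disj {d M k0 k1 : ℕ} (hM : 0 < M) {p q : ℕ × (Fin d → ℤ)} (hp : p ∈ TS d M k0 k1)
    (hq : q ∈ TS d M k0 k1) (hpq : p ≠ q) : Disjoint (tcube M p) (tcube M q) := by
  rw [Set.disjoint_left]
  intro x hx hy
  apply hpq
  have h1 := tcube_shell hM hp hx
  have h2 := tcube_shell hM hq hy
  have hk : p.1 = q.1 := by
    rcases lt_trichotomy p.1 q.1 with h | h | h
    · exact absurd (bx_mono h h1.1) h2.2
    · exact h
    · exact absurd (bx_mono h h2.1) h1.2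
  rw [mem_tcube_floor hM] at hx hy
  rw [hk] at hx
  exact Prod.ext hk (funext fun i => (hx i).symm.trans (hy i))

lemma tcube_cover {d M k0 k1 : ℕ} (hM : 0 < M) {x : Ed d} (hx0 : x ∉ bx d k0) (hx1 : x ∈ bx d k1) :
    ∃ p ∈ TS d M k0 k1, x ∈ tcube M p := by
  classical
  have hMr : (0:ℝ) < M := by exact_mod_cast hM
  have hex : ∃ k, x ∈ bx d k := ⟨_, hx1⟩
  set n := Nat.find hex with hn
  have hn1 : x ∈ bx d n := Nat.find_spec hex
  have hnle : n ≤ k1 := Nat.find_min' hex hx1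
  have hk0 : k0 < n := by
    by_contra h
    exact hx0 (bx_mono (not_lt.1 h) hn1)
  obtain ⟨k, hk⟩ : ∃ k, n = k + 1 := ⟨n - 1, by omega⟩
  have hk1 : x ∉ bx d k := Nat.find_min hex (by omega)
  set s := (2:ℝ) ^ k / M with hs
  have hs0 : 0 < s := by positivity
  have hsM : s * M = 2 ^ k := by rw [hs]; field_simp
  refine ⟨(k, fun i => ⌊x i / s⌋), ?_, ?_⟩
  · rw [mem_TS]
    refine ⟨⟨by simp; omega, by simp; omega⟩, ?_, ?_⟩
    · intro i
      rw [hk] at hn1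
      have := hn1 i
      rw [pow_succ] at this
      constructor
      · simp only
        rw [Int.le_floor, le_div_iff₀ hs0]
        push_cast
        linarith [this.1]
      · simp only
        rw [Int.floor_lt, div_lt_iff₀ hs0]
        push_cast
        linarith [this.2]
    · by_contra hcon
      push Not at hcon
      apply hk1
      intro i
      have := hcon i
      simp only at this
      rw [Int.le_floor, Int.floor_lt, le_div_iff₀ hs0, div_lt_iff₀ hs0] at this
      push_cast at this
      constructor <;> linarith [this.1, this.2]
  · rw [mem_tcube_floor hM]
    intro i
    rfl

lemma norm_ge_of_notMem_bx {d k : ℕ} {x : Ed d} (hx : x ∉ bx d k) : (2:ℝ) ^ k ≤ ‖x‖ := by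
  by_contra h
  push Not at h
  apply hx
  intro i
  have h1 : |x i| ≤ ‖x‖ := by simpa using PiLp.norm_apply_le x i
  have := abs_le.1 h1
  constructor <;> linarith [this.1, this.2]

lemma norm_le_of_coord {d : ℕ} {x : Ed d} {t : ℝ} (ht : 0 ≤ t) (h : ∀ i, |x i| ≤ t) : ‖x‖ ≤ d * t := by
  have h1 : ‖x‖ ≤ ∑ i, |x i| := by
    rw [EuclideanSpace.norm_eq, Real.sqrt_le_left (Finset.sum_nonneg fun i _ => abs_nonneg _)]
    simp only [Real.norm_eq_abs]
    exact Finset.sum_sq_le_sq_sum_of_nonneg fun i _ => abs_nonneg _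
  refine h1.trans ((Finset.sum_le_sum fun i _ => h i).trans ?_)
  simp

lemma norm_le_of_mem_bx {d k : ℕ} {x : Ed d} (hx : x ∈ bx d k) : ‖x‖ ≤ d * (2:ℝ) ^ k :=
  norm_le_of_coord (by positivity) fun i => abs_le.2 ⟨(hx i).1, (hx i).2.le⟩

lemma norm_sub_tcube {d M : ℕ} {p : ℕ × (Fin d → ℤ)} {x y : Ed d} (hx : x ∈ tcube M p)
    (hy : y ∈ tcube M p) : ‖x - y‖ ≤ d * tside M p := by
  apply norm_le_of_coord (by unfold tside; positivity)
  intro i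
  have h1 := hx i
  have h2 := hy i
  simp only [PiLp.sub_apply]
  rw [abs_le]
  constructor <;> linarith [h1.1, h1.2, h2.1, h2.2]

lemma convex_hcube {d : ℕ} (a : Ed d) (L : ℝ) : Convex ℝ (hcube a L) := by
  have : hcube a L = ⋂ i, (EuclideanSpace.proj (𝕜 := ℝ) i : Ed d →L[ℝ] ℝ) ⁻¹' (Ico (a i) (a i + L)) := by
    ext x; simp [hcube]
  rw [this]
  exact convex_iInter fun i => (convex_Ico _ _).linear_preimage (EuclideanSpace.proj (𝕜 := ℝ) i : Ed d →L[ℝ] ℝ).toLinearMap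

lemma bx_eq_hcube {d k : ℕ} : bx d k = hcube (WithLp.toLp 2 (fun _ : Fin d => -(2:ℝ) ^ k)) (2 * 2 ^ k) := by
  ext x
  simp only [bx, hcube, mem_ofPred_eq]
  refine forall_congr' fun i => ?_
  have : -(2:ℝ) ^ k + 2 * 2 ^ k = 2 ^ k := by ring
  rw [this]

lemma measurableSet_bx {d k : ℕ} : MeasurableSet (bx d k) := by
  rw [bx_eq_hcube]; exact measurableSet_hcube _ _

lemma integrableOn_hcube {d : ℕ} {f : Ed d → ℝ} (hf : Continuous f) (a : Ed d) (L : ℝ) :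
    IntegrableOn f (hcube a L) :=
  (integrableOn_ccube hf).mono_set (fun x hx i => ⟨(hx i).1, (hx i).2.le⟩)

lemma integrableOn_bx {d k : ℕ} {f : Ed d → ℝ} (hf : Continuous f) : IntegrableOn f (bx d k) := by
  rw [bx_eq_hcube]; exact integrableOn_hcube hf _ _

lemma sum_tcube {d M k0 k1 : ℕ} (hM : 0 < M) {f : Ed d → ℝ} (hf : Continuous f) :
    ∑ p ∈ TS d M k0 k1, ∫ x in tcube M p, f x = ∫ x in bx d k1 \ bx d k0, f x := by
  have hm : ∀ q ∈ TS d M k0 k1, MeasurableSet (tcube M q) := fun q _ => measurableSet_hcube _ _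
  have hi : ∀ q ∈ TS d M k0 k1, IntegrableOn f (tcube M q) := fun q _ => integrableOn_hcube hf _ _
  rw [← integral_biUnion_finset _ hm (fun p hp q hq hpq => tcube_disj hM hp hq hpq) hi]
  congr 2
  ext x
  simp only [mem_iUnion, exists_prop, Set.mem_sdiff]
  constructor
  · rintro ⟨p, hp, hx⟩
    have h := tcube_shell hM hp hx
    have hp' := mem_TS.1 hp
    exact ⟨bx_mono (by omega) h.1, fun h0 => h.2 (bx_mono (by omega) h0)⟩
  · rintro ⟨h1, h0⟩
    exact tcube_cover hM h0 h1

lemma volume_tcube {d M : ℕ} (hM : 0 < M) (p : ℕ × (Fin d → ℤ)) :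
    (volume (tcube M p)).toReal = tside M p ^ d := volume_hcube _ (by unfold tside; positivity)
lemma volume_bx {d k : ℕ} : (volume (bx d k)).toReal = (2 * 2 ^ k) ^ d := by
  rw [bx_eq_hcube, volume_hcube _ (by positivity)]

lemma pow_pert (d : ℕ) {x A t : ℝ} (hx : 0 ≤ x) (hxA : x ≤ A) (ht : 0 ≤ t) :
    (x + t * A) ^ d ≤ x ^ d + ((1 + t) ^ d - 1) * A ^ d := by
  have hA : 0 ≤ A := hx.trans hxA
  induction d with
  | zero => simp
  | succ n ih =>
    have h1 : (x + t * A) ^ (n + 1) ≤ (x ^ n + ((1 + t) ^ n - 1) * A ^ n) * (x + t * A) := by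
      rw [pow_succ]
      exact mul_le_mul_of_nonneg_right ih (by positivity)
    have h2 : x ^ n ≤ A ^ n := pow_le_pow_left₀ hx hxA n
    have h3 : 0 ≤ (1 + t) ^ n - 1 := by
      have := one_le_pow₀ (n := n) (by linarith : 1 ≤ 1 + t)
      linarith
    have h4 : x ^ n * (t * A) ≤ A ^ n * (t * A) := mul_le_mul_of_nonneg_right h2 (by positivity)
    have h5 : ((1 + t) ^ n - 1) * A ^ n * (x + t * A) ≤ ((1 + t) ^ n - 1) * A ^ n * (A + t * A) :=
      mul_le_mul_of_nonneg_left (by linarith) (by positivity)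
    calc _ ≤ _ := h1
      _ = x ^ n * x + x ^ n * (t * A) + ((1 + t) ^ n - 1) * A ^ n * (x + t * A) := by ring
      _ ≤ x ^ n * x + A ^ n * (t * A) + ((1 + t) ^ n - 1) * A ^ n * (A + t * A) := by linarith
      _ = _ := by ring

lemma sqrt_pert {a b : ℝ} (hb : 0 ≤ b) : √(a + b) ≤ √a + √b := by
  rw [Real.sqrt_le_left (by positivity)]
  have h1 : a ≤ √a ^ 2 := by
    rcases le_total 0 a with h | h
    · rw [Real.sq_sqrt h]
    · exact h.trans (sq_nonneg _)
  have h2 := Real.sq_sqrt hb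
  nlinarith [Real.sqrt_nonneg a, Real.sqrt_nonneg b, mul_nonneg (Real.sqrt_nonneg a) (Real.sqrt_nonneg b)]

/-- decay properties of `W` in shells -/
structure WH (d : ℕ) (W : Ed d → ℝ) (ρ c C : ℝ) (K : ℕ) : Prop where
  d1 : 1 ≤ d
  ρ0 : 0 < ρ
  ρ1 : ρ < 1
  c0 : 0 < c
  C0 : 0 < C
  W1 : ContDiff ℝ 1 W
  lo : ∀ k, K ≤ k → ∀ x ∈ bx d (k+1), x ∉ bx d k → c * ((2:ℝ) ^ k) ^ (-ρ) ≤ |W x|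
  up : ∀ k, K ≤ k → ∀ x, x ∉ bx d k → |W x| ≤ C * ((2:ℝ) ^ k) ^ (-ρ)
  gr : ∀ k, K ≤ k → ∀ x, x ∉ bx d k → ‖fderiv ℝ W x‖ ≤ C * ((2:ℝ) ^ k) ^ (-ρ) / 2 ^ k

lemma exists_mem_bx {d : ℕ} (x : Ed d) : ∃ n, x ∈ bx d n := by
  obtain ⟨n, hn⟩ := pow_unbounded_of_one_lt ‖x‖ (by norm_num : (1:ℝ) < 2)
  refine ⟨n, ?_⟩
  by_contra h
  exact absurd (norm_ge_of_notMem_bx h) (not_le.2 hn)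

lemma shell_of_notMem {d k0 : ℕ} {x : Ed d} (hx : x ∉ bx d k0) :
    ∃ k, k0 ≤ k ∧ x ∈ bx d (k + 1) ∧ x ∉ bx d k := by
  classical
  have hex := exists_mem_bx x
  have hn1 := Nat.find_spec hex
  have hk0 : k0 < Nat.find hex := by
    by_contra h
    exact hx (bx_mono (not_lt.1 h) hn1)
  obtain ⟨k, hk⟩ : ∃ k, Nat.find hex = k + 1 := ⟨Nat.find hex - 1, by omega⟩
  exact ⟨k, by omega, hk ▸ hn1, Nat.find_min hex (by omega)⟩

lemma rpow_two_large {a : ℝ} (ha : 0 < a) (B : ℝ) : ∀ᶠ k : ℕ in atTop, B ≤ ((2:ℝ) ^ k) ^ a :=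
  ((tendsto_rpow_atTop ha).comp (tendsto_pow_atTop_atTop_of_one_lt (by norm_num))).eventually_ge_atTop B

lemma corner_mem {d M : ℕ} (hM : 0 < M) (p : ℕ × (Fin d → ℤ)) : tcorner M p ∈ tcube M p := by
  intro i
  have : 0 < tside M p := by unfold tside; positivity
  constructor <;> linarith

lemma osc_tile {d : ℕ} {W : Ed d → ℝ} {ρ c C : ℝ} {K : ℕ} (h : WH d W ρ c C K) {ε : ℝ}
    (hε : 0 < ε) : ∃ M : ℕ, 0 < M ∧ ∀ k0 k1, K ≤ k0 → ∀ p ∈ TS d M k0 k1, ∀ x ∈ tcube M p,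
      |W x - W (tcorner M p)| ≤ ε * |W (tcorner M p)| := by
  obtain ⟨M, hM⟩ := exists_nat_ge (C * d / (ε * c) + 1)
  have hc := h.c0
  have hC := h.C0
  have hMr : (0:ℝ) < M := by
    have : 0 ≤ C * d / (ε * c) := by positivity
    linarith
  have hM0 : 0 < M := by exact_mod_cast hMr
  refine ⟨M, hM0, fun k0 k1 hk p hp x hx => ?_⟩
  have hK : K ≤ p.1 := hk.trans (mem_TS.1 hp).1.1
  have hy := corner_mem hM0 p
  have hsy := tcube_shell hM0 hp hy
  have hlo := h.lo p.1 hK _ hsy.1 hsy.2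
  have hmv := Convex.norm_image_sub_le_of_norm_fderiv_le (𝕜 := ℝ) (f := W) (s := tcube M p)
    (C := C * ((2:ℝ) ^ p.1) ^ (-ρ) / 2 ^ p.1)
    (fun z _ => (h.W1.differentiable (by norm_num)) z)
    (fun z hz => h.gr p.1 hK z (tcube_shell hM0 hp hz).2) (convex_hcube _ _) hy hx
  rw [Real.norm_eq_abs] at hmv
  have hn := norm_sub_tcube hx hy
  have hX : (0:ℝ) < ((2:ℝ) ^ p.1) ^ (-ρ) := by positivity
  calc _ ≤ _ := hmv
    _ ≤ C * ((2:ℝ) ^ p.1) ^ (-ρ) / 2 ^ p.1 * (d * tside M p) :=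
        mul_le_mul_of_nonneg_left hn (by positivity)
    _ = (C * d / M) * ((2:ℝ) ^ p.1) ^ (-ρ) := by unfold tside; field_simp
    _ ≤ (ε * c) * ((2:ℝ) ^ p.1) ^ (-ρ) := by
        apply mul_le_mul_of_nonneg_right _ hX.le
        rw [div_le_iff₀ hMr]
        have : C * d / (ε * c) ≤ M := by linarith
        rw [div_le_iff₀ (by positivity)] at this
        linarith
    _ = ε * (c * ((2:ℝ) ^ p.1) ^ (-ρ)) := by ring
    _ ≤ _ := mul_le_mul_of_nonneg_left hlo hε.le

lemma far_facts {d : ℕ} {W : Ed d → ℝ} {ρ c C : ℝ} {K : ℕ} (h : WH d W ρ c C K) {δ : ℝ}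
    (hδ : 0 < δ) (G : ℝ) : ∃ k0, K ≤ k0 ∧ ∀ k, k0 ≤ k → ∀ x ∈ bx d (k+1), x ∉ bx d k →
      |W x| ≤ δ ∧ (∀ i, |pd i W x| ≤ δ * W x ^ 2) ∧ G / 2 ^ k ≤ |W x| := by
  have hc := h.c0
  have hC := h.C0
  have h1 := rpow_two_large h.ρ0 (C / δ)
  have h2 := rpow_two_large (sub_pos.2 h.ρ1) (C / (δ * c ^ 2))
  have h3 := rpow_two_large (sub_pos.2 h.ρ1) (G / c)
  obtain ⟨k0, hk0⟩ := eventually_atTop.1 (h1.and (h2.and h3))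
  refine ⟨max K k0, le_max_left _ _, fun k hk x hx hx' => ?_⟩
  obtain ⟨a1, a2, a3⟩ := hk0 k ((le_max_right _ _).trans hk)
  have hK : K ≤ k := (le_max_left _ _).trans hk
  have lo := h.lo k hK x hx hx'
  have up := h.up k hK x hx'
  have gr := h.gr k hK x hx'
  have hX : (0:ℝ) < (2:ℝ) ^ k := by positivity
  set X : ℝ := (2:ℝ) ^ k with hXd
  have e1 : X ^ (1 - ρ) = X * X ^ (-ρ) := by
    rw [sub_eq_add_neg, rpow_add hX, rpow_one]
  have e2 : X ^ ρ * X ^ (-ρ) = 1 := by rw [← rpow_add hX]; simp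
  have hY : 0 < X ^ (-ρ) := by positivity
  rw [e1] at a2 a3
  rw [div_le_iff₀ (by positivity)] at a1 a2 a3
  set Y := X ^ (-ρ) with hYd
  refine ⟨?_, ?_, ?_⟩
  · have := mul_le_mul_of_nonneg_right a1 hY.le
    have e3 : X ^ ρ * δ * Y = δ := by rw [mul_right_comm, e2, one_mul]
    linarith
  · intro i
    refine (norm_pd_le i W x).trans (gr.trans ?_)
    have e4 : (c * Y) ^ 2 ≤ W x ^ 2 := by
      rw [← sq_abs (W x)]; exact pow_le_pow_left₀ (by positivity) lo 2
    refine le_trans ?_ (mul_le_mul_of_nonneg_left e4 hδ.le)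
    rw [div_le_iff₀ hX]
    calc C * Y ≤ X * Y * (δ * c ^ 2) * Y := mul_le_mul_of_nonneg_right a2 hY.le
      _ = _ := by ring
  · refine le_trans ?_ lo
    rw [div_le_iff₀ hX]
    linarith

/-- classical density -/
def FF {d : ℕ} (W : Ed d → ℝ) (ψ₀ e : ℝ) (x : Ed d) : ℝ := √(ψ₀ * W x ^ 2 - e) ^ d
/-- classical density at zero energy -/
def AA {d : ℕ} (W : Ed d → ℝ) (ψ₀ : ℝ) (x : Ed d) : ℝ := (√ψ₀ * |W x|) ^ d

lemma continuous_FF {d : ℕ} {W : Ed d → ℝ} (hW : Continuous W) (ψ₀ e : ℝ) : Continuous (FF W ψ₀ e) := by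
  unfold FF; fun_prop
lemma continuous_AA {d : ℕ} {W : Ed d → ℝ} (hW : Continuous W) (ψ₀ : ℝ) : Continuous (AA W ψ₀) := by
  unfold AA; fun_prop

lemma sqrt_le_A {ψ₀ e w : ℝ} (hψ : 0 < ψ₀) (he : 0 ≤ e) : √(ψ₀ * w ^ 2 - e) ≤ √ψ₀ * |w| := by
  rw [← Real.sqrt_sq_eq_abs, ← Real.sqrt_mul hψ.le]
  exact Real.sqrt_le_sqrt (by linarith)

lemma FF_le_AA {d : ℕ} {W : Ed d → ℝ} {ψ₀ e : ℝ} (hψ : 0 < ψ₀) (he : 0 ≤ e) (x : Ed d) :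
    FF W ψ₀ e x ≤ AA W ψ₀ x := pow_le_pow_left₀ (Real.sqrt_nonneg _) (sqrt_le_A hψ he) d

lemma setInt_const_hcube {d : ℕ} (a : Ed d) {s : ℝ} (hs : 0 < s) (c : ℝ) :
    ∫ _ in hcube a s, c = s ^ d * c := by
  rw [setIntegral_const, measureReal_def, volume_hcube a hs.le, smul_eq_mul]

lemma upper_tile_int {d : ℕ} {W : Ed d → ℝ} (hW : Continuous W) {ψ₀ e t m s : ℝ} (hψ : 0 < ψ₀)
    (he : 0 ≤ e) (ht : 0 ≤ t) (hs : 0 < s) (a : Ed d)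
    (h : ∀ x ∈ hcube a s, √m + π * √d / s ≤ √(ψ₀ * W x ^ 2 - e) + t * (√ψ₀ * |W x|)) :
    (s * √m + π * √d) ^ d ≤
      ∫ x in hcube a s, (FF W ψ₀ e x + ((1 + t) ^ d - 1) * AA W ψ₀ x) := by
  have h1 : (s * √m + π * √d) ^ d = ∫ _ in hcube a s, (√m + π * √d / s) ^ d := by
    rw [setInt_const_hcube a hs, ← mul_pow]
    congr 1
    field_simp
  rw [h1]
  have hcF := continuous_FF hW ψ₀ e
  have hcA := continuous_AA hW ψ₀
  apply setIntegral_mono_on (integrableOn_hcube (by fun_prop) _ _) (integrableOn_hcube (by fun_prop) _ _)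
    (measurableSet_hcube _ _)
  intro x hx
  exact (pow_le_pow_left₀ (by positivity) (h x hx) d).trans
    (pow_pert d (Real.sqrt_nonneg _) (sqrt_le_A hψ he) ht)

lemma lower_tile_int {d : ℕ} {W : Ed d → ℝ} (hW : Continuous W) {ψ₀ e t m s : ℝ} (hψ : 0 < ψ₀)
    (ht : 0 ≤ t) (hs : 0 < s) (a : Ed d)
    (h : ∀ x ∈ hcube a s, √(ψ₀ * W x ^ 2 - e) + π * √d / s ≤ √m + t * (√ψ₀ * |W x|))
    (h' : ∀ x ∈ hcube a s, √m ≤ √ψ₀ * |W x|) :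
    ∫ x in hcube a s, FF W ψ₀ e x ≤ (max 0 (s * √m - π * √d)) ^ d +
      ((1 + t) ^ d - 1) * ∫ x in hcube a s, AA W ψ₀ x := by
  have h1 : (max 0 (s * √m - π * √d)) ^ d = ∫ _ in hcube a s, (max 0 (√m - π * √d / s)) ^ d := by
    rw [setInt_const_hcube a hs, ← mul_pow]
    congr 1
    rw [mul_max_of_nonneg _ _ hs.le, mul_zero]
    congr 1
    field_simp
  have hcF := continuous_FF hW ψ₀ e
  have hcA := continuous_AA hW ψ₀
  rw [h1, ← integral_const_mul, ← integral_add (integrableOn_hcube (by fun_prop) _ _)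
    (integrableOn_hcube (by fun_prop) _ _)]
  apply setIntegral_mono_on (integrableOn_hcube (by fun_prop) _ _) (integrableOn_hcube (by fun_prop) _ _)
    (measurableSet_hcube _ _)
  intro x hx
  have h2 : 0 ≤ π * √d / s := by positivity
  refine le_trans (pow_le_pow_left₀ (Real.sqrt_nonneg _) (?_ : _ ≤ max 0 (√m - π * √d / s) + t * (√ψ₀ * |W x|)) d)
    (pow_pert d (le_max_left _ _) ?_ ht)
  · have := h x hx
    have := le_max_right 0 (√m - π * √d / s)
    linarith
  · exact max_le (by positivity) (by linarith [h' x hx])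

lemma eps_choice (d : ℕ) {κ : ℝ} (hκ : 0 < κ) : ∃ ε : ℝ, 0 < ε ∧ ε ≤ 1 / 2 ∧
    (1 + (√((1 + ε) ^ 3 / (1 - ε) ^ 3 - 1) + ε)) ^ d - 1 ≤ κ ∧
    (1 + (√(1 - (1 - ε) ^ 3 / (1 + ε) ^ 3) + ε)) ^ d - 1 ≤ κ := by
  have c1 : ContinuousAt (fun ε : ℝ => (1 + (√((1 + ε) ^ 3 / (1 - ε) ^ 3 - 1) + ε)) ^ d - 1) 0 := by
    have : ContinuousAt (fun ε : ℝ => (1 + ε) ^ 3 / (1 - ε) ^ 3) 0 :=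
      ContinuousAt.div (by fun_prop) (by fun_prop) (by norm_num)
    fun_prop
  have c2 : ContinuousAt (fun ε : ℝ => (1 + (√(1 - (1 - ε) ^ 3 / (1 + ε) ^ 3) + ε)) ^ d - 1) 0 := by
    have : ContinuousAt (fun ε : ℝ => (1 - ε) ^ 3 / (1 + ε) ^ 3) 0 :=
      ContinuousAt.div (by fun_prop) (by fun_prop) (by norm_num)
    fun_prop
  have e1 := c1.eventually_lt_const (u := κ) (by simpa using hκ)
  have e2 := c2.eventually_lt_const (u := κ) (by simpa using hκ)
  have e3 : ∀ᶠ ε : ℝ in 𝓝 0, ε < 1 / 2 := eventually_lt_nhds (by norm_num)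
  have hh := ((e1.and (e2.and e3)).filter_mono (nhdsWithin_le_nhds (s := Ioi 0))).and self_mem_nhdsWithin
  obtain ⟨ε, ⟨h1, h2, h3⟩, h4⟩ := hh.exists
  exact ⟨ε, h4, h3.le, h1.le, h2.le⟩

/-- scalar estimate for the upper bound -/
lemma scalar_up {ψ₀ e ε w wx b : ℝ} (hψ : 0 < ψ₀) (hε : 0 < ε) (hε1 : ε ≤ 1 / 2)
    (hosc : |wx - w| ≤ ε * |w|) (hb : b ≤ ε * (√ψ₀ * |wx|)) :
    √(((1 + ε) ^ 3 * (ψ₀ * w ^ 2) - (1 - ε) * e) / (1 - ε)) + b ≤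
      √(ψ₀ * wx ^ 2 - e) + (√((1 + ε) ^ 3 / (1 - ε) ^ 3 - 1) + ε) * (√ψ₀ * |wx|) := by
  have h1 : (1 - ε) * |w| ≤ |wx| := by
    have := abs_sub_abs_le_abs_sub w wx
    rw [abs_sub_comm] at this
    linarith
  have h2 : (1 - ε) ^ 2 * w ^ 2 ≤ wx ^ 2 := by
    rw [← sq_abs w, ← sq_abs wx, ← mul_pow]
    exact pow_le_pow_left₀ (mul_nonneg (by linarith) (abs_nonneg _)) h1 2
  have hε' : 0 < 1 - ε := by linarith
  set θ := (1 + ε) ^ 3 / (1 - ε) ^ 3 with hθ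
  have hθ1 : 0 ≤ θ - 1 := by
    rw [hθ, sub_nonneg, one_le_div (by positivity)]
    exact pow_le_pow_left₀ hε'.le (by linarith) 3
  have h3 : ((1 + ε) ^ 3 * (ψ₀ * w ^ 2) - (1 - ε) * e) / (1 - ε) ≤ (ψ₀ * wx ^ 2 - e) + (θ - 1) * (ψ₀ * wx ^ 2) := by
    have h4 : (1 + ε) ^ 3 * (ψ₀ * w ^ 2) / (1 - ε) ≤ θ * (ψ₀ * wx ^ 2) := by
      rw [hθ, div_le_iff₀ hε']
      have : (1 + ε) ^ 3 / (1 - ε) ^ 3 * (ψ₀ * wx ^ 2) * (1 - ε) =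
        ((1 + ε) ^ 3 * ψ₀ / (1 - ε) ^ 2) * wx ^ 2 := by field_simp
      rw [this]
      refine le_trans (le_of_eq ?_) (mul_le_mul_of_nonneg_left h2 (by positivity))
      field_simp
    rw [sub_div, mul_div_cancel_left₀ _ hε'.ne']
    linarith
  have h5 := (Real.sqrt_le_sqrt h3).trans (sqrt_pert (by positivity))
  have h6 : √((θ - 1) * (ψ₀ * wx ^ 2)) = √(θ - 1) * (√ψ₀ * |wx|) := by
    rw [Real.sqrt_mul hθ1, Real.sqrt_mul hψ.le, Real.sqrt_sq_eq_abs]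
  rw [h6] at h5
  linarith

/-- scalar estimate for the lower bound -/
lemma scalar_lo {ψ₀ e ε w wx b : ℝ} (hψ : 0 < ψ₀) (he : 0 ≤ e) (hε : 0 < ε) (hε1 : ε ≤ 1 / 2)
    (hosc : |wx - w| ≤ ε * |w|) (hb : b ≤ ε * (√ψ₀ * |wx|)) :
    √(ψ₀ * wx ^ 2 - e) + b ≤ √(((1 - ε) ^ 3 * (ψ₀ * w ^ 2) - (1 + ε) * e) / (1 + ε)) +
      (√(1 - (1 - ε) ^ 3 / (1 + ε) ^ 3) + ε) * (√ψ₀ * |wx|) ∧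
    √(((1 - ε) ^ 3 * (ψ₀ * w ^ 2) - (1 + ε) * e) / (1 + ε)) ≤ √ψ₀ * |wx| := by
  have h1 : (1 - ε) * |w| ≤ |wx| := by
    have := abs_sub_abs_le_abs_sub w wx
    rw [abs_sub_comm] at this
    linarith
  have h1' : |wx| ≤ (1 + ε) * |w| := by
    have := abs_sub_abs_le_abs_sub wx w
    linarith
  have h2 : (1 - ε) ^ 2 * w ^ 2 ≤ wx ^ 2 := by
    rw [← sq_abs w, ← sq_abs wx, ← mul_pow]
    exact pow_le_pow_left₀ (mul_nonneg (by linarith) (abs_nonneg _)) h1 2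
  have h2' : wx ^ 2 ≤ (1 + ε) ^ 2 * w ^ 2 := by
    rw [← sq_abs w, ← sq_abs wx, ← mul_pow]
    exact pow_le_pow_left₀ (abs_nonneg _) h1' 2
  have hε' : 0 < 1 - ε := by linarith
  set θ := (1 - ε) ^ 3 / (1 + ε) ^ 3 with hθ
  have hθ1 : 0 ≤ 1 - θ := by
    rw [hθ, sub_nonneg, div_le_one (by positivity)]
    exact pow_le_pow_left₀ hε'.le (by linarith) 3
  constructor
  · have h3 : ψ₀ * wx ^ 2 - e ≤ ((1 - ε) ^ 3 * (ψ₀ * w ^ 2) - (1 + ε) * e) / (1 + ε) + (1 - θ) * (ψ₀ * wx ^ 2) := by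
      have h4 : θ * (ψ₀ * wx ^ 2) ≤ (1 - ε) ^ 3 * (ψ₀ * w ^ 2) / (1 + ε) := by
        rw [hθ]
        have : (1 - ε) ^ 3 / (1 + ε) ^ 3 * (ψ₀ * wx ^ 2) =
          ((1 - ε) ^ 3 * ψ₀ / (1 + ε) ^ 3) * wx ^ 2 := by field_simp
        rw [this]
        refine (mul_le_mul_of_nonneg_left h2' (by positivity)).trans (le_of_eq ?_)
        field_simp
      rw [sub_div, mul_div_cancel_left₀ _ (by positivity)]
      linarith
    have h5 := (Real.sqrt_le_sqrt h3).trans (sqrt_pert (by positivity))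
    have h6 : √((1 - θ) * (ψ₀ * wx ^ 2)) = √(1 - θ) * (√ψ₀ * |wx|) := by
      rw [Real.sqrt_mul hθ1, Real.sqrt_mul hψ.le, Real.sqrt_sq_eq_abs]
    rw [h6] at h5
    linarith
  · rw [← Real.sqrt_sq_eq_abs, ← Real.sqrt_mul hψ.le]
    apply Real.sqrt_le_sqrt
    rw [div_le_iff₀ (by positivity)]
    have h7 : (1 - ε) * (ψ₀ * ((1 - ε) ^ 2 * w ^ 2)) ≤ (1 - ε) * (ψ₀ * wx ^ 2) :=
      mul_le_mul_of_nonneg_left (mul_le_mul_of_nonneg_left h2 hψ.le) hε'.le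
    have h8 : 0 ≤ ψ₀ * wx ^ 2 := by positivity
    have h9 : 0 ≤ (1 + ε) * e := by positivity
    nlinarith

lemma sum_tiles_up {d M k0 k1 : ℕ} (hM : 0 < M) {f : Ed d → ℝ} (hf : Continuous f) {T : ℝ} (n : ℕ × (Fin d → ℤ) → ℝ)
    (h : ∀ p ∈ TS d M k0 k1, n p ≤ T * ∫ x in tcube M p, f x) :
    ∑ p ∈ TS d M k0 k1, n p ≤ T * ∫ x in bx d k1 \ bx d k0, f x := by
  rw [← sum_tcube hM hf, Finset.mul_sum]
  exact Finset.sum_le_sum h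

lemma bracket_upper {d : ℕ} {η φ χ W : Ed d → ℝ} {ψ₀ B : ℝ} (H : GH d η φ χ W ψ₀ B)
    {ρ c C : ℝ} {K : ℕ} (h : WH d W ρ c C K) {ε δ : ℝ} (hε : 0 < ε) (hε1 : ε ≤ 1 / 2)
    (hδ : ∀ (e : ℝ) (v : Ed d → ℝ) (x : Ed d), 0 ≤ e →
      |W x| ≤ δ → (∀ i, |pd i W x| ≤ δ * W x ^ 2) →
      (1 - ε) * gsq v x - ((1 + ε) * (ψ₀ * W x ^ 2) - (1 - ε) * e) * v x ^ 2 ≤ hd φ χ W ψ₀ e v x)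
    {M k0 : ℕ} (hM : 0 < M) (hK : K ≤ k0)
    (hosc : ∀ k1, ∀ p ∈ TS d M k0 k1, ∀ x ∈ tcube M p,
      |W x - W (tcorner M p)| ≤ ε * |W (tcorner M p)|)
    (hfar : ∀ k, k0 ≤ k → ∀ x ∈ bx d (k+1), x ∉ bx d k →
      |W x| ≤ δ ∧ (∀ i, |pd i W x| ≤ δ * W x ^ 2) ∧ (π * √d * M / (ε * √ψ₀)) / 2 ^ k ≤ |W x|) :
    ∃ Cc : ℝ, 0 ≤ Cc ∧ ∀ e k1, 0 < e → k0 ≤ k1 → 3 * ψ₀ * (C * ((2:ℝ) ^ k1) ^ (-ρ)) ^ 2 ≤ e →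
      schN d (fun x => η x * W x) (-e) ≠ ⊤ ∧
      ((schN d (fun x => η x * W x) (-e)).toNat : ℝ) ≤ Cc + tau d / (2 * π) ^ d *
        ∫ x in bx d k1 \ bx d k0, (FF W ψ₀ e x +
          ((1 + (√((1 + ε) ^ 3 / (1 - ε) ^ 3 - 1) + ε)) ^ d - 1) * AA W ψ₀ x) := by
  classical
  obtain ⟨c1, D, hc1, hD, hcore⟩ := hd_core H
  have hψ := H.ψpos
  have hcW : Continuous W := h.W1.continuous
  have hε' : 0 < 1 - ε := by linarith
  have hL0 : 0 < 2 * (2:ℝ) ^ k0 := by positivity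
  have hs : ∀ p : ℕ × (Fin d → ℤ), 0 < tside M p := fun p => by unfold tside; positivity
  refine ⟨((nset (d := d) hL0 (D / c1)).card : ℝ), by positivity, fun e k1 he hk hout => ?_⟩
  set m : ℕ × (Fin d → ℤ) → ℝ := fun p =>
    (1 + ε) ^ 3 * (ψ₀ * W (tcorner M p) ^ 2) - (1 - ε) * e with hm
  have hLL : ∀ q : Option {p // p ∈ TS d M k0 k1}, 0 < q.elim (2 * (2:ℝ) ^ k0) (fun p => tside M p.1) := by
    rintro (_ | p)
    · exact hL0
    · exact hs p.1
  have key := upper_tiles H (e := e) (ι := Option {p // p ∈ TS d M k0 k1})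
    (fun q => q.elim (WithLp.toLp 2 (fun _ : Fin d => -(2:ℝ) ^ k0)) (fun p => tcorner M p.1))
    (fun q => q.elim (2 * (2:ℝ) ^ k0) (fun p => tside M p.1)) hLL ?_
    (fun q => q.elim c1 (fun _ => 1 - ε)) (fun q => q.elim D (fun p => m p.1)) ?_ ?_ ?_
  · rw [Fintype.sum_option] at key
    simp only [Option.elim] at key
    have hne : schN d (fun x => η x * W x) (-e) ≠ ⊤ := ne_top_of_le_ne_top (ENat.natCast_ne_top _) key
    refine ⟨hne, ?_⟩
    have key2 := ENat.toNat_le_toNat key (ENat.natCast_ne_top _)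
    rw [ENat.toNat_natCast] at key2
    have key3 : ((schN d (fun x => η x * W x) (-e)).toNat : ℝ) ≤
      ((nset (d := d) hL0 (D / c1)).card : ℝ) +
        ∑ q : {p // p ∈ TS d M k0 k1}, ((nset (d := d) (hs q.1) (m q.1 / (1 - ε))).card : ℝ) := by
      exact_mod_cast key2
    refine key3.trans (add_le_add_right ?_ _)
    rw [Finset.sum_coe_sort (TS d M k0 k1) (fun q => ((nset (d := d) (hs q) (m q / (1 - ε))).card : ℝ))]
    have hcF := continuous_FF hcW ψ₀ e
    have hcA := continuous_AA hcW ψ₀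
    apply sum_tiles_up hM (by fun_prop)
    intro p hp
    refine (nset_card h.d1 (hs p) _).trans ?_
    apply mul_le_mul_of_nonneg_left _ (by have := tau_pos d; positivity)
    apply upper_tile_int hcW hψ he.le (by positivity) (hs p)
    intro x hx
    apply scalar_up hψ hε hε1 (hosc k1 p hp x hx)
    have hsh := tcube_shell hM hp hx
    have h3 := (hfar p.1 (mem_TS.1 hp).1.1 x hsh.1 hsh.2).2.2
    have hM' : (0:ℝ) < M := by exact_mod_cast hM
    have hsq : 0 < √ψ₀ := Real.sqrt_pos.2 hψ
    calc π * √d / tside M p = ε * √ψ₀ * ((π * √d * M / (ε * √ψ₀)) / 2 ^ p.1) := by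
          unfold tside; field_simp
      _ ≤ ε * √ψ₀ * |W x| := mul_le_mul_of_nonneg_left h3 (by positivity)
      _ = _ := by ring
  · rintro (_ | p) (_ | q) hpq
    · exact absurd rfl hpq
    · simp only [Option.elim]
      rw [← bx_eq_hcube, Set.disjoint_left]
      intro x hx hx'
      exact (tcube_shell hM q.2 hx').2 (bx_mono (mem_TS.1 q.2).1.1 hx)
    · simp only [Option.elim]
      rw [← bx_eq_hcube, Set.disjoint_right]
      intro x hx hx'
      exact (tcube_shell hM p.2 hx').2 (bx_mono (mem_TS.1 p.2).1.1 hx)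
    · exact tcube_disj hM p.2 q.2 (fun h => hpq (by rw [Subtype.ext h]))
  · rintro (_ | p)
    · exact hc1
    · exact hε'
  · rintro (_ | ⟨p, hp⟩) x hx v
    · exact hcore e v x he.le
    · simp only [Option.elim] at hx ⊢
      have hsh := tcube_shell hM hp hx
      have h3 := hfar p.1 (mem_TS.1 hp).1.1 x hsh.1 hsh.2
      refine le_trans ?_ (hδ e v x he.le h3.1 h3.2.1)
      have h1 : |W x| ≤ (1 + ε) * |W (tcorner M p)| := by
        have := abs_sub_abs_le_abs_sub (W x) (W (tcorner M p))
        have := hosc k1 p hp x hx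
        linarith
      have h2 : W x ^ 2 ≤ (1 + ε) ^ 2 * W (tcorner M p) ^ 2 := by
        rw [← sq_abs (W x), ← sq_abs (W (tcorner M p)), ← mul_pow]
        exact pow_le_pow_left₀ (abs_nonneg _) h1 2
      have h4 : (1 + ε) * (ψ₀ * W x ^ 2) - (1 - ε) * e ≤ m p := by
        have := mul_le_mul_of_nonneg_left h2 (by positivity : 0 ≤ (1 + ε) * ψ₀)
        simp only [hm]
        linarith
      have := mul_le_mul_of_nonneg_right h4 (sq_nonneg (v x))
      linarith
  · intro x hx v
    have hxk : x ∉ bx d k1 := by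
      intro hx1
      by_cases hx0 : x ∈ bx d k0
      · rw [bx_eq_hcube] at hx0
        exact hx none hx0
      · obtain ⟨p, hp, hxp⟩ := tcube_cover hM hx0 hx1
        exact hx (some ⟨p, hp⟩) hxp
    obtain ⟨k, hk1, hb, hnb⟩ := shell_of_notMem hxk
    have h3 := hfar k (hk.trans hk1) x hb hnb
    refine le_trans ?_ (hδ e v x he.le h3.1 h3.2.1)
    have hup := h.up k1 (hK.trans hk) x hxk
    have h2 : W x ^ 2 ≤ (C * ((2:ℝ) ^ k1) ^ (-ρ)) ^ 2 := by
      rw [← sq_abs (W x)]; exact pow_le_pow_left₀ (abs_nonneg _) hup 2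
    have h4 : 3 * (ψ₀ * W x ^ 2) ≤ e := by
      have := mul_le_mul_of_nonneg_left h2 (by positivity : 0 ≤ 3 * ψ₀)
      linarith
    have h5 : (1 + ε) * (ψ₀ * W x ^ 2) - (1 - ε) * e ≤ 0 := by
      have h6 : 0 ≤ ψ₀ * W x ^ 2 := by positivity
      nlinarith
    have h7 : 0 ≤ gsq v x := Finset.sum_nonneg fun i _ => sq_nonneg _
    have h8 := mul_nonneg hε'.le h7
    have h9 := mul_nonneg (neg_nonneg.2 h5) (sq_nonneg (v x))
    linarith

lemma bracket_lower {d : ℕ} {η φ χ W : Ed d → ℝ} {ψ₀ B : ℝ} (H : GH d η φ χ W ψ₀ B)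
    {ρ c C : ℝ} {K : ℕ} (h : WH d W ρ c C K) {ε δ : ℝ} (hε : 0 < ε) (hε1 : ε ≤ 1 / 2)
    (hδ : ∀ (e : ℝ) (v : Ed d → ℝ) (x : Ed d), 0 ≤ e →
      |W x| ≤ δ → (∀ i, |pd i W x| ≤ δ * W x ^ 2) →
      hd φ χ W ψ₀ e v x ≤ (1 + ε) * gsq v x - ((1 - ε) * (ψ₀ * W x ^ 2) - (1 + ε) * e) * v x ^ 2)
    {M k0 : ℕ} (hM : 0 < M)
    (hosc : ∀ k1, ∀ p ∈ TS d M k0 k1, ∀ x ∈ tcube M p,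
      |W x - W (tcorner M p)| ≤ ε * |W (tcorner M p)|)
    (hfar : ∀ k, k0 ≤ k → ∀ x ∈ bx d (k+1), x ∉ bx d k →
      |W x| ≤ δ ∧ (∀ i, |pd i W x| ≤ δ * W x ^ 2) ∧ (π * √d * M / (ε * √ψ₀)) / 2 ^ k ≤ |W x|)
    {e : ℝ} (k1 : ℕ) (he : 0 < e) (hne : schN d (fun x => η x * W x) (-e) ≠ ⊤) :
      tau d / (2 * π) ^ d * ∫ x in bx d k1 \ bx d k0, FF W ψ₀ e x ≤
      ((schN d (fun x => η x * W x) (-e)).toNat : ℝ) + tau d / (2 * π) ^ d *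
        (((1 + (√(1 - (1 - ε) ^ 3 / (1 + ε) ^ 3) + ε)) ^ d - 1) *
        ∫ x in bx d k1 \ bx d k0, AA W ψ₀ x) := by
  classical
  have hψ := H.ψpos
  have hcW : Continuous W := h.W1.continuous
  have hε' : 0 < 1 - ε := by linarith
  have hs : ∀ p : ℕ × (Fin d → ℤ), 0 < tside M p := fun p => by unfold tside; positivity
  set m : ℕ × (Fin d → ℤ) → ℝ := fun p =>
    (1 - ε) ^ 3 * (ψ₀ * W (tcorner M p) ^ 2) - (1 + ε) * e with hm
  have key := lower_tiles H (e := e) (ι := {p // p ∈ TS d M k0 k1})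
    (fun p => tcorner M p.1) (fun p => tside M p.1) (fun p => hs p.1)
    (fun p q hpq => tcube_disj hM p.2 q.2 (fun h => hpq (Subtype.ext h)))
    (fun _ => 1 + ε) (fun p => m p.1) (fun _ => by positivity) ?_
  · have key2 := ENat.toNat_le_toNat key hne
    rw [ENat.toNat_natCast] at key2
    have key3 : ∑ q : {p // p ∈ TS d M k0 k1}, ((dset (d := d) (hs q.1) (m q.1 / (1 + ε))).card : ℝ) ≤
      ((schN d (fun x => η x * W x) (-e)).toNat : ℝ) := by
      exact_mod_cast key2
    rw [Finset.sum_coe_sort (TS d M k0 k1) (fun q => ((dset (d := d) (hs q) (m q / (1 + ε))).card : ℝ))] at key3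
    have hcF := continuous_FF hcW ψ₀ e
    have hcA := continuous_AA hcW ψ₀
    refine le_trans ?_ (add_le_add_left key3 _)
    rw [← sum_tcube hM hcF, ← sum_tcube hM hcA, Finset.mul_sum, Finset.mul_sum, Finset.mul_sum,
      ← Finset.sum_add_distrib]
    apply Finset.sum_le_sum
    intro p hp
    refine le_trans ?_ (add_le_add_left (dset_card h.d1 (hs p) _) _)
    rw [← mul_add]
    apply mul_le_mul_of_nonneg_left _ (by have := tau_pos d; positivity)
    have hsc : ∀ x ∈ tcube M p, _ := fun x hx => by
      have hsh := tcube_shell hM hp hx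
      have h3 := (hfar p.1 (mem_TS.1 hp).1.1 x hsh.1 hsh.2).2.2
      have hM' : (0:ℝ) < M := by exact_mod_cast hM
      have hsq : 0 < √ψ₀ := Real.sqrt_pos.2 hψ
      have hb : π * √d / tside M p ≤ ε * (√ψ₀ * |W x|) := by
        calc π * √d / tside M p = ε * √ψ₀ * ((π * √d * M / (ε * √ψ₀)) / 2 ^ p.1) := by
              unfold tside; field_simp
          _ ≤ ε * √ψ₀ * |W x| := mul_le_mul_of_nonneg_left h3 (by positivity)
          _ = _ := by ring
      exact scalar_lo hψ he.le hε hε1 (hosc k1 p hp x hx) hb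
    exact lower_tile_int hcW hψ (by positivity) (hs p) _ (fun x hx => (hsc x hx).1)
      (fun x hx => (hsc x hx).2)
  · rintro ⟨p, hp⟩ x hx v
    have hsh := tcube_shell hM hp hx
    have h3 := hfar p.1 (mem_TS.1 hp).1.1 x hsh.1 hsh.2
    refine le_trans (hδ e v x he.le h3.1 h3.2.1) ?_
    have h1 : (1 - ε) * |W (tcorner M p)| ≤ |W x| := by
      have h0 := abs_sub_abs_le_abs_sub (W (tcorner M p)) (W x)
      rw [abs_sub_comm] at h0
      have := hosc k1 p hp x hx
      linarith
    have h2 : (1 - ε) ^ 2 * W (tcorner M p) ^ 2 ≤ W x ^ 2 := by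
      rw [← sq_abs (W x), ← sq_abs (W (tcorner M p)), ← mul_pow]
      exact pow_le_pow_left₀ (by positivity) h1 2
    have h4 : m p ≤ (1 - ε) * (ψ₀ * W x ^ 2) - (1 + ε) * e := by
      have := mul_le_mul_of_nonneg_left h2 (by positivity : 0 ≤ (1 - ε) * ψ₀)
      simp only [hm]
      linarith
    have := mul_le_mul_of_nonneg_right h4 (sq_nonneg (v x))
    simp only
    linarith

/-- combined bracketing -/
lemma bracket {d : ℕ} {η φ χ W : Ed d → ℝ} {ψ₀ B : ℝ} (H : GH d η φ χ W ψ₀ B)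
    {ρ c C : ℝ} {K : ℕ} (h : WH d W ρ c C K) {κ : ℝ} (hκ : 0 < κ) :
    ∃ (k0 : ℕ) (Cc : ℝ), K ≤ k0 ∧ 0 ≤ Cc ∧ ∀ e k1, 0 < e → k0 ≤ k1 →
      3 * ψ₀ * (C * ((2:ℝ) ^ k1) ^ (-ρ)) ^ 2 ≤ e →
      schN d (fun x => η x * W x) (-e) ≠ ⊤ ∧
      ((schN d (fun x => η x * W x) (-e)).toNat : ℝ) ≤ Cc + tau d / (2 * π) ^ d *
        ((∫ x in bx d k1 \ bx d k0, FF W ψ₀ e x) + κ * ∫ x in bx d k1 \ bx d k0, AA W ψ₀ x) ∧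
      tau d / (2 * π) ^ d * (∫ x in bx d k1 \ bx d k0, FF W ψ₀ e x) ≤
        ((schN d (fun x => η x * W x) (-e)).toNat : ℝ) + tau d / (2 * π) ^ d *
        (κ * ∫ x in bx d k1 \ bx d k0, AA W ψ₀ x) := by
  obtain ⟨ε, hε, hε1, hk1, hk2⟩ := eps_choice d hκ
  obtain ⟨δ, hδ0, hδ⟩ := hd_far H hε (by linarith)
  obtain ⟨M, hM, hosc⟩ := osc_tile h hε
  obtain ⟨k0, hK, hfar⟩ := far_facts h hδ0 (π * √d * M / (ε * √ψ₀))
  obtain ⟨Cc, hCc, hup⟩ := bracket_upper H h hε hε1 (fun e v x a b c => (hδ e v x a b c).1) hM hK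
    (fun k1 => hosc k0 k1 hK) hfar
  refine ⟨k0, Cc, hK, hCc, fun e k1 he hk hout => ?_⟩
  obtain ⟨hne, hu⟩ := hup e k1 he hk hout
  have hl := bracket_lower H h hε hε1 (fun e v x a b c => (hδ e v x a b c).2) hM
    (fun k1 => hosc k0 k1 hK) hfar k1 he hne
  have hcF := continuous_FF h.W1.continuous ψ₀ e
  have hcA := continuous_AA h.W1.continuous ψ₀
  have hT : 0 ≤ tau d / (2 * π) ^ d := by have := tau_pos d; positivity
  have hI : 0 ≤ ∫ x in bx d k1 \ bx d k0, AA W ψ₀ x :=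
    integral_nonneg fun x => by unfold AA; positivity
  have iF : IntegrableOn (FF W ψ₀ e) (bx d k1 \ bx d k0) := (integrableOn_bx hcF).mono_set sdiff_subset
  have iA : IntegrableOn (AA W ψ₀) (bx d k1 \ bx d k0) := (integrableOn_bx hcA).mono_set sdiff_subset
  refine ⟨hne, hu.trans ?_, hl.trans ?_⟩
  · rw [integral_add iF (iA.const_mul _), integral_const_mul]
    gcongr
  · gcongr

lemma AA_shell {d : ℕ} {W : Ed d → ℝ} {ψ₀ ρ c C : ℝ} {K : ℕ} (h : WH d W ρ c C K)
    {k : ℕ} (hk : K ≤ k) : ∫ x in bx d (k + 1) \ bx d k, AA W ψ₀ x ≤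
      (4 * √ψ₀ * C) ^ d * (((2:ℝ) ^ k) ^ (1 - ρ)) ^ d := by
  have hC := h.C0
  have hcA := continuous_AA h.W1.continuous ψ₀
  have hX : (0:ℝ) < (2:ℝ) ^ k := by positivity
  have iA : IntegrableOn (AA W ψ₀) (bx d (k + 1) \ bx d k) := (integrableOn_bx hcA).mono_set sdiff_subset
  have h1 : ∫ x in bx d (k + 1) \ bx d k, AA W ψ₀ x ≤
      ∫ _ in bx d (k + 1) \ bx d k, (√ψ₀ * (C * ((2:ℝ) ^ k) ^ (-ρ))) ^ d := by
    apply setIntegral_mono_on iA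
      ((integrableOn_bx continuous_const).mono_set sdiff_subset) (measurableSet_bx.diff measurableSet_bx)
    intro x hx
    have := h.up k hk x hx.2
    unfold AA
    gcongr
  refine h1.trans ?_
  have h2 : ∫ _ in bx d (k + 1) \ bx d k, (√ψ₀ * (C * ((2:ℝ) ^ k) ^ (-ρ))) ^ d ≤
      ∫ _ in bx d (k + 1), (√ψ₀ * (C * ((2:ℝ) ^ k) ^ (-ρ))) ^ d := by
    apply setIntegral_mono_set (integrableOn_bx continuous_const)
    · exact ae_of_all _ fun x => by positivity
    · exact (sdiff_subset).eventuallyLE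
  refine h2.trans (le_of_eq ?_)
  rw [setIntegral_const, measureReal_def, volume_bx, smul_eq_mul, ← mul_pow, ← mul_pow,
    sub_eq_add_neg, rpow_add hX, rpow_one, pow_succ]
  ring

lemma AA_int {d : ℕ} {W : Ed d → ℝ} {ψ₀ ρ c C : ℝ} {K : ℕ} (h : WH d W ρ c C K) (hψ : 0 < ψ₀) :
    ∃ KA : ℝ, 0 < KA ∧ ∀ k0 k1, K ≤ k0 → k0 ≤ k1 →
      ∫ x in bx d k1 \ bx d k0, AA W ψ₀ x ≤ KA * (((2:ℝ) ^ k1) ^ (1 - ρ)) ^ d := by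
  have hC := h.C0
  have hcA := continuous_AA h.W1.continuous ψ₀
  have hd0 : d ≠ 0 := by have := h.d1; omega
  set q : ℝ := ((2:ℝ) ^ (1 - ρ)) ^ d with hq
  have hq1 : 1 < q := one_lt_pow₀ (one_lt_rpow (by norm_num) (by linarith [h.ρ1])) hd0
  have hqk : ∀ k : ℕ, (((2:ℝ) ^ k) ^ (1 - ρ)) ^ d = q ^ k := by
    intro k
    rw [hq, ← pow_mul, mul_comm d k, pow_mul]
    congr 1
    rw [← rpow_natCast, ← rpow_natCast, ← rpow_mul (by norm_num), ← rpow_mul (by norm_num), mul_comm]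
  have hsψ : 0 < √ψ₀ := Real.sqrt_pos.2 hψ
  refine ⟨(4 * √ψ₀ * C) ^ d / (q - 1), div_pos (by positivity) (by linarith), fun k0 k1 hk hk1 => ?_⟩
  rw [hqk]
  induction k1, hk1 using Nat.le_induction with
  | base =>
    simp only [sdiff_self]
    have : 0 < q - 1 := by linarith
    simp
    positivity
  | succ k hk1 ih =>
    have h1 : bx d (k + 1) \ bx d k0 = (bx d k \ bx d k0) ∪ (bx d (k + 1) \ bx d k) := by
      ext x
      have a1 := @bx_mono d k (k+1) (by omega) x
      have a2 := @bx_mono d k0 k hk1 x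
      simp only [Set.mem_sdiff, mem_union]
      tauto
    have i1 : IntegrableOn (AA W ψ₀) (bx d (k + 1) \ bx d k) := (integrableOn_bx hcA).mono_set sdiff_subset
    have i2 : IntegrableOn (AA W ψ₀) (bx d k \ bx d k0) := (integrableOn_bx hcA).mono_set sdiff_subset
    rw [h1, setIntegral_union (by
      rw [Set.disjoint_left]; intro x hx hx'; exact hx'.2 hx.1) (measurableSet_bx.diff measurableSet_bx) i2 i1]
    have h2 := AA_shell (ψ₀ := ψ₀) h (hk.trans hk1)
    rw [hqk] at h2
    refine (add_le_add ih h2).trans (le_of_eq ?_)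
    have : q - 1 ≠ 0 := by linarith
    field_simp
    ring

/-- choice of outer scale -/
lemma scale_choice {d : ℕ} {ψ₀ ρ C : ℝ} (hψ : 0 < ψ₀) (hC : 0 < C) (hρ0 : 0 < ρ) (hρ1 : ρ < 1) :
    ∃ K2 : ℝ, 0 < K2 ∧ ∀ k0 : ℕ, ∃ e0 : ℝ, 0 < e0 ∧ ∀ e, 0 < e → e < e0 → ∃ k1, k0 ≤ k1 ∧
      3 * ψ₀ * (C * ((2:ℝ) ^ k1) ^ (-ρ)) ^ 2 ≤ e ∧
      (((2:ℝ) ^ k1) ^ (1 - ρ)) ^ d ≤ K2 * e ^ ((d:ℝ) / 2 * (1 - 1 / ρ)) := by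
  set S : ℝ := 3 * ψ₀ * C ^ 2 with hS
  have hSp : 0 < S := by positivity
  set G : ℝ := S ^ (1 / (2 * ρ)) with hG
  have hGp : 0 < G := by positivity
  refine ⟨((2 * G) ^ (1 - ρ)) ^ d, by positivity, fun k0 => ?_⟩
  have hlim : Tendsto (fun e : ℝ => e ^ (-(1 / (2 * ρ)))) (𝓝[>] 0) atTop :=
    tendsto_rpow_neg_nhdsGT_zero (by simp; positivity)
  have hev := hlim.eventually_ge_atTop ((2:ℝ) ^ k0 / G)
  obtain ⟨e0, he0, hsub⟩ := mem_nhdsGT_iff_exists_Ioo_subset.1 hev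
  refine ⟨e0, he0, fun e he hee => ?_⟩
  have hb : (2:ℝ) ^ k0 / G ≤ e ^ (-(1 / (2 * ρ))) := hsub ⟨he, hee⟩
  set r : ℝ := G * e ^ (-(1 / (2 * ρ))) with hr
  have hrk : (2:ℝ) ^ k0 ≤ r := by
    rw [div_le_iff₀ hGp] at hb; linarith
  have hr1 : 1 ≤ r := (one_le_pow₀ (by norm_num)).trans hrk
  obtain ⟨n, hn1, hn2⟩ := exists_nat_pow_near hr1 (by norm_num : (1:ℝ) < 2)
  have hr0 : 0 < r := by linarith
  refine ⟨n + 1, ?_, ?_, ?_⟩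
  · have : (2:ℝ) ^ k0 < 2 ^ (n + 1) := by linarith
    exact ((pow_lt_pow_iff_right₀ (by norm_num)).1 this).le
  · have h1 : ((2:ℝ) ^ (n + 1)) ^ (-ρ) ≤ r ^ (-ρ) :=
      rpow_le_rpow_of_nonpos hr0 hn2.le (by linarith)
    have h2 : S * (r ^ (-ρ)) ^ 2 = e := by
      rw [hr, mul_rpow hGp.le (by positivity), mul_pow, hG, ← rpow_natCast, ← rpow_natCast,
        ← rpow_mul hSp.le, ← rpow_mul hSp.le, ← rpow_mul he.le, ← rpow_mul he.le]
      have e1 : 1 / (2 * ρ) * -ρ * ((2:ℕ):ℝ) = -1 := by push_cast; field_simp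
      have e2 : -(1 / (2 * ρ)) * -ρ * ((2:ℕ):ℝ) = 1 := by push_cast; field_simp
      rw [e1, e2, rpow_neg_one, rpow_one]
      field_simp
    calc _ = S * (((2:ℝ) ^ (n + 1)) ^ (-ρ)) ^ 2 := by rw [hS]; ring
      _ ≤ S * (r ^ (-ρ)) ^ 2 := by gcongr
      _ = e := h2
  · have h1 : (2:ℝ) ^ (n + 1) ≤ 2 * r := by rw [pow_succ]; linarith
    have h2 : ((2:ℝ) ^ (n + 1)) ^ (1 - ρ) ≤ (2 * r) ^ (1 - ρ) :=
      rpow_le_rpow (by positivity) h1 (by linarith)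
    refine (pow_le_pow_left₀ (by positivity) h2 d).trans (le_of_eq ?_)
    rw [hr, ← mul_assoc, mul_rpow (by positivity) (by positivity), mul_pow]
    congr 1
    rw [← rpow_mul he.le, ← rpow_natCast, ← rpow_mul he.le]
    congr 1
    field_simp
    ring

lemma FF_zero_out {d : ℕ} {W : Ed d → ℝ} {ψ₀ ρ c C : ℝ} {K : ℕ} (h : WH d W ρ c C K) (hψ : 0 < ψ₀)
    {e : ℝ} {k1 : ℕ} (hk : K ≤ k1) (he : 3 * ψ₀ * (C * ((2:ℝ) ^ k1) ^ (-ρ)) ^ 2 ≤ e) {x : Ed d}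
    (hx : x ∉ bx d k1) : FF W ψ₀ e x = 0 := by
  have hup := h.up k1 hk x hx
  have h2 : W x ^ 2 ≤ (C * ((2:ℝ) ^ k1) ^ (-ρ)) ^ 2 := by
    rw [← sq_abs (W x)]; exact pow_le_pow_left₀ (abs_nonneg _) hup 2
  have h4 := mul_le_mul_of_nonneg_left h2 hψ.le
  have h5 : 0 ≤ ψ₀ * W x ^ 2 := by positivity
  unfold FF
  rw [Real.sqrt_eq_zero_of_nonpos (by linarith), zero_pow]
  have := h.d1; omega

lemma FF_split {d : ℕ} {W : Ed d → ℝ} {ψ₀ ρ c C : ℝ} {K : ℕ} (h : WH d W ρ c C K) (hψ : 0 < ψ₀)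
    {e : ℝ} {k0 k1 : ℕ} (hk : K ≤ k1) (hk0 : k0 ≤ k1) (he0 : 0 ≤ e)
    (he : 3 * ψ₀ * (C * ((2:ℝ) ^ k1) ^ (-ρ)) ^ 2 ≤ e) :
    Integrable (FF W ψ₀ e) ∧
    ∫ x in bx d k1 \ bx d k0, FF W ψ₀ e x ≤ ∫ x, FF W ψ₀ e x ∧
    ∫ x, FF W ψ₀ e x ≤ (∫ x in bx d k1 \ bx d k0, FF W ψ₀ e x) + ∫ x in bx d k0, AA W ψ₀ x := by
  have hcA := continuous_AA h.W1.continuous ψ₀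
  have hcF := continuous_FF h.W1.continuous ψ₀ e
  have hz : ∀ x, x ∉ bx d k1 → FF W ψ₀ e x = 0 := fun x hx => FF_zero_out h hψ hk he hx
  have hi : Integrable (FF W ψ₀ e) :=
    (integrableOn_iff_integrable_of_support_subset (fun x hx => by
      by_contra hn; exact hx (hz x hn))).1 (integrableOn_bx (k := k1) hcF)
  have e1 : ∫ x, FF W ψ₀ e x = ∫ x in bx d k1, FF W ψ₀ e x :=
    (setIntegral_eq_integral_of_forall_compl_eq_zero hz).symm
  have hnn : ∀ x, 0 ≤ FF W ψ₀ e x := fun x => by unfold FF; positivity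
  refine ⟨hi, setIntegral_le_integral hi (ae_of_all _ hnn), ?_⟩
  have e2 : ∫ x in bx d k1, FF W ψ₀ e x = (∫ x in bx d k1 \ bx d k0, FF W ψ₀ e x) + ∫ x in bx d k0, FF W ψ₀ e x := by
    rw [← setIntegral_union disjoint_sdiff_left measurableSet_bx hi.integrableOn hi.integrableOn,
      sdiff_union_of_subset (bx_mono hk0)]
  rw [e1, e2]
  exact add_le_add_right (setIntegral_mono_on (integrableOn_bx hcF) (integrableOn_bx hcA)
    measurableSet_bx fun x _ => FF_le_AA hψ he0 x) _

lemma FF_lower {d : ℕ} {W : Ed d → ℝ} {ψ₀ ρ c C : ℝ} {K : ℕ} (h : WH d W ρ c C K) (hψ : 0 < ψ₀) :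
    ∃ cJ : ℝ, 0 < cJ ∧ ∃ e0 : ℝ, 0 < e0 ∧ ∀ e, 0 < e → e < e0 → Integrable (FF W ψ₀ e) →
      cJ * e ^ ((d:ℝ) / 2 * (1 - 1 / ρ)) ≤ ∫ x, FF W ψ₀ e x := by
  have hc := h.c0
  have hρ0 := h.ρ0
  have hd0 : (0:ℝ) < d := by exact_mod_cast h.d1
  set S : ℝ := ψ₀ * c ^ 2 / 2 with hS
  have hSp : 0 < S := by positivity
  set g : ℝ := S ^ (1 / (2 * ρ)) / (2 * d) with hg
  have hgp : 0 < g := by positivity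
  refine ⟨g ^ d, by positivity, ?_⟩
  have hlim : Tendsto (fun e : ℝ => e ^ (-(1 / (2 * ρ)))) (𝓝[>] 0) atTop :=
    tendsto_rpow_neg_nhdsGT_zero (by simp; positivity)
  have hev := hlim.eventually_ge_atTop ((2:ℝ) ^ K / g)
  obtain ⟨e0, he0, hsub⟩ := mem_nhdsGT_iff_exists_Ioo_subset.1 hev
  refine ⟨e0, he0, fun e he hee hi => ?_⟩
  have hb : (2:ℝ) ^ K / g ≤ e ^ (-(1 / (2 * ρ))) := hsub ⟨he, hee⟩
  set s : ℝ := g * e ^ (-(1 / (2 * ρ))) with hs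
  have hrk : (2:ℝ) ^ K ≤ s := by
    rw [div_le_iff₀ hgp] at hb; linarith
  have hs0 : 0 < s := by positivity
  have hnn : ∀ x, 0 ≤ FF W ψ₀ e x := fun x => by unfold FF; positivity
  have hcF := continuous_FF h.W1.continuous ψ₀ e
  refine le_trans ?_ (setIntegral_le_integral (s := hcube (WithLp.toLp 2 (fun _ : Fin d => s)) s) hi (ae_of_all _ hnn))
  have h1 : g ^ d * e ^ ((d:ℝ) / 2 * (1 - 1 / ρ)) = ∫ _ in hcube (WithLp.toLp 2 (fun _ : Fin d => s)) s, √e ^ d := by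
    rw [setInt_const_hcube _ hs0, hs, mul_pow, mul_assoc, Real.sqrt_eq_rpow, ← mul_pow,
      ← rpow_add he, ← rpow_natCast (e ^ _), ← rpow_mul he.le]
    congr 2
    field_simp
    ring
  rw [h1]
  apply setIntegral_mono_on (integrableOn_hcube continuous_const _ _) (integrableOn_hcube hcF _ _)
    (measurableSet_hcube _ _)
  intro x hx
  unfold FF
  apply pow_le_pow_left₀ (Real.sqrt_nonneg _)
  apply Real.sqrt_le_sqrt
  have hxK : x ∉ bx d K := by
    intro hxb
    have a1 := (hxb ⟨0, h.d1⟩).2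
    have a2 := (hx ⟨0, h.d1⟩).1
    simp only at a2
    linarith
  obtain ⟨k, hk, b1, b2⟩ := shell_of_notMem hxK
  have hlo := h.lo k hk x b1 b2
  have hn1 := norm_ge_of_notMem_bx b2
  have hn2 : ‖x‖ ≤ d * (2 * s) := norm_le_of_coord (by positivity) fun i => by
    have := hx i
    simp only at this
    rw [abs_le]
    constructor <;> linarith [this.1, this.2]
  have h2 : ((d:ℝ) * (2 * s)) ^ (-ρ) ≤ ((2:ℝ) ^ k) ^ (-ρ) :=
    rpow_le_rpow_of_nonpos (by positivity) (hn1.trans hn2) (by linarith)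
  have h3 : (c * ((d:ℝ) * (2 * s)) ^ (-ρ)) ^ 2 ≤ W x ^ 2 := by
    rw [← sq_abs (W x)]
    exact pow_le_pow_left₀ (by positivity) ((mul_le_mul_of_nonneg_left h2 hc.le).trans hlo) 2
  have h4 : (((d:ℝ) * (2 * s)) ^ (-ρ)) ^ 2 = e / S := by
    have : (d:ℝ) * (2 * s) = S ^ (1 / (2 * ρ)) * e ^ (-(1 / (2 * ρ))) := by
      rw [hs, hg]; field_simp
    rw [this, mul_rpow (by positivity) (by positivity), mul_pow, ← rpow_natCast, ← rpow_natCast,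
        ← rpow_mul hSp.le, ← rpow_mul hSp.le, ← rpow_mul he.le, ← rpow_mul he.le]
    have e1 : 1 / (2 * ρ) * -ρ * ((2:ℕ):ℝ) = -1 := by push_cast; field_simp
    have e2 : -(1 / (2 * ρ)) * -ρ * ((2:ℕ):ℝ) = 1 := by push_cast; field_simp
    rw [e1, e2, rpow_neg_one, rpow_one]
    field_simp
  rw [mul_pow, h4] at h3
  have h5 := mul_le_mul_of_nonneg_left h3 hψ.le
  have h6 : ψ₀ * (c ^ 2 * (e / S)) = 2 * e := by rw [hS]; field_simp
  linarith

lemma Ncl_eq {d : ℕ} (W : Ed d → ℝ) (ψ₀ e : ℝ) :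
    Ncl d (fun x => -ψ₀ * W x ^ 2) (-e) = tau d / (2 * π) ^ d * ∫ x, FF W ψ₀ e x := by
  unfold Ncl FF
  congr 2
  funext x
  have h1 : -e - -ψ₀ * W x ^ 2 = ψ₀ * W x ^ 2 - e := by ring
  rw [h1, rpow_div_two_eq_sqrt _ (le_max_right _ _), rpow_natCast]
  congr 1
  rcases le_total 0 (ψ₀ * W x ^ 2 - e) with h | h
  · rw [max_eq_left h]
  · rw [max_eq_right h, Real.sqrt_zero, Real.sqrt_eq_zero_of_nonpos h]

lemma asymp {d : ℕ} {η φ χ W : Ed d → ℝ} {ψ₀ B : ℝ} (H : GH d η φ χ W ψ₀ B)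
    {ρ c C : ℝ} {K : ℕ} (h : WH d W ρ c C K) :
    ∃ cJ CJ : ℝ, 0 < cJ ∧ 0 < CJ ∧ ∀ κ : ℝ, 0 < κ → ∃ Cc e0 : ℝ, 0 ≤ Cc ∧ 0 < e0 ∧
      ∀ e, 0 < e → e < e0 → schN d (fun x => η x * W x) (-e) ≠ ⊤ ∧
        |((schN d (fun x => η x * W x) (-e)).toNat : ℝ) - Ncl d (fun x => -ψ₀ * W x ^ 2) (-e)| ≤
          Cc + κ * e ^ ((d:ℝ) / 2 * (1 - 1 / ρ)) ∧
        cJ * e ^ ((d:ℝ) / 2 * (1 - 1 / ρ)) ≤ Ncl d (fun x => -ψ₀ * W x ^ 2) (-e) ∧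
        Ncl d (fun x => -ψ₀ * W x ^ 2) (-e) ≤ Cc + CJ * e ^ ((d:ℝ) / 2 * (1 - 1 / ρ)) := by
  have hψ := H.ψpos
  obtain ⟨KA, hKA, hAA⟩ := AA_int h hψ
  obtain ⟨K2, hK2, hsc⟩ := scale_choice (d := d) hψ h.C0 h.ρ0 h.ρ1
  obtain ⟨cJ, hcJ, e1, he1, hlow⟩ := FF_lower h hψ
  set T : ℝ := tau d / (2 * π) ^ d with hT
  have hTp : 0 < T := by have := tau_pos d; positivity
  refine ⟨T * cJ, T * (KA * K2), by positivity, by positivity, fun κ hκ => ?_⟩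
  obtain ⟨k0, Cc, hk0, hCc, hbr⟩ := bracket H h (κ := κ / (T * (KA * K2))) (by positivity)
  obtain ⟨e2, he2, hch⟩ := hsc k0
  have hA0 : 0 ≤ ∫ x in bx d k0, AA W ψ₀ x := integral_nonneg fun x => by unfold AA; positivity
  set A0 := ∫ x in bx d k0, AA W ψ₀ x with hA0d
  refine ⟨Cc + T * A0, min e1 e2, by positivity, lt_min he1 he2, fun e he hee => ?_⟩
  obtain ⟨k1, hk1, hout, hsz⟩ := hch e he (hee.trans_le (min_le_right _ _))
  obtain ⟨hne, hu, hl⟩ := hbr e k1 he hk1 hout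
  obtain ⟨hi, hs1, hs2⟩ := FF_split (k0 := k0) h hψ (hk0.trans hk1) hk1 he.le hout
  have hlo := hlow e he (hee.trans_le (min_le_left _ _)) hi
  have hIA := hAA k0 k1 hk0 hk1
  rw [Ncl_eq, ← hT]
  set Φ : ℝ := e ^ ((d:ℝ) / 2 * (1 - 1 / ρ)) with hΦ
  have hΦp : 0 < Φ := by positivity
  set N : ℝ := ((schN d (fun x => η x * W x) (-e)).toNat : ℝ) with hN
  set J := ∫ x, FF W ψ₀ e x with hJ
  set I := ∫ x in bx d k1 \ bx d k0, FF W ψ₀ e x with hI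
  set IA := ∫ x in bx d k1 \ bx d k0, AA W ψ₀ x with hIAd
  have hIA2 : IA ≤ KA * K2 * Φ := by
    refine hIA.trans ?_
    rw [mul_assoc]
    exact mul_le_mul_of_nonneg_left hsz hKA.le
  have hκI : T * (κ / (T * (KA * K2)) * IA) ≤ κ * Φ := by
    calc _ ≤ T * (κ / (T * (KA * K2)) * (KA * K2 * Φ)) := by gcongr
      _ = _ := by field_simp
  have hTI := mul_le_mul_of_nonneg_left hs1 hTp.le
  have hTJ := mul_le_mul_of_nonneg_left hs2 hTp.le
  have hIle : I ≤ IA := by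
    have hcF := continuous_FF h.W1.continuous ψ₀ e
    have hcA := continuous_AA h.W1.continuous ψ₀
    exact setIntegral_mono_on hi.integrableOn ((integrableOn_bx hcA).mono_set sdiff_subset)
      (measurableSet_bx.diff measurableSet_bx) fun x _ => FF_le_AA hψ he.le x
  have hTA : 0 ≤ T * A0 := by positivity
  refine ⟨hne, ?_, ?_, ?_⟩
  · rw [abs_le]
    constructor <;> linarith
  · rw [mul_assoc]; exact mul_le_mul_of_nonneg_left hlo hTp.le
  · have := mul_le_mul_of_nonneg_left (hIle.trans hIA2) hTp.le
    linarith

lemma mk_WH {d : ℕ} (hd1 : 1 ≤ d) {ρ : ℝ} (hρ : ρ ∈ Set.Ioo (0 : ℝ) 1) {W : Ed d → ℝ} (hW : SClass d 2 ρ W)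
    {C R : ℝ} (hC : 0 < C) (hWlow : ∀ x : Ed d, R ≤ ‖x‖ → C * ‖x‖ ^ (-(2 * ρ)) ≤ W x ^ 2) :
    ∃ c C' K, WH d W ρ c C' K := by
  obtain ⟨hcd, C', hC', hb⟩ := hW
  have hd0 : (0:ℝ) < d := by exact_mod_cast hd1
  have hρ0 := hρ.1
  obtain ⟨K, hK⟩ := pow_unbounded_of_one_lt R (by norm_num : (1:ℝ) < 2)
  refine ⟨√C * (2 * d) ^ (-ρ), C', K, ⟨hd1, hρ.1, hρ.2, by positivity, hC',
    hcd.of_le (by norm_num), ?_, ?_, ?_⟩⟩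
  · intro k hk x hx hx'
    have h1 := norm_ge_of_notMem_bx hx'
    have h2 := norm_le_of_mem_bx hx
    have hX : (0:ℝ) < 2 ^ k := by positivity
    have hRx : R ≤ ‖x‖ := hK.le.trans ((pow_le_pow_right₀ (by norm_num) hk).trans h1)
    have hx0 : 0 < ‖x‖ := hX.trans_le h1
    have h3 : (2 * (d:ℝ) * 2 ^ k) ^ (-ρ) ≤ ‖x‖ ^ (-ρ) :=
      rpow_le_rpow_of_nonpos hx0 (h2.trans (le_of_eq (by rw [pow_succ]; ring))) (by linarith)
    rw [mul_rpow (by positivity) (by positivity)] at h3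
    rw [mul_assoc]
    refine (mul_le_mul_of_nonneg_left h3 (Real.sqrt_nonneg C)).trans ?_
    apply le_of_sq_le_sq _ (abs_nonneg _)
    rw [sq_abs, mul_pow, Real.sq_sqrt hC.le, ← rpow_natCast, ← rpow_mul hx0.le]
    refine le_trans (le_of_eq ?_) (hWlow x hRx)
    congr 2
    push_cast; ring
  · intro k hk x hx'
    have h1 := norm_ge_of_notMem_bx hx'
    have hX : (0:ℝ) < 2 ^ k := by positivity
    have h2 := hb 0 (by norm_num) x
    rw [norm_iteratedFDeriv_zero, Real.norm_eq_abs] at h2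
    refine h2.trans (mul_le_mul_of_nonneg_left ?_ hC'.le)
    simp only [Nat.cast_zero, sub_zero]
    exact rpow_le_rpow_of_nonpos hX (by linarith) (by linarith)
  · intro k hk x hx'
    have h1 := norm_ge_of_notMem_bx hx'
    have hX : (0:ℝ) < 2 ^ k := by positivity
    have h2 := hb 1 (by norm_num) x
    rw [norm_iteratedFDeriv_one] at h2
    refine h2.trans ?_
    rw [mul_div_assoc, ← rpow_sub_one hX.ne']
    refine mul_le_mul_of_nonneg_left ?_ hC'.le
    simp only [Nat.cast_one]
    exact rpow_le_rpow_of_nonpos hX (by linarith) (by linarith)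

lemma mk_GH {d : ℕ} {ρ : ℝ} (hρ : ρ ∈ Set.Ioo (0 : ℝ) 1)
    {η φ : Ed d → ℝ} (hη : IsAdmissible d η 0 φ) {ψ₀ : ℝ} (hψ₀ : 0 < ψ₀) {χ : Ed d → ℝ}
    (hψ : IsAdmissible d (fun x => ‖gradient φ x‖ ^ 2) ψ₀ χ)
    {W : Ed d → ℝ} (hW : SClass d 2 ρ W) : ∃ B, GH d η φ χ W ψ₀ B := by
  obtain ⟨hcd, C', hC', hb⟩ := hW
  obtain ⟨a0, ha0⟩ := hη.bounded 0 (by norm_num)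
  obtain ⟨a1, ha1⟩ := hη.bounded 1 (by norm_num)
  obtain ⟨b1, hb1⟩ := hψ.bounded 1 (by norm_num)
  simp only [norm_iteratedFDeriv_zero, norm_iteratedFDeriv_one, Real.norm_eq_abs] at ha0 ha1 hb1
  have a0n := (abs_nonneg _).trans (ha0 0)
  have a1n := (norm_nonneg _).trans (ha1 0)
  have b1n := (norm_nonneg _).trans (hb1 0)
  have hWk : ∀ k : ℕ, k ≤ 2 → ∀ x, ‖iteratedFDeriv ℝ k W x‖ ≤ C' := fun k hk x => by
    refine (hb k hk x).trans ?_
    have : (1 + ‖x‖) ^ (-ρ - (k:ℝ)) ≤ 1 :=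
      rpow_le_one_of_one_le_of_nonpos (by linarith [norm_nonneg x]) (by
        have : (0:ℝ) ≤ k := by positivity
        linarith [hρ.1])
    nlinarith
  have hW0 := hWk 0 (by norm_num)
  have hW1 := hWk 1 (by norm_num)
  simp only [norm_iteratedFDeriv_zero, norm_iteratedFDeriv_one, Real.norm_eq_abs] at hW0 hW1
  refine ⟨1 + a0 + a1 + b1 + C', ⟨hη.smooth, hψ.smooth, hcd, by linarith, hψ₀, ?_, ?_, ?_, ?_, ?_, ?_, ?_⟩⟩
  · exact fun x => (ha0 x).trans (by linarith)
  · exact fun x => (hW0 x).trans (by linarith)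
  · exact fun i x => (norm_pd_le i φ x).trans ((ha1 x).trans (by linarith))
  · exact fun i x => (norm_pd_le i χ x).trans ((hb1 x).trans (by linarith))
  · exact fun i x => (norm_pd_le i W x).trans ((hW1 x).trans (by linarith))
  · intro x
    rw [← lap_eq hη.smooth, hη.poisson, sub_zero]
  · intro x
    rw [← lap_eq hψ.smooth, hψ.poisson, norm_gradient_sq]

/-- Theorem 3.2 (i): eigenvalue asymptotics for vanishing mean value, `ρ ∈ (0,1)`, governed
by the effective Hamiltonian `-Δ - ψ₀ W²`. -/
theorem eigenvalue_asymptotics_zero_mean_effective_hamiltonian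
    (d : ℕ) (hd : 1 ≤ d) (ρ : ℝ) (hρ : ρ ∈ Set.Ioo (0 : ℝ) 1)
    (η φ : Ed d → ℝ) (hη : IsAdmissible d η 0 φ)
    (ψ₀ : ℝ) (hψ₀ : 0 < ψ₀) (χ : Ed d → ℝ)
    (hψ : IsAdmissible d (fun x => ‖gradient φ x‖ ^ 2) ψ₀ χ)
    (W : Ed d → ℝ) (hW : SClass d 2 ρ W)
    (C R : ℝ) (hC : 0 < C) (hR : 0 < R)
    (hWlow : ∀ x : Ed d, R ≤ ‖x‖ → C * ‖x‖ ^ (-(2 * ρ)) ≤ W x ^ 2) :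
    Tendsto (fun E : ℝ =>
        ((schN d (fun x => η x * W x) E).toNat : ℝ) / Ncl d (fun x => -ψ₀ * W x ^ 2) E)
      (𝓝[<] 0) (𝓝 1) ∧
    ∃ c₁ c₂ : ℝ, 0 < c₁ ∧ 0 < c₂ ∧ ∃ E₀ : ℝ, E₀ < 0 ∧ ∀ E ∈ Set.Ioo E₀ (0 : ℝ),
      schN d (fun x => η x * W x) E ≠ ⊤ ∧
      c₁ * |E| ^ (((d : ℝ) / 2) * (1 - 1 / ρ)) ≤ ((schN d (fun x => η x * W x) E).toNat : ℝ) ∧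
      ((schN d (fun x => η x * W x) E).toNat : ℝ) ≤ c₂ * |E| ^ (((d : ℝ) / 2) * (1 - 1 / ρ)) := by
  obtain ⟨B, H⟩ := mk_GH hρ hη hψ₀ hψ hW
  obtain ⟨c, C', K, h⟩ := mk_WH hd hρ hW hC hWlow
  obtain ⟨cJ, CJ, hcJ, hCJ, has⟩ := asymp H h
  have hp : (d:ℝ) / 2 * (1 - 1 / ρ) < 0 := by
    have h1 : (0:ℝ) < d := by exact_mod_cast hd
    have h2 : 1 < 1 / ρ := by rw [lt_div_iff₀ hρ.1]; linarith [hρ.2]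
    exact mul_neg_of_pos_of_neg (by positivity) (by linarith)
  set p : ℝ := (d:ℝ) / 2 * (1 - 1 / ρ) with hpd
  have hlim : Tendsto (fun e : ℝ => e ^ p) (𝓝[>] 0) atTop := tendsto_rpow_neg_nhdsGT_zero hp
  have hbig : ∀ Y : ℝ, ∃ e0 : ℝ, 0 < e0 ∧ ∀ e, 0 < e → e < e0 → Y ≤ e ^ p := fun Y => by
    obtain ⟨e0, he0, hsub⟩ := mem_nhdsGT_iff_exists_Ioo_subset.1 (hlim.eventually_ge_atTop Y)
    exact ⟨e0, he0, fun e h1 h2 => hsub ⟨h1, h2⟩⟩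
  constructor
  · rw [Metric.tendsto_nhds]
    intro ε hε
    obtain ⟨Cc, e0, hCc, he0, hall⟩ := has (ε * cJ / 4) (by positivity)
    obtain ⟨e1, he1, hY⟩ := hbig (4 * Cc / (ε * cJ))
    have hmem : Ioo (-(min e0 e1)) 0 ∈ 𝓝[<] (0:ℝ) := Ioo_mem_nhdsLT (by simp [he0, he1])
    filter_upwards [hmem] with E hE
    obtain ⟨-, h1, h2, -⟩ := hall (-E) (by linarith [hE.2]) (by
      have := hE.1; have := min_le_left e0 e1; linarith)
    have h3 := hY (-E) (by linarith [hE.2]) (by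
      have := hE.1; have := min_le_right e0 e1; linarith)
    rw [neg_neg] at h1 h2
    have hΦ : 0 < (-E) ^ p := rpow_pos_of_pos (by linarith [hE.2]) _
    set J := Ncl d (fun x => -ψ₀ * W x ^ 2) E
    have hJ : 0 < J := lt_of_lt_of_le (by positivity) h2
    rw [Real.dist_eq, div_sub_one hJ.ne', abs_div, abs_of_pos hJ, div_lt_iff₀ hJ]
    refine h1.trans_lt ?_
    rw [div_le_iff₀ (by positivity)] at h3
    have h4 := mul_le_mul_of_nonneg_left h2 hε.le
    have h5 : 0 < ε * cJ * (-E) ^ p := by positivity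
    linarith
  · obtain ⟨Cc, e0, hCc, he0, hall⟩ := has (cJ / 4) (by positivity)
    obtain ⟨e1, he1, hY⟩ := hbig (4 * Cc / cJ)
    refine ⟨cJ / 2, CJ + 3 * cJ, by positivity, by positivity, -(min e0 e1), by simp [he0, he1], fun E hE => ?_⟩
    obtain ⟨h0, h1, h2, h2'⟩ := hall (-E) (by linarith [hE.2]) (by
      have := hE.1; have := min_le_left e0 e1; linarith)
    have h3 := hY (-E) (by linarith [hE.2]) (by
      have := hE.1; have := min_le_right e0 e1; linarith)
    rw [neg_neg] at h0 h1 h2 h2'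
    rw [abs_of_neg hE.2]
    have hΦ : 0 < (-E) ^ p := rpow_pos_of_pos (by linarith [hE.2]) _
    rw [div_le_iff₀ (by positivity)] at h3
    have h6 := abs_le.1 h1
    have h5 : 0 < cJ * (-E) ^ p := by positivity
    exact ⟨h0, by linarith [h6.1], by linarith [h6.2]⟩

end
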